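/- arXiv:1711.07710 — 13 statements merged into one kernel-verified Lean document; each statement's English description precedes it below -/
import Mathlib

section
/- Let n ≥ 1 be an integer, let h_1, …, h_n be positive reals (item heights), and let ε ∈ (0, 1] be such that m := 1/ε is a positive integer. Define finite sets of reals T^r recursively: T^1 = { a·h_j/(2n) : j ∈ {1,…,n}, a ∈ ℕ, 1 ≤ a ≤ 4n² }, and for r > 1, T^r = { a·h_j/2 + Σ_{k=1}^{b} h_{j_k} + Σ_{k=1}^{c} s_k : j ∈ {1,…,n}, a ∈ ℕ with 0 ≤ a ≤ 2n−1, 0 ≤ b ≤ m−1, j_1,…,j_b ∈ {1,…,n}, 0 ≤ c ≤ m, s_1,…,s_c ∈ T^{r−1} }. Then for every integer r ≥ 1, |T^r| ≤ (2n)^{(r+2+(r−1)ε)/ε^{r−1}}. -/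
/-- All sums of at most `m` elements of `S` lie in one finite set of at most `(|S| + 1) ^ m` reals. -/
theorem exists_finset_sums_of_card_le (S : Finset ℝ) (m : ℕ) :
    ∃ A : Finset ℝ, A.card ≤ (S.card + 1) ^ m ∧
      ∀ c ≤ m, ∀ s : Fin c → ℝ, (∀ k, s k ∈ S) → ∑ k, s k ∈ A := by
  classical
  refine ⟨(Fintype.piFinset fun _ : Fin m => insert 0 S).image fun t => ∑ k, t k, ?_, ?_⟩
  · refine Finset.card_image_le.trans ?_
    rw [Fintype.card_piFinset_const]
    exact Nat.pow_le_pow_left (Finset.card_insert_le _ _) _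
  · intro c hc s hs
    obtain ⟨d, rfl⟩ := Nat.exists_eq_add_of_le hc
    refine Finset.mem_image.2 ⟨Fin.append s fun _ => 0, ?_, ?_⟩
    · refine Fintype.mem_piFinset.2 fun k => ?_
      induction k using Fin.addCases with
      | left k => simpa using Or.inr (hs k)
      | right k => simp
    · simp [Fin.sum_univ_add]

open scoped Pointwise in
/-- One step of the recursion: the candidates built from a finite set `F` lie in a finite set
of controlled size. -/
theorem exists_finset_candidates_succ (n : ℕ) (h : Fin n → ℝ) (m : ℕ) (F : Finset ℝ) :
    ∃ G : Finset ℝ, G.card ≤ n * (2 * n) * (n + 1) ^ (m - 1) * (F.card + 1) ^ m ∧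
      ∀ (j : Fin n) (a : ℕ), a ≤ 2 * n - 1 → ∀ b ≤ m - 1, ∀ js : Fin b → Fin n,
        ∀ c ≤ m, ∀ s : Fin c → ℝ, (∀ k, s k ∈ F) →
          (a : ℝ) * (h j / 2) + (∑ k, h (js k)) + (∑ k, s k) ∈ G := by
  classical
  obtain ⟨A, hA, hA'⟩ := exists_finset_sums_of_card_le (Finset.univ.image h) (m - 1)
  obtain ⟨B, hB, hB'⟩ := exists_finset_sums_of_card_le F m
  have hh : (Finset.univ.image h).card ≤ n := by
    simpa using Finset.card_image_le (s := Finset.univ) (f := h)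
  let C : Finset ℝ := (Finset.univ ×ˢ Finset.range (2 * n)).image
    fun p : Fin n × ℕ => (p.2 : ℝ) * (h p.1 / 2)
  have hC : C.card ≤ n * (2 * n) := Finset.card_image_le.trans (by simp)
  refine ⟨C + A + B, ?_, ?_⟩
  · calc (C + A + B).card ≤ C.card * A.card * B.card :=
          Finset.card_add_le.trans (Nat.mul_le_mul_right _ Finset.card_add_le)
      _ ≤ n * (2 * n) * (n + 1) ^ (m - 1) * (F.card + 1) ^ m := by
          have hA'' : A.card ≤ (n + 1) ^ (m - 1) :=
            hA.trans (Nat.pow_le_pow_left (Nat.succ_le_succ hh) _)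
          gcongr
  · intro j a ha b hb js c hc s hs
    refine Finset.add_mem_add (Finset.add_mem_add ?_ ?_) (hB' c hc s hs)
    · have := j.pos
      exact Finset.mem_image.2 ⟨(j, a), by simp; omega, rfl⟩
    · exact hA' b hb (fun k => h (js k)) fun k => Finset.mem_image_of_mem h (Finset.mem_univ _)

/-- The size bound of one recursion step leaves room for one more element. -/
theorem step_bound_add_one_le {n m N e f : ℕ} (hn : 1 ≤ n) (hm : 1 ≤ m)
    (hN : N + 1 ≤ (2 * n) ^ e) (hf : m + 1 + m * e ≤ f) :
    n * (2 * n) * (n + 1) ^ (m - 1) * (N + 1) ^ m + 1 ≤ (2 * n) ^ f := by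
  obtain ⟨k, rfl⟩ := Nat.exists_eq_add_of_le' hm
  rw [Nat.add_sub_cancel]
  set M := (2 * n) ^ (k + (k + 1) * e) with hM
  have hMpos : 1 ≤ M := Nat.one_le_pow _ _ (by omega)
  have hle : (n + 1) ^ k * (N + 1) ^ (k + 1) ≤ M := by
    rw [hM, pow_add (2 * n) k, mul_comm (k + 1) e, pow_mul]
    gcongr
    omega
  calc n * (2 * n) * (n + 1) ^ k * (N + 1) ^ (k + 1) + 1
      = n * (2 * n) * ((n + 1) ^ k * (N + 1) ^ (k + 1)) + 1 := by ring
    _ ≤ n * (2 * n) * M + n * (2 * n) * M := by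
        gcongr
        have : 1 ≤ n * (2 * n) := Nat.mul_pos hn (by omega)
        exact Nat.mul_pos this hMpos
    _ = (2 * n) ^ (k + 1 + 1 + (k + 1) * e) := by rw [hM]; ring
    _ ≤ (2 * n) ^ f := Nat.pow_le_pow_right (by omega) hf


/-- cardinality bound for the recursively defined sets `T r` of
candidate top coordinates: `|T r| ≤ (2n) ^ ((r + 2 + (r-1)ε) / ε^(r-1))`. -/
theorem candidate_set_cardinality
    (n : ℕ) (hn : 1 ≤ n) (h : Fin n → ℝ) (hpos : ∀ j, 0 < h j)
    (ε : ℝ) (hε0 : 0 < ε) (hε1 : ε ≤ 1)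
    (m : ℕ) (hm : 1 ≤ m) (hmε : (m : ℝ) = 1 / ε)
    (T : ℕ → Set ℝ)
    (hT1 : T 1 = {x : ℝ | ∃ j : Fin n, ∃ a : ℕ,
      1 ≤ a ∧ a ≤ 4 * n ^ 2 ∧ x = (a : ℝ) * h j / (2 * n)})
    (hTsucc : ∀ r : ℕ, 1 ≤ r → T (r + 1) = {x : ℝ |
      ∃ j : Fin n, ∃ a : ℕ, a ≤ 2 * n - 1 ∧
        ∃ b : ℕ, b ≤ m - 1 ∧ ∃ js : Fin b → Fin n,
          ∃ c : ℕ, c ≤ m ∧ ∃ s : Fin c → ℝ, (∀ k, s k ∈ T r) ∧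
            x = (a : ℝ) * (h j / 2) + (∑ k, h (js k)) + (∑ k, s k)}) :
    ∀ r : ℕ, 1 ≤ r → (T r).Finite ∧
      ((T r).ncard : ℝ) ≤
        (2 * n : ℝ) ^ (((r : ℝ) + 2 + ((r : ℝ) - 1) * ε) / ε ^ (r - 1)) := by
  classical
  have key : ∀ s : ℕ, ∃ (F : Finset ℝ) (e : ℕ), T (s + 1) ⊆ F ∧ F.card + 1 ≤ (2 * n) ^ e ∧
      (e : ℝ) = ((s : ℝ) + 3 + s * ε) / ε ^ s := by
    intro s
    induction s with
    | zero =>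
      refine ⟨(Finset.univ ×ˢ Finset.Icc 1 (4 * n ^ 2)).image
        fun p : Fin n × ℕ => (p.2 : ℝ) * h p.1 / (2 * n), 3, ?_, ?_, by simp⟩
      · rw [hT1]
        rintro x ⟨j, a, ha, ha', rfl⟩
        exact Finset.mem_coe.2 (Finset.mem_image.2 ⟨(j, a), by simp [ha, ha'], rfl⟩)
      · refine (Nat.succ_le_succ Finset.card_image_le).trans ?_
        have : 1 ≤ n ^ 3 := Nat.one_le_pow _ _ hn
        simp only [Finset.card_product, Finset.card_univ, Fintype.card_fin, Nat.card_Icc,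
          Nat.add_sub_cancel]
        nlinarith
    | succ s ih =>
      obtain ⟨F, e, hF, hcard, he⟩ := ih
      obtain ⟨G, hG, hG'⟩ := exists_finset_candidates_succ n h m F
      refine ⟨G, m ^ (s + 1) + m ^ s + m * e, ?_, ?_, ?_⟩
      · rw [hTsucc (s + 1) (by omega)]
        rintro x ⟨j, a, ha, b, hb, js, c, hc, t, ht, rfl⟩
        exact hG' j a ha b hb js c hc t fun k => hF (ht k)
      · refine (Nat.succ_le_succ hG).trans (step_bound_add_one_le hn hm hcard ?_)
        have h1 : 1 ≤ m ^ s := Nat.one_le_pow _ _ hm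
        have h2 : m ≤ m ^ (s + 1) := Nat.le_self_pow (by omega) m
        omega
      · push_cast
        rw [he, hmε, one_div_pow, one_div_pow]
        field_simp
        ring
  intro r hr
  obtain ⟨s, rfl⟩ := Nat.exists_eq_add_of_le' hr
  obtain ⟨F, e, hF, hcard, he⟩ := key s
  refine ⟨F.finite_toSet.subset hF, ?_⟩
  have hexp : (((s + 1 : ℕ) : ℝ) + 2 + (((s + 1 : ℕ) : ℝ) - 1) * ε) / ε ^ (s + 1 - 1) = e := by
    rw [he, Nat.add_sub_cancel]
    push_cast
    ring
  rw [hexp, Real.rpow_natCast]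
  have hle : (T (s + 1)).ncard ≤ (2 * n) ^ e := by
    have := Set.ncard_le_ncard hF F.finite_toSet
    rw [Set.ncard_coe_finset] at this
    omega
  exact_mod_cast hle
end

section
/- Let ε ∈ (0, 1), let k = ⌈2/ε⌉, and let f : (0, ∞) → (0, ∞) be an increasing function with f(x) < x for all x > 0. Let N > 0 and let I be a finite set of items, each item i having width w(i) ∈ (0, N], height h(i) ∈ (0, N] and nonnegative profit p(i). Define ε_1 = f(ε) and ε_{i+1} = f(ε_i) for i ≥ 1. Then there exists j ∈ {1, …, k} such that the total profit of the items i with w(i) ∈ (ε_{j+1}N, ε_j N] or h(i) ∈ (ε_{j+1}N, ε_j N] is at most ε·p(I). -/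
open scoped Classical in
/-- A point lies in at most one of the consecutive half-open intervals cut out by an antitone
sequence. -/
lemma card_filter_mem_Ioc_succ_le_one {a : ℕ → ℝ} (ha : Antitone a) (s : Finset ℕ) (x : ℝ) :
    (s.filter fun j => x ∈ Set.Ioc (a (j + 1)) (a j)).card ≤ 1 := by
  refine Finset.card_le_one.2 fun i hi j hj => ?_
  by_contra hij
  exact Set.disjoint_left.1 (ha.pairwise_disjoint_on_Ioc_succ hij)
    (Finset.mem_filter.1 hi).2 (Finset.mem_filter.1 hj).2

open scoped Classical in
/-- Summed over the consecutive intervals cut out by an antitone sequence, the profit of the items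
with a side length in the interval is at most twice the total profit. -/
lemma sum_profit_Ioc_succ_le_two_mul {ι : Type*} {a : ℕ → ℝ} (ha : Antitone a) (s : Finset ℕ)
    (I : Finset ι) (w h p : ι → ℝ) (hp : ∀ i ∈ I, 0 ≤ p i) :
    ∑ j ∈ s, ∑ i ∈ I.filter (fun i =>
        w i ∈ Set.Ioc (a (j + 1)) (a j) ∨ h i ∈ Set.Ioc (a (j + 1)) (a j)), p i ≤
      2 * ∑ i ∈ I, p i := by
  simp_rw [Finset.sum_filter]
  rw [Finset.sum_comm, Finset.mul_sum]
  refine Finset.sum_le_sum fun i hi => ?_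
  rw [← Finset.sum_filter, Finset.sum_const, nsmul_eq_mul]
  refine mul_le_mul_of_nonneg_right ?_ (hp i hi)
  rw [Finset.filter_or]
  exact_mod_cast (Finset.card_union_le _ _).trans
    (Nat.add_le_add (card_filter_mem_Ioc_succ_le_one ha s (w i))
      (card_filter_mem_Ioc_succ_le_one ha s (h i)))


open scoped Classical in
/-- there is a range `(ε_{j+1} N, ε_j N]` (with `j ≤ ⌈2/ε⌉`) such
that the items with a side length in that range carry at most an `ε` fraction
of the total profit. -/
theorem intermediate_items_low_profit
    {ι : Type*} (ε : ℝ) (hε0 : 0 < ε) (hε1 : ε < 1)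
    (k : ℕ) (hk : k = ⌈(2 : ℝ) / ε⌉₊)
    (f : ℝ → ℝ)
    (hfpos : ∀ x, 0 < x → 0 < f x)
    (hfmono : ∀ x y, 0 < x → x < y → f x < f y)
    (hflt : ∀ x, 0 < x → f x < x)
    (N : ℝ) (hN : 0 < N)
    (I : Finset ι) (w h p : ι → ℝ)
    (hw : ∀ i ∈ I, 0 < w i ∧ w i ≤ N)
    (hh : ∀ i ∈ I, 0 < h i ∧ h i ≤ N)
    (hp : ∀ i ∈ I, 0 ≤ p i)
    (e : ℕ → ℝ) (he1 : e 1 = f ε)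
    (hesucc : ∀ i, 1 ≤ i → e (i + 1) = f (e i)) :
    ∃ j, 1 ≤ j ∧ j ≤ k ∧
      ∑ i ∈ I.filter (fun i =>
          w i ∈ Set.Ioc (e (j + 1) * N) (e j * N) ∨
          h i ∈ Set.Ioc (e (j + 1) * N) (e j * N)), p i ≤
        ε * ∑ i ∈ I, p i := by
  have hpos : ∀ n, 0 < e (n + 1) := by
    intro n
    induction n with
    | zero => simpa [he1] using hfpos ε hε0
    | succ n ih => simpa [hesucc (n + 1) (by omega)] using hfpos _ ih
  have hanti : Antitone fun n => e (n + 1) * N := by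
    refine antitone_nat_of_succ_le fun n => mul_le_mul_of_nonneg_right ?_ hN.le
    rw [hesucc (n + 1) (by omega)]
    exact (hflt _ (hpos n)).le
  have hkε : 2 ≤ k * ε := by
    rw [← div_le_iff₀ hε0, hk]
    exact Nat.le_ceil _
  have hk0 : k ≠ 0 := by
    rintro rfl
    norm_num at hkε
  by_contra! hlarge
  have hlt := Finset.sum_lt_sum_of_nonempty (Finset.nonempty_range_iff.2 hk0) fun j hj =>
    hlarge (j + 1) (by omega) (by simpa [Nat.succ_le_iff] using hj)
  have hle := sum_profit_Ioc_succ_le_two_mul hanti (Finset.range k) I w h p hp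
  rw [Finset.sum_const, Finset.card_range, nsmul_eq_mul, ← mul_assoc] at hlt
  have hP := mul_le_mul_of_nonneg_right hkε (Finset.sum_nonneg hp)
  exact absurd (hlt.trans_le hle) hP.not_gt
end

section
/- Let 0 < ε < 1/2, let N > 0, and let M be a finite set of items, each item j having height h(j) ∈ (0, N]. Then there exists i ∈ {1, …, ⌈1/(2ε)⌉} such that the number of items j ∈ M with h(j) ∈ ((1 − 2ε^i)N, (1 − ε^{i+1})N] is at most 4ε·|M|. -/
/-- The intervals `((1 - 2ε^i)N, (1 - ε^{i+1})N]` and `((1 - 2ε^k)N, (1 - ε^{k+1})N]` can only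
meet when `k ≤ i + 1`. -/
theorem le_succ_of_mem_medium_interval {ε N x : ℝ} (hε0 : 0 < ε) (hε : ε ≤ 1 / 2) (hN : 0 ≤ N)
    {i k : ℕ} (hi : x ∈ Set.Ioc ((1 - 2 * ε ^ i) * N) ((1 - ε ^ (i + 1)) * N))
    (hk : x ∈ Set.Ioc ((1 - 2 * ε ^ k) * N) ((1 - ε ^ (k + 1)) * N)) : k ≤ i + 1 := by
  by_contra! hlt
  have hpow : ε ^ k ≤ ε ^ (i + 2) := pow_le_pow_of_le_one hε0.le (by linarith) hlt
  have hstep : 2 * ε ^ (i + 2) ≤ ε ^ (i + 1) := by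
    rw [pow_succ ε (i + 1)]
    nlinarith [pow_pos hε0 (i + 1)]
  have hmul : (1 - ε ^ (i + 1)) * N ≤ (1 - 2 * ε ^ k) * N :=
    mul_le_mul_of_nonneg_right (by linarith) hN
  linarith [hi.2, hk.1]

/-- A finite set of naturals in which any two elements differ by at most one has at most two
elements. -/
theorem Finset.card_le_two_of_forall_le_succ (s : Finset ℕ)
    (hs : ∀ i ∈ s, ∀ k ∈ s, k ≤ i + 1) : s.card ≤ 2 := by
  rcases s.eq_empty_or_nonempty with rfl | hne
  · simp
  · have hsub : s ⊆ Finset.Icc (s.min' hne) (s.min' hne + 1) := fun k hk =>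
      Finset.mem_Icc.2 ⟨s.min'_le k hk, hs _ (s.min'_mem hne) k hk⟩
    refine (Finset.card_le_card hsub).trans ?_
    rw [Nat.card_Icc]
    omega

open scoped Classical in
/-- there is an `i ≤ ⌈1/(2ε)⌉` such that at most `4ε|M|` items
have height in `((1 - 2ε^i)N, (1 - ε^{i+1})N]`. -/
theorem medium_height_items_few
    {ι : Type*} (ε : ℝ) (hε0 : 0 < ε) (hε : ε < 1 / 2)
    (N : ℝ) (hN : 0 < N)
    (M : Finset ι) (h : ι → ℝ)
    (hh : ∀ j ∈ M, 0 < h j ∧ h j ≤ N) :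
    ∃ i, 1 ≤ i ∧ i ≤ ⌈1 / (2 * ε)⌉₊ ∧
      ((M.filter (fun j =>
          h j ∈ Set.Ioc ((1 - 2 * ε ^ i) * N) ((1 - ε ^ (i + 1)) * N))).card : ℝ) ≤
        4 * ε * M.card := by
  set K := ⌈1 / (2 * ε)⌉₊
  have hKpos : 0 < K := Nat.ceil_pos.2 (by positivity)
  have hKε : 1 ≤ K * (2 * ε) := (div_le_iff₀ (by positivity)).1 (Nat.le_ceil (1 / (2 * ε)))
  let r : ℕ → ι → Prop := fun i j =>
    h j ∈ Set.Ioc ((1 - 2 * ε ^ i) * N) ((1 - ε ^ (i + 1)) * N)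
  by_contra! hcon
  have hcount : ∑ i ∈ Finset.Icc 1 K, (M.filter (r i)).card ≤ M.card * 2 := by
    calc ∑ i ∈ Finset.Icc 1 K, (M.filter (r i)).card
        = ∑ j ∈ M, ((Finset.Icc 1 K).filter (fun i => r i j)).card :=
          Finset.sum_card_bipartiteAbove_eq_sum_card_bipartiteBelow r
      _ ≤ M.card * 2 := by
          refine Finset.sum_le_card_nsmul _ _ _ fun j _ => ?_
          refine Finset.card_le_two_of_forall_le_succ _ fun i hi k hk => ?_
          exact le_succ_of_mem_medium_interval hε0 hε.le hN.le
            (Finset.mem_filter.1 hi).2 (Finset.mem_filter.1 hk).2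
  have hlt : ∑ _i ∈ Finset.Icc 1 K, 4 * ε * (M.card : ℝ) <
      ∑ i ∈ Finset.Icc 1 K, ((M.filter (r i)).card : ℝ) :=
    Finset.sum_lt_sum_of_nonempty (Finset.nonempty_Icc.2 hKpos) fun i hi =>
      hcon i (Finset.mem_Icc.1 hi).1 (Finset.mem_Icc.1 hi).2
  have hcount' : ∑ i ∈ Finset.Icc 1 K, ((M.filter (r i)).card : ℝ) ≤ M.card * 2 := by
    exact_mod_cast hcount
  rw [Finset.sum_const, Nat.card_Icc, Nat.add_sub_cancel, nsmul_eq_mul] at hlt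
  nlinarith [mul_le_mul_of_nonneg_right hKε (Nat.cast_nonneg (α := ℝ) M.card)]
end

section
/- Let N > 0 and 0 < ε_small ≤ ε_s. Let M be a finite set of items packed into the square [0,N]×[0,N], such that every item i satisfies w(i) ≤ ε_small·N or h(i) ≤ ε_small·N. Let E_V be the set of items whose open rectangle intersects the vertical strip [0, ε_s N]×[0,N] or the strip [(1−ε_s)N, N]×[0,N], and let E_H be the set of items whose open rectangle intersects the horizontal strip [0,N]×[0, ε_s N] or the strip [0,N]×[(1−ε_s)N, N]. Then min{ a(E_V), a(E_H) } ≤ ((1 + 8ε_s)/2)·N². -/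
/-- Pairwise disjoint open rectangles inside a closed rectangle have total area at most its area. -/
theorem sum_area_le_of_subset_rectangle {ι : Type*} (S : Finset ι) (w h x y : ι → ℝ)
    (hwpos : ∀ i ∈ S, 0 < w i) (hhpos : ∀ i ∈ S, 0 < h i)
    (hdisj : ∀ i ∈ S, ∀ j ∈ S, i ≠ j →
      Disjoint (Set.Ioo (x i) (x i + w i) ×ˢ Set.Ioo (y i) (y i + h i))
        (Set.Ioo (x j) (x j + w j) ×ˢ Set.Ioo (y j) (y j + h j)))
    {a b c d : ℝ} (hab : a ≤ b) (hcd : c ≤ d)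
    (hsub : ∀ i ∈ S, (Set.Ioo (x i) (x i + w i) ×ˢ Set.Ioo (y i) (y i + h i)) ⊆
      Set.Icc a b ×ˢ Set.Icc c d) :
    ∑ i ∈ S, w i * h i ≤ (b - a) * (d - c) := by
  have hbox : ∀ i ∈ S, MeasureTheory.volume.real
      (Set.Ioo (x i) (x i + w i) ×ˢ Set.Ioo (y i) (y i + h i)) = w i * h i := by
    intro i hi
    rw [MeasureTheory.Measure.volume_eq_prod, MeasureTheory.measureReal_prod_prod,
      Real.volume_real_Ioo_of_le (by linarith [hwpos i hi]),
      Real.volume_real_Ioo_of_le (by linarith [hhpos i hi])]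
    ring
  have hrect : MeasureTheory.volume.real (Set.Icc a b ×ˢ Set.Icc c d) = (b - a) * (d - c) := by
    rw [MeasureTheory.Measure.volume_eq_prod, MeasureTheory.measureReal_prod_prod,
      Real.volume_real_Icc_of_le hab, Real.volume_real_Icc_of_le hcd]
  have hfinite : MeasureTheory.volume (Set.Icc a b ×ˢ Set.Icc c d) ≠ ⊤ :=
    (isCompact_Icc.prod isCompact_Icc).measure_lt_top.ne
  rw [← Finset.sum_congr rfl hbox, ← hrect, ← MeasureTheory.measureReal_biUnion_finset
    (fun i hi j hj hij => hdisj i hi j hj hij)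
    (fun i _ => measurableSet_Ioo.prod measurableSet_Ioo)
    (fun i hi => ((MeasureTheory.measure_mono (hsub i hi)).trans_lt hfinite.lt_top).ne)]
  exact MeasureTheory.measureReal_mono (Set.iUnion₂_subset hsub) hfinite

open scoped Classical in
/-- for a packing of skewed items into the `N × N` square, the
items touching the two vertical boundary strips of width `ε_s N`, or the items
touching the two horizontal boundary strips of height `ε_s N`, have total area
at most `(1 + 8 ε_s)/2 · N²`. -/
theorem strip_area_bound
    {ι : Type*} (N εsmall εs : ℝ) (hN : 0 < N)
    (hεsmall : 0 < εsmall) (hεss : εsmall ≤ εs)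
    (M : Finset ι) (w h : ι → ℝ)
    (hwpos : ∀ i ∈ M, 0 < w i) (hhpos : ∀ i ∈ M, 0 < h i)
    (hskew : ∀ i ∈ M, w i ≤ εsmall * N ∨ h i ≤ εsmall * N)
    (x y : ι → ℝ)
    (hin : ∀ i ∈ M,
      (Set.Ioo (x i) (x i + w i) ×ˢ Set.Ioo (y i) (y i + h i)) ⊆
        Set.Icc 0 N ×ˢ Set.Icc 0 N)
    (hdisj : ∀ i ∈ M, ∀ j ∈ M, i ≠ j →
      Disjoint (Set.Ioo (x i) (x i + w i) ×ˢ Set.Ioo (y i) (y i + h i))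
        (Set.Ioo (x j) (x j + w j) ×ˢ Set.Ioo (y j) (y j + h j))) :
    min
      (∑ i ∈ M.filter (fun i =>
        ((Set.Ioo (x i) (x i + w i) ×ˢ Set.Ioo (y i) (y i + h i)) ∩
          (Set.Icc 0 (εs * N) ×ˢ Set.Icc 0 N)).Nonempty ∨
        ((Set.Ioo (x i) (x i + w i) ×ˢ Set.Ioo (y i) (y i + h i)) ∩
          (Set.Icc ((1 - εs) * N) N ×ˢ Set.Icc 0 N)).Nonempty), w i * h i)
      (∑ i ∈ M.filter (fun i =>
        ((Set.Ioo (x i) (x i + w i) ×ˢ Set.Ioo (y i) (y i + h i)) ∩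
          (Set.Icc 0 N ×ˢ Set.Icc 0 (εs * N))).Nonempty ∨
        ((Set.Ioo (x i) (x i + w i) ×ˢ Set.Ioo (y i) (y i + h i)) ∩
          (Set.Icc 0 N ×ˢ Set.Icc ((1 - εs) * N) N)).Nonempty), w i * h i)
      ≤ (1 + 8 * εs) / 2 * N ^ 2 := by
  set B : ι → Set (ℝ × ℝ) := fun i =>
    Set.Ioo (x i) (x i + w i) ×ˢ Set.Ioo (y i) (y i + h i)
  set V := M.filter (fun i => (B i ∩ (Set.Icc 0 (εs * N) ×ˢ Set.Icc 0 N)).Nonempty ∨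
    (B i ∩ (Set.Icc ((1 - εs) * N) N ×ˢ Set.Icc 0 N)).Nonempty)
  set H := M.filter (fun i => (B i ∩ (Set.Icc 0 N ×ˢ Set.Icc 0 (εs * N))).Nonempty ∨
    (B i ∩ (Set.Icc 0 N ×ˢ Set.Icc ((1 - εs) * N) N)).Nonempty)
  have hεN : 0 < εs * N := mul_pos (hεsmall.trans_le hεss) hN
  have hsmall : εsmall * N ≤ εs * N := mul_le_mul_of_nonneg_right hεss hN.le
  have harea {a b c d : ℝ} (hab : a ≤ b) (hcd : c ≤ d) (S : Finset ι) (hS : S ⊆ M)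
      (hsub : ∀ i ∈ S, B i ⊆ Set.Icc a b ×ˢ Set.Icc c d) :
      ∑ i ∈ S, w i * h i ≤ (b - a) * (d - c) :=
    sum_area_le_of_subset_rectangle S w h x y (fun i hi => hwpos i (hS hi))
      (fun i hi => hhpos i (hS hi)) (fun i hi j hj => hdisj i (hS hi) j (hS hj)) hab hcd hsub
  have hunion : ∑ i ∈ V ∪ H, w i * h i ≤ (N - 0) * (N - 0) := by
    have hVH : V ∪ H ⊆ M :=
      Finset.union_subset (Finset.filter_subset _ _) (Finset.filter_subset _ _)
    exact harea hN.le hN.le _ hVH (fun i hi => hin i (hVH hi))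
  let inside (R : Set (ℝ × ℝ)) : Finset ι := M.filter (fun i => B i ⊆ R)
  have hinside {a b c d : ℝ} (hab : a ≤ b) (hcd : c ≤ d) :
      ∑ i ∈ inside (Set.Icc a b ×ˢ Set.Icc c d), w i * h i ≤ (b - a) * (d - c) :=
    harea hab hcd _ (Finset.filter_subset _ _) (fun i hi => (Finset.mem_filter.mp hi).2)
  let left : Set (ℝ × ℝ) := Set.Icc 0 (2 * (εs * N)) ×ˢ Set.Icc 0 N
  let right : Set (ℝ × ℝ) := Set.Icc (N - 2 * (εs * N)) N ×ˢ Set.Icc 0 N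
  let bottom : Set (ℝ × ℝ) := Set.Icc 0 N ×ˢ Set.Icc 0 (2 * (εs * N))
  let top : Set (ℝ × ℝ) := Set.Icc 0 N ×ˢ Set.Icc (N - 2 * (εs * N)) N
  have hleft : ∑ i ∈ inside left, w i * h i ≤ _ := hinside (by linarith) hN.le
  have hright : ∑ i ∈ inside right, w i * h i ≤ _ := hinside (by linarith) hN.le
  have hbottom : ∑ i ∈ inside bottom, w i * h i ≤ _ := hinside hN.le (by linarith)
  have htop : ∑ i ∈ inside top, w i * h i ≤ _ := hinside hN.le (by linarith)
  have hcover : V ∩ H ⊆ (inside left ∪ inside right) ∪ (inside bottom ∪ inside top) := by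
    intro i hi
    obtain ⟨hiV, hiH⟩ := Finset.mem_inter.mp hi
    obtain ⟨hiM, hiV⟩ := Finset.mem_filter.mp hiV
    obtain ⟨-, hiH⟩ := Finset.mem_filter.mp hiH
    simp only [inside, Finset.mem_union, Finset.mem_filter, hiM, true_and]
    rcases hskew i hiM with hw | hh
    · left
      refine hiV.imp ?_ ?_ <;>
      · rintro ⟨p, ⟨⟨hp₁, hp₂⟩, -⟩, ⟨hp₃, hp₄⟩, -⟩ q hq
        obtain ⟨⟨hq₁, hq₂⟩, hq₃⟩ := hin i hiM hq
        obtain ⟨⟨hq₄, hq₅⟩, -⟩ := hq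
        exact ⟨⟨by linarith, by linarith⟩, hq₃⟩
    · right
      refine hiH.imp ?_ ?_ <;>
      · rintro ⟨p, ⟨-, hp₁, hp₂⟩, -, hp₃, hp₄⟩ q hq
        obtain ⟨hq₃, hq₁, hq₂⟩ := hin i hiM hq
        obtain ⟨-, hq₄, hq₅⟩ := hq
        exact ⟨hq₃, ⟨by linarith, by linarith⟩⟩
  have hnonneg : ∀ i ∈ M, 0 ≤ w i * h i := fun i hi => (mul_pos (hwpos i hi) (hhpos i hi)).le
  have hsum_union (S T : Finset ι) (hS : S ⊆ M) (hT : T ⊆ M) :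
      ∑ i ∈ S ∪ T, w i * h i ≤ ∑ i ∈ S, w i * h i + ∑ i ∈ T, w i * h i := by
    rw [← Finset.sum_union_inter]
    exact le_add_of_nonneg_right
      (Finset.sum_nonneg fun i hi => hnonneg i (hS (Finset.mem_inter.mp hi).1))
  have hinsideM (R : Set (ℝ × ℝ)) : inside R ⊆ M := Finset.filter_subset _ _
  have hvertM := Finset.union_subset (hinsideM left) (hinsideM right)
  have hhorM := Finset.union_subset (hinsideM bottom) (hinsideM top)
  have hinter : ∑ i ∈ V ∩ H, w i * h i ≤
      ∑ i ∈ (inside left ∪ inside right) ∪ (inside bottom ∪ inside top), w i * h i :=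
    Finset.sum_le_sum_of_subset_of_nonneg hcover
      (fun i hi _ => hnonneg i (Finset.union_subset hvertM hhorM hi))
  have hstrips := hsum_union _ _ hvertM hhorM
  have hvert := hsum_union _ _ (hinsideM left) (hinsideM right)
  have hhor := hsum_union _ _ (hinsideM bottom) (hinsideM top)
  have htotal := Finset.sum_union_inter (s₁ := V) (s₂ := H) (f := fun i => w i * h i)
  have hmin := min_le_left (∑ i ∈ V, w i * h i) (∑ i ∈ H, w i * h i)
  have hmin' := min_le_right (∑ i ∈ V, w i * h i) (∑ i ∈ H, w i * h i)
  linarith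
end

section
/- Let N > 0, 0 < ε_a < 1/2, 0 < ε_s < 1, and 0 < ε_small ≤ ε_s/2. Let M̃ be a finite set of items such that every i ∈ M̃ satisfies w(i) ≤ ε_small·N and h(i) ≤ N, and such that a(M̃) ≤ (1/2 + ε_a)·N². Then there exists a subset S ⊆ M̃ with |S| ≥ (1 − 2ε_s − 2ε_a)·|M̃| that can be packed into the box [0, (1 − ε_s)N] × [0, N]. -/
/-- An axis-parallel packing (without rotations) of the items of `I`, with
widths `w` and heights `h`, into the region `R ⊆ ℝ²`: each item gets a
position so that the open rectangles are pairwise disjoint and contained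
in `R`. -/
def IsPacking {ι : Type*} (I : Finset ι) (w h : ι → ℝ) (R : Set (ℝ × ℝ)) : Prop :=
  ∃ x y : ι → ℝ,
    (∀ i ∈ I, (Set.Ioo (x i) (x i + w i) ×ˢ Set.Ioo (y i) (y i + h i)) ⊆ R) ∧
    (∀ i ∈ I, ∀ j ∈ I, i ≠ j →
      Disjoint (Set.Ioo (x i) (x i + w i) ×ˢ Set.Ioo (y i) (y i + h i))
        (Set.Ioo (x j) (x j + w j) ×ˢ Set.Ioo (y j) (y j + h j)))

/-- The items of `I` can be placed in the box `[a, b] × [c, d]` so that any two of them are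
separated by a horizontal or a vertical line. -/
def FitsInBox {ι : Type*} (I : Finset ι) (w h : ι → ℝ) (a b c d : ℝ) : Prop :=
  ∃ x y : ι → ℝ,
    (∀ i ∈ I, a ≤ x i ∧ x i + w i ≤ b ∧ c ≤ y i ∧ y i + h i ≤ d) ∧
    (∀ i ∈ I, ∀ j ∈ I, i ≠ j →
      x i + w i ≤ x j ∨ x j + w j ≤ x i ∨ y i + h i ≤ y j ∨ y j + h j ≤ y i)

namespace FitsInBox

variable {ι : Type*} {I J : Finset ι} {w h : ι → ℝ} {a b c d : ℝ}

theorem mono {a' b' c' d' : ℝ} (hI : FitsInBox I w h a b c d) (ha : a' ≤ a) (hb : b ≤ b')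
    (hc : c' ≤ c) (hd : d ≤ d') : FitsInBox I w h a' b' c' d' := by
  obtain ⟨x, y, hbox, hsep⟩ := hI
  refine ⟨x, y, fun i hi => ?_, hsep⟩
  obtain ⟨h1, h2, h3, h4⟩ := hbox i hi
  exact ⟨ha.trans h1, h2.trans hb, hc.trans h3, h4.trans hd⟩

theorem isPacking (hI : FitsInBox I w h a b c d) :
    IsPacking I w h (Set.Icc a b ×ˢ Set.Icc c d) := by
  obtain ⟨x, y, hbox, hsep⟩ := hI
  refine ⟨x, y, fun i hi => ?_, fun i hi j hj hij => ?_⟩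
  · obtain ⟨h1, h2, h3, h4⟩ := hbox i hi
    exact Set.prod_mono
      (Set.Ioo_subset_Icc_self.trans (Set.Icc_subset_Icc h1 h2))
      (Set.Ioo_subset_Icc_self.trans (Set.Icc_subset_Icc h3 h4))
  · rw [Set.disjoint_left]
    rintro ⟨p, q⟩ ⟨⟨h1, h2⟩, h3, h4⟩ ⟨⟨h5, h6⟩, h7, h8⟩
    dsimp only at *
    rcases hsep i hi j hj hij with h | h | h | h <;> linarith

variable [DecidableEq ι]

/-- Two boxes separated by a line can be filled independently. -/
theorem union {a₁ b₁ c₁ d₁ a₂ b₂ c₂ d₂ : ℝ} (hI : FitsInBox I w h a₁ b₁ c₁ d₁)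
    (hJ : FitsInBox J w h a₂ b₂ c₂ d₂) (hsep : b₁ ≤ a₂ ∨ d₁ ≤ c₂) :
    FitsInBox (I ∪ J) w h (min a₁ a₂) (max b₁ b₂) (min c₁ c₂) (max d₁ d₂) := by
  obtain ⟨x, y, hbox, hxy⟩ := hI
  obtain ⟨x', y', hbox', hxy'⟩ := hJ
  have hJmem : ∀ i ∈ I ∪ J, i ∉ I → i ∈ J := fun i hi hiI =>
    (Finset.mem_union.mp hi).resolve_left hiI
  refine ⟨fun i => if i ∈ I then x i else x' i, fun i => if i ∈ I then y i else y' i,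
    fun i hi => ?_, fun i hi j hj hij => ?_⟩
  · by_cases hiI : i ∈ I
    · obtain ⟨h1, h2, h3, h4⟩ := hbox i hiI
      simp only [hiI, if_true]
      exact ⟨min_le_of_left_le h1, le_max_of_le_left h2, min_le_of_left_le h3,
        le_max_of_le_left h4⟩
    · obtain ⟨h1, h2, h3, h4⟩ := hbox' i (hJmem i hi hiI)
      simp only [hiI, if_false]
      exact ⟨min_le_of_right_le h1, le_max_of_le_right h2, min_le_of_right_le h3,
        le_max_of_le_right h4⟩
  · by_cases hiI : i ∈ I <;> by_cases hjI : j ∈ I <;> simp only [hiI, hjI, if_true, if_false]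
    · exact hxy i hiI j hjI hij
    · obtain ⟨-, h2, -, h4⟩ := hbox i hiI
      obtain ⟨h1, -, h3, -⟩ := hbox' j (hJmem j hj hjI)
      rcases hsep with hs | hs
      · exact Or.inl (by linarith)
      · exact Or.inr (Or.inr (Or.inl (by linarith)))
    · obtain ⟨-, h2, -, h4⟩ := hbox j hjI
      obtain ⟨h1, -, h3, -⟩ := hbox' i (hJmem i hi hiI)
      rcases hsep with hs | hs
      · exact Or.inr (Or.inl (by linarith))
      · exact Or.inr (Or.inr (Or.inr (by linarith)))
    · exact hxy' i (hJmem i hi hiI) j (hJmem j hj hjI) hij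

/-- Items stacked on top of each other. -/
theorem stack (hh : ∀ i ∈ I, 0 ≤ h i) (hw : ∀ i ∈ I, w i ≤ b - a) :
    FitsInBox I w h a b c (c + ∑ i ∈ I, h i) := by
  induction I using Finset.induction_on with
  | empty => exact ⟨fun _ => 0, fun _ => 0, by simp, by simp⟩
  | insert k I hk ih =>
    have hsum : 0 ≤ ∑ i ∈ I, h i :=
      Finset.sum_nonneg fun i hi => hh i (Finset.mem_insert_of_mem hi)
    have hhk := hh k (Finset.mem_insert_self k I)
    have hwk := hw k (Finset.mem_insert_self k I)
    have hrest := ih (fun i hi => hh i (Finset.mem_insert_of_mem hi))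
      (fun i hi => hw i (Finset.mem_insert_of_mem hi))
    have hsingle : FitsInBox {k} w h a b (c + ∑ i ∈ I, h i) (c + ∑ i ∈ I, h i + h k) := by
      refine ⟨fun _ => a, fun _ => c + ∑ i ∈ I, h i, fun i hi => ?_, fun i hi j hj hij => ?_⟩
      · rw [Finset.mem_singleton.mp hi]
        exact ⟨le_rfl, by linarith, le_rfl, le_rfl⟩
      · exact absurd ((Finset.mem_singleton.mp hi).trans (Finset.mem_singleton.mp hj).symm) hij
    have := (hrest.union hsingle (Or.inr le_rfl)).mono (a' := a) (b' := b) (c' := c)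
      (d' := c + ∑ i ∈ insert k I, h i) (le_min le_rfl le_rfl) (max_le le_rfl le_rfl)
      (le_min le_rfl (by linarith))
      (by rw [Finset.sum_insert hk]; exact max_le (by linarith) (by linarith))
    rwa [Finset.union_comm, ← Finset.insert_eq] at this

end FitsInBox

/-- Every nonempty set of items of height at most `N` has a widest initial part whose total height
is at most `N` and which cannot be extended by a widest remaining item. -/
theorem exists_maximal_column {ι : Type*} [DecidableEq ι] {N : ℝ} (hN : 0 ≤ N) (S : Finset ι)
    (w h : ι → ℝ) :
    ∃ C ⊆ S, (∀ i ∈ C, ∀ j ∈ S \ C, w j ≤ w i) ∧ ∑ i ∈ C, h i ≤ N ∧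
      ∀ b ∈ S \ C, (∀ j ∈ S \ C, w j ≤ w b) → N < ∑ i ∈ C, h i + h b := by
  classical
  let F := S.powerset.filter fun C =>
    (∀ i ∈ C, ∀ j ∈ S \ C, w j ≤ w i) ∧ ∑ i ∈ C, h i ≤ N
  have hF : F.Nonempty := ⟨∅, by simp [F, hN]⟩
  obtain ⟨C, hCF, hmax⟩ := F.exists_max_image Finset.card hF
  obtain ⟨hCS, hwide, hheight⟩ : C ⊆ S ∧ (∀ i ∈ C, ∀ j ∈ S \ C, w j ≤ w i) ∧
      ∑ i ∈ C, h i ≤ N := by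
    simpa only [F, Finset.mem_filter, Finset.mem_powerset] using hCF
  refine ⟨C, hCS, hwide, hheight, fun b hb hbmax => ?_⟩
  obtain ⟨hbS, hbC⟩ := Finset.mem_sdiff.mp hb
  by_contra! hle
  have hins : insert b C ∈ F := by
    simp only [F, Finset.mem_filter, Finset.mem_powerset]
    refine ⟨Finset.insert_subset hbS hCS, fun i hi j hj => ?_, ?_⟩
    · have hj' : j ∈ S \ C :=
        Finset.sdiff_subset_sdiff subset_rfl (Finset.subset_insert b C) hj
      rcases Finset.mem_insert.mp hi with rfl | hi
      · exact hbmax j hj'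
      · exact hwide i hi j hj'
    · rw [Finset.sum_insert hbC]
      linarith
  have := hmax _ hins
  rw [Finset.card_insert_of_notMem hbC] at this
  omega

/-- The next-fit decreasing-width bound: columns are filled with items of decreasing width. -/
theorem exists_fitsInBox_nextFit {ι : Type*} [DecidableEq ι] {N : ℝ} (hN : 0 ≤ N) (w h : ι → ℝ)
    (S : Finset ι) (hS : S.Nonempty) (hw : ∀ i ∈ S, 0 ≤ w i) (hh : ∀ i ∈ S, 0 ≤ h i)
    (hhN : ∀ i ∈ S, h i ≤ N) (a : ℝ) :
    ∃ m ∈ S, (∀ i ∈ S, w i ≤ w m) ∧ ∃ U : ℝ, 0 ≤ U ∧ U ≤ S.card * w m ∧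
      N * U ≤ N * w m + 2 * ∑ i ∈ S, w i * h i - w m * h m ∧
      FitsInBox S w h a (a + U) 0 N := by
  induction S using Finset.strongInduction generalizing a with
  | H S ih =>
    obtain ⟨C, hCS, hwide, hheight, hfull⟩ := exists_maximal_column hN S w h
    have hCne : C.Nonempty := by
      rw [Finset.nonempty_iff_ne_empty]
      rintro rfl
      obtain ⟨b, hb, hbmax⟩ := S.exists_max_image w hS
      have := hfull b (by simpa using hb) (by simpa using hbmax)
      have := hhN b hb
      simp at *
      linarith
    obtain ⟨m, hmC, hmmax⟩ := C.exists_max_image w hCne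
    have hmS := hCS hmC
    have hmall : ∀ i ∈ S, w i ≤ w m := fun i hi => by
      by_cases hiC : i ∈ C
      · exact hmmax i hiC
      · exact hwide m hmC i (Finset.mem_sdiff.mpr ⟨hi, hiC⟩)
    have harea : ∀ i ∈ S, 0 ≤ w i * h i := fun i hi => mul_nonneg (hw i hi) (hh i hi)
    have hmarea : w m * h m ≤ ∑ i ∈ C, w i * h i :=
      Finset.single_le_sum (f := fun i => w i * h i) (fun i hi => harea i (hCS hi)) hmC
    have hcol : FitsInBox C w h a (a + w m) 0 N :=
      (FitsInBox.stack (a := a) (b := a + w m) (c := 0) (fun i hi => hh i (hCS hi))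
        (fun i hi => by linarith [hmmax i hi])).mono le_rfl le_rfl le_rfl (by linarith)
    have hsplit := Finset.sum_sdiff (f := fun i => w i * h i) hCS
    have hcard := Finset.card_sdiff_add_card_eq_card hCS
    have hCcard : (1 : ℝ) ≤ C.card := by exact_mod_cast hCne.card_pos
    have hcard' : ((S \ C).card : ℝ) + C.card = S.card := by exact_mod_cast hcard
    have hwm := hw m hmS
    rcases (S \ C).eq_empty_or_nonempty with hrest | hrest
    · have hCeq : C = S := hCS.antisymm (Finset.sdiff_eq_empty_iff_subset.mp hrest)
      subst hCeq
      refine ⟨m, hmS, hmall, w m, hwm, by nlinarith, ?_, hcol⟩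
      linarith [Finset.sum_nonneg harea]
    · have hsub : S \ C ⊆ S := Finset.sdiff_subset
      obtain ⟨b, hb, hbmax, U, hU, hUcard, hUarea, hfit⟩ :=
        ih (S \ C) (Finset.sdiff_ssubset hCS hCne) hrest (fun i hi => hw i (hsub hi))
          (fun i hi => hh i (hsub hi)) (fun i hi => hhN i (hsub hi)) (a + w m)
      have hover := hfull b hb hbmax
      have hwb := hw b (hsub hb)
      have hCarea : w b * ∑ i ∈ C, h i ≤ ∑ i ∈ C, w i * h i := by
        rw [Finset.mul_sum]
        exact Finset.sum_le_sum fun i hi =>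
          mul_le_mul_of_nonneg_right (hwide i hi b hb) (hh i (hCS hi))
      have hb_over := mul_le_mul_of_nonneg_left hover.le hwb
      refine ⟨m, hmS, hmall, w m + U, by linarith, ?_, ?_, ?_⟩
      · have h1 : ((S \ C).card : ℝ) * w b ≤ (S \ C).card * w m :=
          mul_le_mul_of_nonneg_left (hmall b (hsub hb)) (Nat.cast_nonneg _)
        rw [← hcard']
        nlinarith
      · nlinarith
      · have := (hcol.union hfit (Or.inl le_rfl)).mono (a' := a) (b' := a + (w m + U))
          (c' := 0) (d' := N) (le_min le_rfl (by linarith)) (max_le (by linarith) (by linarith))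
          (le_min le_rfl le_rfl) (max_le le_rfl le_rfl)
        rwa [Finset.union_sdiff_of_subset hCS] at this

/-- The `k` smallest values of `f` on `M` have an average at most the average of `f` on `M`. -/
theorem Finset.exists_subset_card_eq_mul_sum_le {ι : Type*} [DecidableEq ι] (f : ι → ℝ)
    (M : Finset ι) (k : ℕ) (hk : k ≤ M.card) :
    ∃ S ⊆ M, S.card = k ∧ (M.card : ℝ) * ∑ i ∈ S, f i ≤ k * ∑ i ∈ M, f i := by
  induction hn : M.card generalizing M with
  | zero =>
    obtain rfl : k = 0 := by omega
    exact ⟨∅, M.empty_subset, rfl, by simp⟩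
  | succ n ih =>
    rcases hk.eq_or_lt with rfl | hlt
    · exact ⟨M, subset_rfl, rfl, by rw [hn]⟩
    rcases k.eq_zero_or_pos with rfl | hkpos
    · exact ⟨∅, M.empty_subset, rfl, by simp⟩
    obtain ⟨m, hm, hmax⟩ := M.exists_max_image f (Finset.card_pos.mp (by omega))
    have hcard : (M.erase m).card = n := by rw [Finset.card_erase_of_mem hm, hn]; rfl
    obtain ⟨S, hS, hSk, hsum⟩ := ih (M.erase m) (by omega) hcard
    refine ⟨S, hS.trans (M.erase_subset m), hSk, ?_⟩
    have hle : ∑ i ∈ M.erase m, f i ≤ n * f m := by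
      have := Finset.sum_le_card_nsmul (M.erase m) f (f m)
        fun i hi => hmax i (Finset.mem_of_mem_erase hi)
      rwa [hcard, nsmul_eq_mul] at this
    have hn0 : (0 : ℝ) < n := by exact_mod_cast (by omega : 0 < n)
    have hk0 : (0 : ℝ) ≤ k := Nat.cast_nonneg k
    rw [← Finset.sum_erase_add M f hm]
    push_cast
    refine le_of_mul_le_mul_left ?_ hn0
    nlinarith [mul_le_mul_of_nonneg_left hle hk0,
      mul_le_mul_of_nonneg_left hsum (by linarith : (0 : ℝ) ≤ n + 1)]

/-- a large-cardinality subset of a set of narrow items of small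
total area can be packed into the horizontally shrunk box
`[0, (1-ε_s)N] × [0, N]`. -/
theorem steinberg_narrow_selection
    {ι : Type*} (N εa εs εsmall : ℝ) (hN : 0 < N)
    (hεa0 : 0 < εa) (hεa : εa < 1 / 2)
    (hεs0 : 0 < εs) (hεs1 : εs < 1)
    (hεsm0 : 0 < εsmall) (hεsm : εsmall ≤ εs / 2)
    (M : Finset ι) (w h : ι → ℝ)
    (hwpos : ∀ i ∈ M, 0 < w i) (hhpos : ∀ i ∈ M, 0 < h i)
    (hwsm : ∀ i ∈ M, w i ≤ εsmall * N) (hhN : ∀ i ∈ M, h i ≤ N)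
    (harea : ∑ i ∈ M, w i * h i ≤ (1 / 2 + εa) * N ^ 2) :
    ∃ S ⊆ M, ((1 - 2 * εs - 2 * εa) * M.card ≤ (S.card : ℝ)) ∧
      IsPacking S w h (Set.Icc 0 ((1 - εs) * N) ×ˢ Set.Icc 0 N) := by
  classical
  rcases le_or_gt (1 - 2 * εs - 2 * εa) 0 with hc | hc
  · refine ⟨∅, M.empty_subset, ?_, fun _ => 0, fun _ => 0, by simp, by simp⟩
    simpa using mul_nonpos_of_nonpos_of_nonneg hc (Nat.cast_nonneg M.card)
  set c := 1 - 2 * εs - 2 * εa with hcdef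
  have hcard_nonneg : (0 : ℝ) ≤ M.card := Nat.cast_nonneg _
  have hkM : ⌈c * M.card⌉₊ ≤ M.card := Nat.ceil_le.mpr (by nlinarith)
  obtain ⟨S, hSM, hSk, hSarea⟩ :=
    Finset.exists_subset_card_eq_mul_sum_le (fun i => w i * h i) M _ hkM
  have hSge : c * M.card ≤ S.card := hSk ▸ Nat.le_ceil _
  have hSlt : (S.card : ℝ) < c * M.card + 1 :=
    hSk ▸ Nat.ceil_lt_add_one (mul_nonneg hc.le hcard_nonneg)
  rw [← hSk] at hSarea
  refine ⟨S, hSM, hSge, ?_⟩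
  rcases S.eq_empty_or_nonempty with rfl | hSne
  · exact ⟨fun _ => 0, fun _ => 0, by simp, by simp⟩
  obtain ⟨m, hm, -, U, -, hUcard, hUarea, hfit⟩ :=
    exists_fitsInBox_nextFit hN.le w h S hSne (fun i hi => (hwpos i (hSM hi)).le)
      (fun i hi => (hhpos i (hSM hi)).le) (fun i hi => hhN i (hSM hi)) 0
  refine (hfit.mono le_rfl ?_ le_rfl le_rfl).isPacking
  rw [zero_add]
  have hwm : w m ≤ εs / 2 * N :=
    (hwsm m (hSM hm)).trans (mul_le_mul_of_nonneg_right hεsm hN.le)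
  have hmarea : 0 ≤ w m * h m := (mul_pos (hwpos m (hSM hm)) (hhpos m (hSM hm))).le
  rcases le_or_gt (S.card * (εs / 2)) (1 - εs) with hfew | hmany
  · calc U ≤ S.card * w m := hUcard
      _ ≤ S.card * (εs / 2 * N) := mul_le_mul_of_nonneg_left hwm (Nat.cast_nonneg _)
      _ = S.card * (εs / 2) * N := by ring
      _ ≤ (1 - εs) * N := mul_le_mul_of_nonneg_right hfew hN.le
  · set k := (S.card : ℝ)
    set A := ∑ i ∈ S, w i * h i
    have hA : 0 ≤ A := Finset.sum_nonneg fun i hi =>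
      (mul_pos (hwpos i (hSM hi)) (hhpos i (hSM hi))).le
    have hk0 : (0 : ℝ) ≤ k := Nat.cast_nonneg _
    have hk1 : 1 < k := by nlinarith
    have hfrac : c * (1 / 2 + εa) ≤ 1 / 2 - εs := by
      nlinarith [mul_pos hεs0 hεa0, mul_pos hεa0 hεa0]
    have hshare : (k - 1) * A ≤ k * ((1 / 2 - εs) * N ^ 2) :=
      calc (k - 1) * A ≤ c * M.card * A := mul_le_mul_of_nonneg_right (by linarith) hA
        _ = c * (M.card * A) := by ring
        _ ≤ c * (k * ((1 / 2 + εa) * N ^ 2)) := mul_le_mul_of_nonneg_left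
            (hSarea.trans (mul_le_mul_of_nonneg_left harea hk0)) hc.le
        _ = k * (c * (1 / 2 + εa) * N ^ 2) := by ring
        _ ≤ k * ((1 / 2 - εs) * N ^ 2) := mul_le_mul_of_nonneg_left
            (mul_le_mul_of_nonneg_right hfrac (sq_nonneg N)) hk0
    have hcoef : k * (1 / 2 - εs) ≤ (k - 1) * (1 / 2 - 3 / 4 * εs) := by nlinarith
    have hAle : A ≤ (1 / 2 - 3 / 4 * εs) * N ^ 2 := by
      refine le_of_mul_le_mul_left ?_ (sub_pos.mpr hk1)
      calc (k - 1) * A ≤ k * ((1 / 2 - εs) * N ^ 2) := hshare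
        _ = k * (1 / 2 - εs) * N ^ 2 := by ring
        _ ≤ (k - 1) * (1 / 2 - 3 / 4 * εs) * N ^ 2 :=
            mul_le_mul_of_nonneg_right hcoef (sq_nonneg N)
        _ = (k - 1) * ((1 / 2 - 3 / 4 * εs) * N ^ 2) := by ring
    refine le_of_mul_le_mul_left ?_ hN
    nlinarith [mul_le_mul_of_nonneg_left hwm hN.le]
end

section
/- Let N > 0 and 0 < ε_large ≤ 1/4. Let I' be a finite set of items such that every i ∈ I' satisfies w(i) ≤ (1/2 + 2ε_large)N and h(i) ≤ (1/2 + 2ε_large)N, and let α, β be reals with 0 ≤ α ≤ 1/2 − 2ε_large and 0 ≤ β ≤ 1/2 − 2ε_large. If a(I') ≤ (1/2 − (α + β)(1/2 + 2ε_large) − 8ε_large²)·N², then all of I' can be packed into the box [0, (1 − α)N] × [0, (1 − β)N]. -/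
/-- The items of `I` admit a packing into the box `[0, u] × [0, v]`, expressed by inequalities. -/
def BoxPackable {ι : Type*} (w h : ι → ℝ) (I : Finset ι) (u v : ℝ) : Prop :=
  ∃ x y : ι → ℝ,
    (∀ i ∈ I, 0 ≤ x i ∧ x i + w i ≤ u ∧ 0 ≤ y i ∧ y i + h i ≤ v) ∧
    (∀ i ∈ I, ∀ j ∈ I, i ≠ j →
      x i + w i ≤ x j ∨ x j + w j ≤ x i ∨ y i + h i ≤ y j ∨ y j + h j ≤ y i)

/-- The hypotheses of Steinberg's theorem, with `A` and `B` upper bounds for the widths and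
heights that are at least half of the corresponding side of the box. -/
structure SteinbergCondition {ι : Type*} (w h : ι → ℝ) (I : Finset ι) (u v A B : ℝ) : Prop where
  width_pos : ∀ i ∈ I, 0 < w i
  height_pos : ∀ i ∈ I, 0 < h i
  width_le : ∀ i ∈ I, w i ≤ A
  height_le : ∀ i ∈ I, h i ≤ B
  le_two_width : u ≤ 2 * A
  width_le_box : A ≤ u
  le_two_height : v ≤ 2 * B
  height_le_box : B ≤ v
  area_le : 2 * ∑ i ∈ I, w i * h i ≤ u * v - (2 * A - u) * (2 * B - v)

/-- Steinberg's theorem for the item set `I`. -/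
def SteinbergHolds {ι : Type*} (w h : ι → ℝ) (I : Finset ι) : Prop :=
  ∀ u v A B : ℝ, SteinbergCondition w h I u v A B → BoxPackable w h I u v

section Steinberg

variable {ι : Type*} {w h : ι → ℝ} {I J K : Finset ι} {u v A B : ℝ}

theorem BoxPackable.swap (H : BoxPackable w h I u v) : BoxPackable h w I v u := by
  obtain ⟨x, y, hbox, hsep⟩ := H
  refine ⟨y, x, fun i hi => ?_, fun i hi j hj hij => ?_⟩
  · obtain ⟨h1, h2, h3, h4⟩ := hbox i hi
    exact ⟨h3, h4, h1, h2⟩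
  · rcases hsep i hi j hj hij with h1 | h1 | h1 | h1 <;> simp [h1]

theorem SteinbergCondition.swap (H : SteinbergCondition w h I u v A B) :
    SteinbergCondition h w I v u B A where
  width_pos := H.height_pos
  height_pos := H.width_pos
  width_le := H.height_le
  height_le := H.width_le
  le_two_width := H.le_two_height
  width_le_box := H.height_le_box
  le_two_height := H.le_two_width
  height_le_box := H.width_le_box
  area_le := by
    have := H.area_le
    simp only [mul_comm (h _)]
    linarith

theorem SteinbergHolds.swap (H : SteinbergHolds w h I) : SteinbergHolds h w I :=
  fun u v A B hc => (H v u B A hc.swap).swap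

theorem boxPackable_empty : BoxPackable w h ∅ u v := ⟨0, 0, by simp, by simp⟩

theorem boxPackable_singleton {i : ι} (hw : w i ≤ u) (hh : h i ≤ v) :
    BoxPackable w h {i} u v :=
  ⟨0, 0, by simpa using ⟨hw, hh⟩, by simp⟩

theorem BoxPackable.union_right [DecidableEq ι] {u₁ u₂ : ℝ} (h₁ : BoxPackable w h J u₁ v)
    (h₂ : BoxPackable w h K u₂ v) (hu₁ : 0 ≤ u₁) (hu₂ : 0 ≤ u₂) (hu : u₁ + u₂ ≤ u) :
    BoxPackable w h (J ∪ K) u v := by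
  obtain ⟨x₁, y₁, hb₁, hs₁⟩ := h₁
  obtain ⟨x₂, y₂, hb₂, hs₂⟩ := h₂
  refine ⟨fun i => if i ∈ J then x₁ i else u₁ + x₂ i, fun i => if i ∈ J then y₁ i else y₂ i,
    fun i hi => ?_, fun i hi j hj hij => ?_⟩
  · by_cases hJ : i ∈ J
    · obtain ⟨h1, h2, h3, h4⟩ := hb₁ i hJ
      simp only [hJ, if_true]
      exact ⟨h1, by linarith, h3, h4⟩
    · obtain ⟨h1, h2, h3, h4⟩ := hb₂ i (by grind)
      simp only [hJ, if_false]
      exact ⟨by linarith, by linarith, h3, h4⟩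
  · by_cases hJ : i ∈ J <;> by_cases hJ' : j ∈ J
    · simpa [hJ, hJ'] using hs₁ i hJ j hJ' hij
    · have := hb₁ i hJ
      have := hb₂ j (by grind)
      simp only [hJ, hJ', if_true, if_false]
      left; linarith
    · have := hb₁ j hJ'
      have := hb₂ i (by grind)
      simp only [hJ, hJ', if_true, if_false]
      right; left; linarith
    · have := hs₂ i (by grind) j (by grind) hij
      simp only [hJ, hJ', if_false]
      rcases this with h1 | h1 | h1 | h1
      · left; linarith
      · right; left; linarith
      · simp [h1]
      · simp [h1]

theorem boxPackable_pair [DecidableEq ι] {i k : ι} (hwi : w i ≤ u) (hwk : w k ≤ u)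
    (hhi : 0 ≤ h i) (hhk : 0 ≤ h k) (hv : h i + h k ≤ v) : BoxPackable w h {i, k} u v :=
  ((boxPackable_singleton (w := h) (h := w) le_rfl hwi).union_right
    (boxPackable_singleton (w := h) (h := w) le_rfl hwk) hhi hhk hv).swap

/-- Stacking the items of `T` by decreasing width: the staircase below the top of each item is
covered by the items. -/
theorem exists_stack (T : Finset ι) (hw : ∀ i ∈ T, 0 ≤ w i) (hh : ∀ i ∈ T, 0 ≤ h i) :
    ∃ y : ι → ℝ, (∀ i ∈ T, 0 ≤ y i ∧ y i + h i ≤ ∑ j ∈ T, h j ∧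
        w i * (y i + h i) ≤ ∑ j ∈ T, w j * h j) ∧
      ∀ i ∈ T, ∀ j ∈ T, i ≠ j → y i + h i ≤ y j ∨ y j + h j ≤ y i := by
  classical
  induction T using Finset.induction_on_min_value w with
  | empty => exact ⟨0, by simp, by simp⟩
  | insert a s ha hmin ih =>
    obtain ⟨y, hy, hsep⟩ := ih (fun i hi => hw i (by simp [hi])) (fun i hi => hh i (by simp [hi]))
    have hwa := hw a (by simp)
    have hha := hh a (by simp)
    have hs : 0 ≤ ∑ j ∈ s, h j := Finset.sum_nonneg fun i hi => hh i (by simp [hi])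
    refine ⟨fun i => if i = a then ∑ j ∈ s, h j else y i, fun i hi => ?_, fun i hi j hj hij => ?_⟩
    · rw [Finset.sum_insert ha, Finset.sum_insert ha]
      by_cases hia : i = a
      · subst hia
        simp only [if_true]
        refine ⟨hs, by linarith, ?_⟩
        have : w i * ∑ j ∈ s, h j ≤ ∑ j ∈ s, w j * h j := by
          rw [Finset.mul_sum]
          exact Finset.sum_le_sum fun j hj =>
            mul_le_mul_of_nonneg_right (hmin j hj) (hh j (by simp [hj]))
        linarith
      · obtain ⟨h1, h2, h3⟩ := hy i (by grind)
        simp only [hia, if_false]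
        exact ⟨h1, by linarith, by nlinarith⟩
    · by_cases hia : i = a <;> by_cases hja : j = a
      · exact absurd (hia.trans hja.symm) hij
      · subst hia
        simp only [hja, if_true, if_false]
        right; exact (hy j (by grind)).2.1
      · subst hja
        simp only [hia, if_true, if_false]
        left; exact (hy i (by grind)).2.1
      · simp only [hia, hja, if_false]
        exact hsep i (by grind) j (by grind) hij

/-- Steinberg's corner packing: wide items are stacked in the lower left corner, items that are
too high for the remaining strip hang from the upper right corner. -/
theorem boxPackable_of_wide (ih : ∀ J ⊂ I, SteinbergHolds w h J)
    (hc : SteinbergCondition w h I u v A B) (hwide : ∃ i ∈ I, u / 2 < w i) :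
    BoxPackable w h I u v := by
  classical
  obtain ⟨i₀, hi₀, hwi₀⟩ := hwide
  have hwp := hc.width_pos
  have hhp := hc.height_pos
  have hA := hc.width_le
  have hB := hc.height_le
  have hA1 := hc.le_two_width
  have hA2 := hc.width_le_box
  have hB1 := hc.le_two_height
  have hB2 := hc.height_le_box
  have hS := hc.area_le
  have hu : 0 < u := by linarith [hwp i₀ hi₀, hA i₀ hi₀]
  have hv : 0 < v := by linarith [hhp i₀ hi₀, hB i₀ hi₀]
  set T := I.filter (fun i => u / 2 < w i) with hT
  set H := ∑ i ∈ T, h i with hH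
  set U := I.filter (fun i => w i ≤ u / 2 ∧ v - H < h i) with hU
  set R := I.filter (fun i => w i ≤ u / 2 ∧ h i ≤ v - H) with hR
  set W := ∑ i ∈ U, w i with hW
  have hsum : ∑ i ∈ I, w i * h i =
      ∑ i ∈ T, w i * h i + ∑ i ∈ U, w i * h i + ∑ i ∈ R, w i * h i := by
    have hI : I = T ∪ U ∪ R := by ext i; grind
    rw [hI, Finset.sum_union, Finset.sum_union]
    · rw [Finset.disjoint_left]; grind
    · rw [Finset.disjoint_left]; grind
  have hTm : ∀ i ∈ T, i ∈ I ∧ u / 2 < w i := by grind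
  have hUm : ∀ i ∈ U, i ∈ I ∧ w i ≤ u / 2 ∧ v - H < h i := by grind
  have hRm : ∀ i ∈ R, i ∈ I ∧ w i ≤ u / 2 ∧ h i ≤ v - H := by grind
  have hST0 : 0 ≤ ∑ i ∈ T, w i * h i := Finset.sum_nonneg fun i hi =>
    (mul_pos (hwp i (hTm i hi).1) (hhp i (hTm i hi).1)).le
  have hSU0 : 0 ≤ ∑ i ∈ U, w i * h i := Finset.sum_nonneg fun i hi =>
    (mul_pos (hwp i (hUm i hi).1) (hhp i (hUm i hi).1)).le
  have hSR0 : 0 ≤ ∑ i ∈ R, w i * h i := Finset.sum_nonneg fun i hi =>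
    (mul_pos (hwp i (hRm i hi).1) (hhp i (hRm i hi).1)).le
  have hH0 : 0 ≤ H := Finset.sum_nonneg fun i hi => (hhp i (hTm i hi).1).le
  have hW0 : 0 ≤ W := Finset.sum_nonneg fun i hi => (hwp i (hUm i hi).1).le
  have hcorr : 0 ≤ (2 * A - u) * (2 * B - v) := mul_nonneg (by linarith) (by linarith)
  have hHv : H ≤ v := by
    have : u / 2 * H ≤ ∑ i ∈ T, w i * h i := by
      rw [hH, Finset.mul_sum]
      exact Finset.sum_le_sum fun i hi =>
        mul_le_mul_of_nonneg_right (hTm i hi).2.le (hhp i (hTm i hi).1).le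
    nlinarith
  -- A wide and a hanging staircase cannot overlap, by the area bound.
  have key : ∀ a b X Y : ℝ, u / 2 ≤ a → a ≤ A → 0 < b → b ≤ B →
      a * Y ≤ ∑ i ∈ T, w i * h i → b * X ≤ ∑ i ∈ U, w i * h i →
      v < Y + b → a + X ≤ u := by
    intro a b X Y ha haA hb hbB h1 h2 hY
    by_contra! hX
    have e1 : a * (v - b) < a * Y := mul_lt_mul_of_pos_left (by linarith) (by linarith)
    have e2 : b * (u - a) < b * X := mul_lt_mul_of_pos_left (by linarith) hb
    have e3 : (2 * a - u) * (2 * b - v) ≤ (2 * A - u) * (2 * B - v) := by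
      have f1 : (2 * a - u) * (2 * b - v) ≤ (2 * a - u) * (2 * B - v) :=
        mul_le_mul_of_nonneg_left (by linarith) (by linarith)
      have f2 : (2 * a - u) * (2 * B - v) ≤ (2 * A - u) * (2 * B - v) :=
        mul_le_mul_of_nonneg_right (by linarith) (by linarith)
      linarith
    nlinarith
  obtain ⟨a, ha, haT⟩ := T.exists_min_image w ⟨i₀, by grind⟩
  have haH : w a * H ≤ ∑ i ∈ T, w i * h i := by
    rw [hH, Finset.mul_sum]
    exact Finset.sum_le_sum fun i hi =>
      mul_le_mul_of_nonneg_right (haT i hi) (hhp i (hTm i hi).1).le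
  obtain ⟨haI, haw⟩ := hTm a ha
  have hvW : (v - H) * W ≤ ∑ i ∈ U, w i * h i := by
    rw [hW, Finset.mul_sum]
    refine Finset.sum_le_sum fun i hi => ?_
    rw [mul_comm]
    exact mul_le_mul_of_nonneg_left (hUm i hi).2.2.le (hwp i (hUm i hi).1).le
  have haW : w a + W ≤ u := by
    rcases U.eq_empty_or_nonempty with hne | hne
    · simp only [hW, hne, Finset.sum_empty, add_zero]
      linarith [hA a haI]
    · obtain ⟨b, hb, hbU⟩ := U.exists_min_image h hne
      obtain ⟨hbI, hbw, hbh⟩ := hUm b hb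
      refine key (w a) (h b) W H haw.le (hA a haI) (hhp b hbI) (hB b hbI) haH ?_ (by linarith)
      rw [hW, Finset.mul_sum]
      refine Finset.sum_le_sum fun i hi => ?_
      rw [mul_comm]
      exact mul_le_mul_of_nonneg_left (hbU i hi) (hwp i (hUm i hi).1).le
  have hRc : SteinbergCondition w h R (u - W) (v - H) (u / 2) (v - H) :=
    { width_pos := fun i hi => hwp i (hRm i hi).1
      height_pos := fun i hi => hhp i (hRm i hi).1
      width_le := fun i hi => (hRm i hi).2.1
      height_le := fun i hi => (hRm i hi).2.2
      le_two_width := by linarith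
      width_le_box := by linarith
      le_two_height := by linarith
      height_le_box := le_rfl
      area_le := by nlinarith }
  have hRI : R ⊂ I := by
    refine Finset.ssubset_iff_subset_ne.2 ⟨Finset.filter_subset _ _, fun he => ?_⟩
    have := (hRm i₀ (he ▸ hi₀)).2.1
    linarith
  obtain ⟨xR, yR, hRb, hRs⟩ := ih R hRI _ _ _ _ hRc
  obtain ⟨yT, hyT, hyTs⟩ := exists_stack (w := w) (h := h) T
    (fun i hi => (hwp i (hTm i hi).1).le) (fun i hi => (hhp i (hTm i hi).1).le)
  obtain ⟨xU, hxU, hxUs⟩ := exists_stack (w := h) (h := w) U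
    (fun i hi => (hhp i (hUm i hi).1).le) (fun i hi => (hwp i (hUm i hi).1).le)
  simp only [mul_comm (h _) (w _)] at hxU
  have hcases : ∀ i ∈ I, (i ∈ T) ∨ (i ∉ T ∧ i ∈ U) ∨ (i ∉ T ∧ i ∉ U ∧ i ∈ R) := by grind
  have hTU : ∀ i ∈ T, ∀ j ∈ U, w i ≤ u - xU j - w j ∨ yT i + h i ≤ v - h j := by
    intro i hi j hj
    by_contra! hcon
    have := key (w i) (h j) (xU j + w j) (yT i + h i) (hTm i hi).2.le (hA i (hTm i hi).1)
      (hhp j (hUm j hj).1) (hB j (hUm j hj).1) (hyT i hi).2.2 (hxU j hj).2.2 (by linarith)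
    linarith
  refine ⟨fun i => if i ∈ T then 0 else if i ∈ U then u - xU i - w i else xR i,
    fun i => if i ∈ T then yT i else if i ∈ U then v - h i else H + yR i,
    fun i hi => ?_, fun i hi j hj hij => ?_⟩
  · have h1 := hA i hi
    have h2 := hB i hi
    have h3 := hhp i hi
    rcases hcases i hi with hiT | ⟨hiT, hiU⟩ | ⟨hiT, hiU, hiR⟩
    · obtain ⟨g1, g2, -⟩ := hyT i hiT
      simp only [hiT, if_true]
      refine ⟨le_rfl, ?_, ?_, ?_⟩ <;> linarith
    · obtain ⟨g1, g2, -⟩ := hxU i hiU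
      simp only [hiT, hiU, if_true, if_false]
      refine ⟨?_, ?_, ?_, ?_⟩ <;> linarith
    · obtain ⟨g1, g2, g3, g4⟩ := hRb i hiR
      simp only [hiT, hiU, if_false]
      refine ⟨?_, ?_, ?_, ?_⟩ <;> linarith
  · rcases hcases i hi with hiT | ⟨hiT, hiU⟩ | ⟨hiT, hiU, hiR⟩ <;>
      rcases hcases j hj with hjT | ⟨hjT, hjU⟩ | ⟨hjT, hjU, hjR⟩
    · simp only [hiT, hjT, if_true]
      have := hyTs i hiT j hjT hij
      tauto
    · simp only [hiT, hjT, hjU, if_true, if_false]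
      rcases hTU i hiT j hjU with g | g
      · left; linarith
      · right; right; left; linarith
    · simp only [hiT, hjT, hjU, if_true, if_false]
      have := hyT i hiT
      have := hRb j hjR
      right; right; left; linarith
    · simp only [hiT, hiU, hjT, if_true, if_false]
      rcases hTU j hjT i hiU with g | g
      · right; left; linarith
      · right; right; right; linarith
    · simp only [hiT, hiU, hjT, hjU, if_true, if_false]
      rcases hxUs i hiU j hjU hij with g | g
      · right; left; linarith
      · left; linarith
    · simp only [hiT, hiU, hjT, hjU, if_true, if_false]
      have := hxU i hiU
      have := hRb j hjR
      right; left; linarith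
    · simp only [hiT, hiU, hjT, if_true, if_false]
      have := hyT j hjT
      have := hRb i hiR
      right; right; right; linarith
    · simp only [hiT, hiU, hjT, hjU, if_true, if_false]
      have := hxU j hjU
      have := hRb i hiR
      left; linarith
    · simp only [hiT, hiU, hjT, hjU, if_false]
      rcases hRs i hiR j hjR hij with g | g | g | g
      · left; linarith
      · right; left; linarith
      · right; right; left; linarith
      · right; right; right; linarith

theorem SteinbergHolds.boxPackable_of_height_le_half (H : SteinbergHolds w h I)
    (hwp : ∀ i ∈ I, 0 < w i) (hhp : ∀ i ∈ I, 0 < h i) (hw : ∀ i ∈ I, w i ≤ u)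
    (hh : ∀ i ∈ I, h i ≤ v / 2) (hu : 0 ≤ u) (hv : 0 ≤ v)
    (hS : 2 * ∑ i ∈ I, w i * h i ≤ u * v) : BoxPackable w h I u v :=
  H u v u (v / 2)
    { width_pos := hwp
      height_pos := hhp
      width_le := hw
      height_le := hh
      le_two_width := by linarith
      width_le_box := le_rfl
      le_two_height := by linarith
      height_le_box := by linarith
      area_le := by linarith }

/-- Hypotheses of Steinberg's theorem when no item exceeds half of the box in either direction,
together with the theorem for smaller item sets. -/
structure SteinbergSmallStep {ι : Type*} (w h : ι → ℝ) (I : Finset ι) (u v : ℝ) : Prop where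
  smaller : ∀ J ⊂ I, SteinbergHolds w h J
  width_pos : ∀ i ∈ I, 0 < w i
  height_pos : ∀ i ∈ I, 0 < h i
  width_le : ∀ i ∈ I, w i ≤ u / 2
  height_le : ∀ i ∈ I, h i ≤ v / 2
  box_width_pos : 0 < u
  box_height_pos : 0 < v
  area_le : 2 * ∑ i ∈ I, w i * h i ≤ u * v

theorem SteinbergSmallStep.swap (H : SteinbergSmallStep w h I u v) :
    SteinbergSmallStep h w I v u where
  smaller := fun J hJ => (H.smaller J hJ).swap
  width_pos := H.height_pos
  height_pos := H.width_pos
  width_le := H.height_le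
  height_le := H.width_le
  box_width_pos := H.box_height_pos
  box_height_pos := H.box_width_pos
  area_le := by
    have := H.area_le
    simp only [mul_comm (h _)]
    linarith

/-- A set `J` packed into a strip of width at most `u / 2` can be split off if the remaining items
are small enough in area. -/
theorem SteinbergSmallStep.boxPackable_of_split [DecidableEq ι]
    (H : SteinbergSmallStep w h I u v) (hJI : J ⊆ I) (hJ : J.Nonempty) {a : ℝ} (ha0 : 0 ≤ a)
    (ha : a ≤ u / 2) (hpack : BoxPackable w h J a v)
    (hS : 2 * ∑ i ∈ I \ J, w i * h i ≤ (u - a) * v) : BoxPackable w h I u v := by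
  have hsub : I \ J ⊂ I := Finset.sdiff_ssubset hJI hJ
  have hrest : BoxPackable w h (I \ J) (u - a) v :=
    (H.smaller _ hsub).boxPackable_of_height_le_half
      (fun i hi => H.width_pos i (hsub.1 hi)) (fun i hi => H.height_pos i (hsub.1 hi))
      (fun i hi => (H.width_le i (hsub.1 hi)).trans (by linarith))
      (fun i hi => H.height_le i (hsub.1 hi)) (by linarith [H.box_width_pos])
      H.box_height_pos.le hS
  rw [← Finset.union_sdiff_of_subset hJI]
  exact hpack.union_right hrest ha0 (by linarith [H.box_width_pos]) (by linarith)

theorem SteinbergSmallStep.boxPackable_of_large_item (H : SteinbergSmallStep w h I u v) {i : ι}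
    (hi : i ∈ I) (hS : ∑ j ∈ I, w j * h j - u * v / 4 ≤ w i * h i) :
    BoxPackable w h I u v := by
  classical
  have hw := H.width_le i hi
  have hv := H.box_height_pos
  refine H.boxPackable_of_split (Finset.singleton_subset_iff.2 hi) (Finset.singleton_nonempty i)
    (H.width_pos i hi).le hw
    (boxPackable_singleton le_rfl (by linarith [H.height_le i hi])) ?_
  have := Finset.sum_sdiff (f := fun j => w j * h j) (Finset.singleton_subset_iff.2 hi)
  rw [Finset.sum_singleton] at this
  nlinarith

theorem SteinbergSmallStep.boxPackable_of_pair [DecidableEq ι] (H : SteinbergSmallStep w h I u v)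
    {i k : ι} (hi : i ∈ I) (hk : k ∈ I) (hik : i ≠ k) (hw : w k ≤ w i)
    (hS : w i * v ≤ 2 * (w i * h i + w k * h k)) : BoxPackable w h I u v := by
  have hsub : {i, k} ⊆ I := by grind
  refine H.boxPackable_of_split hsub (by simp) (H.width_pos i hi).le (H.width_le i hi)
    (boxPackable_pair le_rfl hw (H.height_pos i hi).le (H.height_pos k hk).le
      (by linarith [H.height_le i hi, H.height_le k hk])) ?_
  have := Finset.sum_sdiff (f := fun j => w j * h j) hsub
  rw [Finset.sum_pair hik] at this
  nlinarith [H.area_le]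

theorem SteinbergSmallStep.boxPackable_of_two_big (H : SteinbergSmallStep w h I u v)
    {i k : ι} (hi : i ∈ I) (hk : k ∈ I) (hik : i ≠ k) (hwi : u / 4 < w i) (hwk : u / 4 < w k)
    (hhi : v / 4 < h i) (hhk : v / 4 < h k) : BoxPackable w h I u v := by
  classical
  wlog hw : w k ≤ w i generalizing i k
  · exact this hk hi hik.symm hwk hwi hhk hhi (le_of_not_ge hw)
  have hu := H.box_width_pos
  have hv := H.box_height_pos
  have hwi' := H.width_le i hi
  have hwk' := H.width_le k hk
  have hhi' := H.height_le i hi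
  have hhk' := H.height_le k hk
  by_cases h1 : w i * v ≤ 2 * (w i * h i + w k * h k)
  · exact H.boxPackable_of_pair hi hk hik hw h1
  rcases le_total (h k) (h i) with hh | hh
  · by_cases h2 : h i * u ≤ 2 * (h i * w i + h k * w k)
    · exact (H.swap.boxPackable_of_pair hi hk hik hh h2).swap
    exfalso
    push Not at h1 h2
    have e : u / 4 * (v / 4) < w k * h k := by nlinarith
    have e1 : u * v / 8 < w i * (v - 2 * h i) := by nlinarith
    have e2 : u * v / 8 < h i * (u - 2 * w i) := by nlinarith
    have p1 : w i * (u - 2 * w i) ≤ u ^ 2 / 8 := by nlinarith [sq_nonneg (u - 4 * w i)]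
    have p2 : h i * (v - 2 * h i) ≤ v ^ 2 / 8 := by nlinarith [sq_nonneg (v - 4 * h i)]
    have q1 : (u * v / 8) * (u * v / 8) < w i * (v - 2 * h i) * (h i * (u - 2 * w i)) :=
      mul_lt_mul'' e1 e2 (by positivity) (by positivity)
    have q2 : w i * (u - 2 * w i) * (h i * (v - 2 * h i)) ≤ u ^ 2 / 8 * (v ^ 2 / 8) :=
      mul_le_mul p1 p2 (mul_nonneg (by linarith) (by linarith)) (by positivity)
    nlinarith
  · by_cases h2 : h k * u ≤ 2 * (h k * w k + h i * w i)
    · exact (H.swap.boxPackable_of_pair hk hi hik.symm hh h2).swap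
    exfalso
    push Not at h1 h2
    have e1 : w i * (v - 2 * h i) ≤ w i * (v / 2) :=
      mul_le_mul_of_nonneg_left (by linarith) (by linarith)
    have e2 : h k * (u - 2 * w k) ≤ h k * (u / 2) :=
      mul_le_mul_of_nonneg_left (by linarith) (by linarith)
    have e3 : h k * (u / 4) ≤ h k * w k := mul_le_mul_of_nonneg_left hwk.le (by linarith)
    have e4 : w i * (v / 4) ≤ w i * h i := mul_le_mul_of_nonneg_left hhi.le (by linarith)
    linarith

theorem SteinbergSmallStep.boxPackable_of_vertical_cut (H : SteinbergSmallStep w h I u v)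
    (hJI : J ⊂ I) (hJ : J.Nonempty) (hw : ∀ i ∈ I, i ∉ J → w i ≤ u / 4)
    (hS1 : ∑ i ∈ I, w i * h i - u * v / 4 ≤ ∑ i ∈ J, w i * h i)
    (hS2 : ∑ i ∈ J, w i * h i ≤ 3 / 8 * (u * v)) : BoxPackable w h I u v := by
  classical
  have hu := H.box_width_pos
  have hv := H.box_height_pos
  have hsum := Finset.sum_sdiff (f := fun j => w j * h j) hJI.1
  have hS := H.area_le
  obtain ⟨c, hc1, hc2, hc3, hc4⟩ : ∃ c, u / 2 ≤ c ∧ c ≤ 3 / 4 * u ∧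
      2 * ∑ i ∈ J, w i * h i ≤ c * v ∧ 2 * ∑ i ∈ I \ J, w i * h i ≤ (u - c) * v := by
    rcases le_total (2 * ∑ i ∈ J, w i * h i) (u / 2 * v) with hle | hle
    · exact ⟨u / 2, le_rfl, by linarith, hle, by linarith⟩
    · have hcv : 2 * (∑ i ∈ J, w i * h i) / v * v = 2 * ∑ i ∈ J, w i * h i :=
        div_mul_cancel₀ _ hv.ne'
      refine ⟨2 * (∑ i ∈ J, w i * h i) / v, ?_, ?_, hcv.ge, ?_⟩
      · rwa [le_div_iff₀ hv]
      · rw [div_le_iff₀ hv]; linarith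
      · rw [sub_mul, hcv]; linarith
  have hsub : I \ J ⊂ I := Finset.sdiff_ssubset hJI.1 hJ
  have hleft : BoxPackable w h J c v :=
    (H.smaller _ hJI).boxPackable_of_height_le_half
      (fun i hi => H.width_pos i (hJI.1 hi)) (fun i hi => H.height_pos i (hJI.1 hi))
      (fun i hi => (H.width_le i (hJI.1 hi)).trans hc1)
      (fun i hi => H.height_le i (hJI.1 hi)) (by linarith) hv.le hc3
  have hright : BoxPackable w h (I \ J) (u - c) v :=
    (H.smaller _ hsub).boxPackable_of_height_le_half
      (fun i hi => H.width_pos i (hsub.1 hi)) (fun i hi => H.height_pos i (hsub.1 hi))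
      (fun i hi => (hw i (hsub.1 hi) (Finset.mem_sdiff.1 hi).2).trans (by linarith))
      (fun i hi => H.height_le i (hsub.1 hi)) (by linarith) hv.le hc4
  rw [← Finset.union_sdiff_of_subset hJI.1]
  exact hleft.union_right hright (by linarith) (by linarith) (by linarith)

theorem SteinbergSmallStep.boxPackable_of_few_wide (H : SteinbergSmallStep w h I u v)
    {k : ι} (hk : k ∈ I) (hkw : w k ≤ u / 4)
    (hS : ∑ i ∈ I with u / 4 < w i, w i * h i ≤ 3 / 8 * (u * v)) : BoxPackable w h I u v := by
  classical
  have hu := H.box_width_pos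
  have hv := H.box_height_pos
  by_cases hlarge : ∃ i ∈ I, ∑ j ∈ I, w j * h j - u * v / 4 ≤ w i * h i
  · obtain ⟨i, hi, hSi⟩ := hlarge
    exact H.boxPackable_of_large_item hi hSi
  push Not at hlarge
  set F := (I.powerset.filter fun J => I.filter (fun i => u / 4 < w i) ⊆ J ∧
    ∑ i ∈ I, w i * h i - u * v / 4 ≤ ∑ i ∈ J, w i * h i) with hF
  have huv : 0 < u * v := mul_pos hu hv
  obtain ⟨J, hJF, hJmin⟩ := F.exists_min_image Finset.card
    ⟨I, by simp only [hF, Finset.mem_filter, Finset.mem_powerset]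
           exact ⟨subset_rfl, Finset.filter_subset _ _, by linarith⟩⟩
  simp only [hF, Finset.mem_filter, Finset.mem_powerset] at hJF hJmin
  obtain ⟨hJI, hwJ, hSJ⟩ := hJF
  have hdrop : ∀ i ∈ J, w i ≤ u / 4 →
      ∑ j ∈ J, w j * h j - w i * h i < ∑ j ∈ I, w j * h j - u * v / 4 := by
    intro i hi hiw
    by_contra! hcon
    have hsum := Finset.add_sum_erase J (fun j => w j * h j) hi
    have := hJmin (J.erase i) ⟨(Finset.erase_subset _ _).trans hJI, fun j hj => by grind,
      by linarith⟩
    exact absurd (Finset.card_erase_lt_of_mem hi) (not_lt.2 this)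
  have hkJ : J ≠ I := by
    rintro rfl
    have h1 := hdrop k hk hkw
    have h2 : w k * h k ≤ u / 4 * (v / 2) :=
      mul_le_mul hkw (H.height_le k hk) (H.height_pos k hk).le (by linarith)
    linarith
  refine H.boxPackable_of_vertical_cut (Finset.ssubset_iff_subset_ne.2 ⟨hJI, hkJ⟩) ?_ ?_ hSJ ?_
  · rw [Finset.nonempty_iff_ne_empty]
    rintro rfl
    rw [Finset.sum_empty] at hSJ
    have h1 := hlarge k hk
    have h2 : 0 < w k * h k := mul_pos (H.width_pos k hk) (H.height_pos k hk)
    linarith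
  · intro i hi hiJ
    by_contra! hcon
    exact hiJ (hwJ (by simp [hi, hcon]))
  · by_cases hex : ∃ i ∈ J, w i ≤ u / 4
    · obtain ⟨i, hi, hiw⟩ := hex
      have h1 := hdrop i hi hiw
      have h2 : w i * h i ≤ u / 4 * (v / 2) :=
        mul_le_mul hiw (H.height_le i (hJI hi)) (H.height_pos i (hJI hi)).le (by linarith)
      linarith [H.area_le]
    · push Not at hex
      rwa [show J = I.filter (fun i => u / 4 < w i) from
        Finset.Subset.antisymm (fun i hi => by simp [hJI hi, hex i hi]) hwJ]

theorem SteinbergSmallStep.boxPackable (H : SteinbergSmallStep w h I u v) :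
    BoxPackable w h I u v := by
  classical
  have hu := H.box_width_pos
  have hv := H.box_height_pos
  have huv : 0 < u * v := mul_pos hu hv
  have hS := H.area_le
  rcases I.eq_empty_or_nonempty with rfl | ⟨i₀, hi₀⟩
  · exact boxPackable_empty
  set D := I.filter (fun i => u / 4 < w i ∧ v / 4 < h i) with hD
  by_cases hD2 : ∃ i ∈ D, ∃ k ∈ D, i ≠ k
  · obtain ⟨i, hi, k, hk, hik⟩ := hD2
    simp only [hD, Finset.mem_filter] at hi hk
    exact H.boxPackable_of_two_big hi.1 hk.1 hik hi.2.1 hk.2.1 hi.2.2 hk.2.2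
  push Not at hD2
  have hSD : ∑ i ∈ D, w i * h i ≤ u * v / 4 := by
    rcases D.eq_empty_or_nonempty with he | ⟨i, hi⟩
    · rw [he, Finset.sum_empty]; linarith
    · rw [show D = {i} from Finset.eq_singleton_iff_unique_mem.2
        ⟨hi, fun k hk => hD2 k hk i hi⟩, Finset.sum_singleton]
      have hiI := Finset.filter_subset _ _ hi
      have := mul_le_mul (H.width_le i hiI) (H.height_le i hiI) (H.height_pos i hiI).le
        (by linarith)
      linarith
  set M := I.filter (fun i => u / 4 < w i) with hM
  set P := I.filter (fun i => v / 4 < h i) with hP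
  have hMP : ∑ i ∈ M, w i * h i + ∑ i ∈ P, w i * h i ≤
      ∑ i ∈ I, w i * h i + ∑ i ∈ D, w i * h i := by
    have hDeq : D = M ∩ P := by ext i; grind
    rw [hDeq, ← Finset.sum_union_inter]
    have hsub : M ∪ P ⊆ I :=
      Finset.union_subset (Finset.filter_subset _ I) (Finset.filter_subset _ I)
    exact add_le_add (Finset.sum_le_sum_of_subset_of_nonneg hsub fun i hi _ =>
      (mul_pos (H.width_pos i hi) (H.height_pos i hi)).le) le_rfl
  have tall : ∀ k ∈ I, h k ≤ v / 4 → ∑ i ∈ P, w i * h i ≤ 3 / 8 * (u * v) →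
      BoxPackable w h I u v := fun k hk hkh hSP =>
    (H.swap.boxPackable_of_few_wide hk hkh (by
      simp only [mul_comm (h _) (w _)]; linarith)).swap
  by_cases hMI : ∃ k ∈ I, w k ≤ u / 4
  · obtain ⟨k, hk, hkw⟩ := hMI
    by_cases hSM : ∑ i ∈ M, w i * h i ≤ 3 / 8 * (u * v)
    · exact H.boxPackable_of_few_wide hk hkw hSM
    push Not at hSM
    by_cases hPI : ∃ k ∈ I, h k ≤ v / 4
    · obtain ⟨l, hl, hlh⟩ := hPI
      exact tall l hl hlh (by linarith)
    · push Not at hPI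
      have : M = D := by ext i; grind
      rw [this] at hSM
      linarith
  · push Not at hMI
    have hPD : P = D := by ext i; grind
    by_cases hPI : ∃ k ∈ I, h k ≤ v / 4
    · obtain ⟨l, hl, hlh⟩ := hPI
      exact tall l hl hlh (by rw [hPD]; linarith)
    · push Not at hPI
      have hDI : D = I := by ext i; grind
      rw [hDI] at hSD
      refine H.boxPackable_of_large_item hi₀ ?_
      have := mul_pos (H.width_pos i₀ hi₀) (H.height_pos i₀ hi₀)
      linarith

/-- **Steinberg's theorem** on packing rectangles into a box. -/
theorem steinbergHolds (w h : ι → ℝ) (I : Finset ι) : SteinbergHolds w h I := by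
  induction I using Finset.strongInduction with
  | H I ih =>
    intro u v A B hc
    by_cases hwide : ∃ i ∈ I, u / 2 < w i
    · exact boxPackable_of_wide ih hc hwide
    by_cases htall : ∃ i ∈ I, v / 2 < h i
    · exact (boxPackable_of_wide (fun J hJ => (ih J hJ).swap) hc.swap htall).swap
    push Not at hwide htall
    rcases I.eq_empty_or_nonempty with rfl | ⟨i₀, hi₀⟩
    · exact boxPackable_empty
    have hcorr : 0 ≤ (2 * A - u) * (2 * B - v) :=
      mul_nonneg (by linarith [hc.le_two_width]) (by linarith [hc.le_two_height])
    exact SteinbergSmallStep.boxPackable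
      { smaller := ih
        width_pos := hc.width_pos
        height_pos := hc.height_pos
        width_le := hwide
        height_le := htall
        box_width_pos := by linarith [hc.width_pos i₀ hi₀, hwide i₀ hi₀]
        box_height_pos := by linarith [hc.height_pos i₀ hi₀, htall i₀ hi₀]
        area_le := by linarith [hc.area_le] }

theorem BoxPackable.isPacking (H : BoxPackable w h I u v) :
    IsPacking I w h (Set.Icc 0 u ×ˢ Set.Icc 0 v) := by
  obtain ⟨x, y, hbox, hsep⟩ := H
  refine ⟨x, y, fun i hi => ?_, fun i hi j hj hij => ?_⟩
  · obtain ⟨h1, h2, h3, h4⟩ := hbox i hi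
    rintro ⟨p, q⟩ ⟨⟨p1, p2⟩, ⟨q1, q2⟩⟩
    simp only at p1 p2 q1 q2
    exact ⟨⟨by simp only; linarith, by simp only; linarith⟩,
      ⟨by simp only; linarith, by simp only; linarith⟩⟩
  · rw [Set.disjoint_left]
    rintro ⟨p, q⟩ ⟨⟨p1, p2⟩, ⟨q1, q2⟩⟩ ⟨⟨p3, p4⟩, ⟨q3, q4⟩⟩
    simp only at p1 p2 q1 q2 p3 p4 q3 q4
    rcases hsep i hi j hj hij with g | g | g | g <;> linarith

end Steinberg

/-- corollary of Steinberg's theorem: items with both sides at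
most `(1/2 + 2ε_large)N` and small enough total area can all be packed into a
`(1-α)N × (1-β)N` box. -/
theorem steinberg_shrunk_box
    {ι : Type*} (N εlarge : ℝ) (hN : 0 < N)
    (hεl0 : 0 < εlarge) (hεl : εlarge ≤ 1 / 4)
    (I : Finset ι) (w h : ι → ℝ)
    (hwpos : ∀ i ∈ I, 0 < w i) (hhpos : ∀ i ∈ I, 0 < h i)
    (hwub : ∀ i ∈ I, w i ≤ (1 / 2 + 2 * εlarge) * N)
    (hhub : ∀ i ∈ I, h i ≤ (1 / 2 + 2 * εlarge) * N)
    (a b : ℝ) (ha0 : 0 ≤ a) (ha : a ≤ 1 / 2 - 2 * εlarge)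
    (hb0 : 0 ≤ b) (hb : b ≤ 1 / 2 - 2 * εlarge)
    (harea : ∑ i ∈ I, w i * h i ≤
      (1 / 2 - (a + b) * (1 / 2 + 2 * εlarge) - 8 * εlarge ^ 2) * N ^ 2) :
    IsPacking I w h (Set.Icc 0 ((1 - a) * N) ×ˢ Set.Icc 0 ((1 - b) * N)) := by
  refine (steinbergHolds w h I _ _ ((1 / 2 + 2 * εlarge) * N) ((1 / 2 + 2 * εlarge) * N)
    { width_pos := hwpos
      height_pos := hhpos
      width_le := hwub
      height_le := hhub
      le_two_width := by nlinarith [mul_nonneg ha0 hN.le, mul_pos hεl0 hN]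
      width_le_box := mul_le_mul_of_nonneg_right (by linarith) hN.le
      le_two_height := by nlinarith [mul_nonneg hb0 hN.le, mul_pos hεl0 hN]
      height_le_box := mul_le_mul_of_nonneg_right (by linarith) hN.le
      area_le := by linarith }).isPacking
end

section
/- Let N > 0 and let H and V be disjoint finite sets of items with nonnegative profits such that w(i) > N/2 for every i ∈ H and h(i) > N/2 for every i ∈ V, and such that H ∪ V admits a packing into [0,N]×[0,N]. Let h_H = Σ_{i∈H} h(i) and w_V = Σ_{i∈V} w(i). Then there exists a subset APX ⊆ H ∪ V with p(APX) ≥ (3/4)·(p(H) + p(V)) admitting a packing into the L-shaped region L = ([0,N]×[0,h_H]) ∪ ([0,w_V]×[0,N]) in which every item of APX ∩ H is contained in [0,N]×[0,h_H] and every item of APX ∩ V is contained in [0,w_V]×[0,N]. -/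
/-- The intervals of lengths `l` starting at `a` do not overlap at `i` and `j`. -/
def IntervalsSeparated {ι : Type*} (a l : ι → ℝ) (i j : ι) : Prop :=
  a i + l i ≤ a j ∨ a j + l j ≤ a i

theorem intervalsSeparated_of_disjoint {ι : Type*} {a l : ι → ℝ} {i j : ι}
    (hi : 0 < l i) (hj : 0 < l j)
    (hd : Disjoint (Set.Ioo (a i) (a i + l i)) (Set.Ioo (a j) (a j + l j))) :
    IntervalsSeparated a l i j := by
  rw [Set.Ioo_disjoint_Ioo, min_le_iff, le_max_iff, le_max_iff] at hd
  unfold IntervalsSeparated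
  grind

theorem IntervalsSeparated.disjoint {ι : Type*} {a l : ι → ℝ} {i j : ι}
    (hs : IntervalsSeparated a l i j) :
    Disjoint (Set.Ioo (a i) (a i + l i)) (Set.Ioo (a j) (a j + l j)) := by
  rw [Set.Ioo_disjoint_Ioo, min_le_iff, le_max_iff, le_max_iff]
  unfold IntervalsSeparated at hs
  grind

/-- Pairwise separated intervals inside `[0, b]` have total length at most `b`. -/
theorem sum_length_le_of_separated {ι : Type*} [DecidableEq ι] (S : Finset ι) (a l : ι → ℝ)
    (hl : ∀ i ∈ S, 0 < l i) (ha : ∀ i ∈ S, 0 ≤ a i)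
    (hsep : ∀ i ∈ S, ∀ j ∈ S, i ≠ j → IntervalsSeparated a l i j)
    (b : ℝ) (hb : 0 ≤ b) (hab : ∀ i ∈ S, a i + l i ≤ b) :
    ∑ i ∈ S, l i ≤ b := by
  induction S using Finset.induction_on_max_value a generalizing b with
  | empty => simpa using hb
  | insert i s hi hmax ih =>
    rw [Finset.sum_insert hi]
    have hs : ∑ j ∈ s, l j ≤ a i := by
      refine ih (fun j hj => hl j (by simp [hj])) (fun j hj => ha j (by simp [hj]))
        (fun j hj k hk => hsep j (by simp [hj]) k (by simp [hk])) _ (ha i (by simp)) ?_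
      intro j hj
      have hji : j ≠ i := fun e => hi (e ▸ hj)
      rcases hsep j (by simp [hj]) i (by simp) hji with h1 | h1
      · exact h1
      · linarith [hl i (by simp), hmax j hj]
    linarith [hab i (by simp)]

/-- Intervals of lengths `l` can be stacked from `0` upwards in order of decreasing `f`. -/
theorem exists_stacking {ι : Type*} [DecidableEq ι] (S : Finset ι) (f l : ι → ℝ)
    (hl : ∀ i ∈ S, 0 ≤ l i) :
    ∃ a : ι → ℝ, (∀ i ∈ S, 0 ≤ a i) ∧
      (∀ i ∈ S, a i + l i ≤ ∑ j ∈ S with f i ≤ f j, l j) ∧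
      ∀ i ∈ S, ∀ j ∈ S, i ≠ j → IntervalsSeparated a l i j := by
  induction S using Finset.induction_on_min_value f with
  | empty => exact ⟨0, by simp⟩
  | insert k s hk hmin ih =>
    have hls : ∀ i ∈ s, 0 ≤ l i := fun j hj => hl j (by simp [hj])
    obtain ⟨a, ha, hal, hsep⟩ := ih hls
    have hne : ∀ j ∈ s, j ≠ k := fun j hj e => hk (e ▸ hj)
    have hle : ∀ j ∈ s, a j + l j ≤ ∑ i ∈ s, l i := fun j hj =>
      (hal j hj).trans (Finset.sum_le_sum_of_subset_of_nonneg (Finset.filter_subset _ _)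
        fun i hi _ => hls i hi)
    refine ⟨Function.update a k (∑ i ∈ s, l i), ?_, ?_, ?_⟩
    · intro i hi
      rcases Finset.mem_insert.1 hi with rfl | hi
      · simpa using Finset.sum_nonneg hls
      · simpa [hne i hi] using ha i hi
    · intro i hi
      rcases Finset.mem_insert.1 hi with rfl | hi
      · rw [Finset.filter_true_of_mem (by simpa using hmin), Finset.sum_insert hk]
        simp [add_comm]
      · rw [Function.update_of_ne (hne i hi)]
        refine (hal i hi).trans (Finset.sum_le_sum_of_subset_of_nonneg
          (Finset.filter_subset_filter _ (Finset.subset_insert _ _)) ?_)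
        exact fun j hj _ => hl j (Finset.mem_filter.1 hj).1
    · intro i hi j hj hij
      unfold IntervalsSeparated
      rcases Finset.mem_insert.1 hi with rfl | his <;>
        rcases Finset.mem_insert.1 hj with rfl | hjs
      · exact absurd rfl hij
      · right; simpa [hne j hjs] using hle j hjs
      · left; simpa [hne i his] using hle i his
      · simpa [hne i his, hne j hjs, IntervalsSeparated] using hsep i his j hjs hij

/-- When the items of `A` are stacked upwards by decreasing width and pushed to the right, and
those of `B` are stacked rightwards by decreasing height and pushed to the top, no item of `A`
meets an item of `B`. -/
def StacksCompatible {ι : Type*} (N : ℝ) (w h : ι → ℝ) (A B : Finset ι) : Prop :=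
  ∀ i ∈ A, ∀ j ∈ B,
    (∑ k ∈ B with h j ≤ h k, w k) + w i ≤ N ∨ (∑ k ∈ A with w i ≤ w k, h k) + h j ≤ N

theorem StacksCompatible.symm {ι : Type*} {N : ℝ} {w h : ι → ℝ} {A B : Finset ι}
    (hc : StacksCompatible N w h A B) : StacksCompatible N h w B A :=
  fun j hj i hi => (hc i hi j hj).symm

theorem StacksCompatible.exists_positions {ι : Type*} [DecidableEq ι] {N : ℝ} {w h : ι → ℝ}
    {A B : Finset ι} (hc : StacksCompatible N w h A B) (hAB : Disjoint A B)
    (hw : ∀ i ∈ A ∪ B, 0 < w i ∧ w i ≤ N) (hh : ∀ i ∈ A ∪ B, 0 < h i ∧ h i ≤ N) :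
    ∃ x y : ι → ℝ,
      (∀ i ∈ A, 0 ≤ x i ∧ x i + w i ≤ N ∧ 0 ≤ y i ∧ y i + h i ≤ ∑ j ∈ A, h j) ∧
      (∀ i ∈ B, 0 ≤ x i ∧ x i + w i ≤ ∑ j ∈ B, w j ∧ 0 ≤ y i ∧ y i + h i ≤ N) ∧
      ∀ i ∈ A ∪ B, ∀ j ∈ A ∪ B, i ≠ j →
        IntervalsSeparated x w i j ∨ IntervalsSeparated y h i j := by
  have hA : ∀ i ∈ A, i ∈ A ∪ B := fun i hi => by simp [hi]
  have hB : ∀ i ∈ B, i ∈ A ∪ B := fun i hi => by simp [hi]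
  have hBA : ∀ i ∈ B, i ∉ A := fun i hi hi' => Finset.disjoint_left.1 hAB hi' hi
  obtain ⟨a, ha, hal, hasep⟩ := exists_stacking A w h fun i hi => (hh i (hA i hi)).1.le
  obtain ⟨b, hb, hbl, hbsep⟩ := exists_stacking B h w fun i hi => (hw i (hB i hi)).1.le
  refine ⟨fun i => if i ∈ A then N - w i else b i, fun i => if i ∈ A then a i else N - h i,
    ?_, ?_, ?_⟩
  · intro i hi
    have := (hal i hi).trans (Finset.sum_le_sum_of_subset_of_nonneg (Finset.filter_subset _ _)
        fun i hi _ => (hh i (hA i hi)).1.le)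
    simpa [hi, ha i hi, (hw i (hA i hi)).2] using this
  · intro i hi
    have := (hbl i hi).trans (Finset.sum_le_sum_of_subset_of_nonneg (Finset.filter_subset _ _)
        fun i hi _ => (hw i (hB i hi)).1.le)
    simpa [hBA i hi, hb i hi, (hh i (hB i hi)).2] using this
  · intro i hi j hj hij
    unfold IntervalsSeparated
    rcases Finset.mem_union.1 hi with hi | hi <;> rcases Finset.mem_union.1 hj with hj | hj
    · right; simpa [hi, hj, IntervalsSeparated] using hasep i hi j hj hij
    · simp only [hi, hBA j hj, if_true, if_false]
      have := hal i hi
      have := hbl j hj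
      rcases hc i hi j hj with h1 | h1
      · left; right; linarith
      · right; left; linarith
    · simp only [hj, hBA i hi, if_true, if_false]
      have := hal j hj
      have := hbl i hi
      rcases hc j hj i hi with h1 | h1
      · left; left; linarith
      · right; right; linarith
    · left; simpa [hBA i hi, hBA j hj, IntervalsSeparated] using hbsep i hi j hj hij

/-- The positions `x`, `y` pack the items of `I` into `[0, N] × [0, N]`. -/
structure IsSquarePlacement {ι : Type*} (N : ℝ) (w h x y : ι → ℝ) (I : Finset ι) : Prop where
  width_pos : ∀ i ∈ I, 0 < w i
  height_pos : ∀ i ∈ I, 0 < h i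
  left : ∀ i ∈ I, 0 ≤ x i
  right : ∀ i ∈ I, x i + w i ≤ N
  bottom : ∀ i ∈ I, 0 ≤ y i
  top : ∀ i ∈ I, y i + h i ≤ N
  separated : ∀ i ∈ I, ∀ j ∈ I, i ≠ j →
    IntervalsSeparated x w i j ∨ IntervalsSeparated y h i j

namespace IsSquarePlacement

variable {ι : Type*} {N : ℝ} {w h x y : ι → ℝ} {I J : Finset ι}

theorem mono (hP : IsSquarePlacement N w h x y I) (hJ : J ⊆ I) :
    IsSquarePlacement N w h x y J where
  width_pos i hi := hP.width_pos i (hJ hi)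
  height_pos i hi := hP.height_pos i (hJ hi)
  left i hi := hP.left i (hJ hi)
  right i hi := hP.right i (hJ hi)
  bottom i hi := hP.bottom i (hJ hi)
  top i hi := hP.top i (hJ hi)
  separated i hi j hj := hP.separated i (hJ hi) j (hJ hj)

theorem transpose (hP : IsSquarePlacement N w h x y I) : IsSquarePlacement N h w y x I where
  width_pos := hP.height_pos
  height_pos := hP.width_pos
  left := hP.bottom
  right := hP.top
  bottom := hP.left
  top := hP.right
  separated i hi j hj hij := (hP.separated i hi j hj hij).symm

theorem reflect (hP : IsSquarePlacement N w h x y I) :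
    IsSquarePlacement N w h x (fun i => N - y i - h i) I where
  width_pos := hP.width_pos
  height_pos := hP.height_pos
  left := hP.left
  right := hP.right
  bottom i hi := by linarith [hP.top i hi]
  top i hi := by linarith [hP.bottom i hi]
  separated i hi j hj hij := by
    refine (hP.separated i hi j hj hij).imp_right ?_
    rintro (h1 | h1)
    · right; linarith
    · left; linarith

/-- If all horizontal items start below the middle, they can be stacked together with the
vertical items. -/
theorem stacksCompatible_of_low [DecidableEq ι] {A B : Finset ι}
    (hP : IsSquarePlacement N w h x y (A ∪ B)) (hAB : Disjoint A B)
    (hA : ∀ i ∈ A, N / 2 < w i) (hB : ∀ i ∈ B, N / 2 < h i) (hlow : ∀ i ∈ A, y i < N / 2) :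
    StacksCompatible N w h A B := by
  intro i hi j hj
  have hAI : ∀ k ∈ A, k ∈ A ∪ B := fun k hk => by simp [hk]
  have hBI : ∀ k ∈ B, k ∈ A ∪ B := fun k hk => by simp [hk]
  obtain ⟨m, hm, hmax⟩ := (A.filter fun k => w i ≤ w k).exists_max_image y ⟨i, by simp [hi]⟩
  obtain ⟨hmA, hwm⟩ := Finset.mem_filter.1 hm
  have hysep : ∀ k ∈ A, ∀ k' ∈ A, k ≠ k' → IntervalsSeparated y h k k' := by
    intro k hk k' hk' hkk'
    refine (hP.separated k (hAI k hk) k' (hAI k' hk') hkk').resolve_left ?_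
    rintro (h1 | h1)
    · linarith [hA k hk, hA k' hk', hP.left k (hAI k hk), hP.right k' (hAI k' hk')]
    · linarith [hA k hk, hA k' hk', hP.left k' (hAI k' hk'), hP.right k (hAI k hk)]
  have hxsep : ∀ k ∈ B, ∀ k' ∈ B, k ≠ k' → IntervalsSeparated x w k k' := by
    intro k hk k' hk' hkk'
    refine (hP.separated k (hBI k hk) k' (hBI k' hk') hkk').resolve_right ?_
    rintro (h1 | h1)
    · linarith [hB k hk, hB k' hk', hP.bottom k (hBI k hk), hP.top k' (hBI k' hk')]
    · linarith [hB k hk, hB k' hk', hP.bottom k' (hBI k' hk'), hP.top k (hBI k hk)]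
  have hsum : ∑ k ∈ A with w i ≤ w k, h k ≤ y m + h m := by
    have hmpos := hP.height_pos m (hAI m hmA)
    refine sum_length_le_of_separated _ y h
      (fun k hk => hP.height_pos k (hAI k (Finset.mem_filter.1 hk).1))
      (fun k hk => hP.bottom k (hAI k (Finset.mem_filter.1 hk).1))
      (fun k hk k' hk' => hysep k (Finset.mem_filter.1 hk).1 k' (Finset.mem_filter.1 hk').1)
      _ (by linarith [hP.bottom m (hAI m hmA)]) ?_
    intro k hk
    rcases eq_or_ne k m with rfl | hkm
    · exact le_rfl
    · rcases hysep k (Finset.mem_filter.1 hk).1 m hmA hkm with h1 | h1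
      · linarith
      · linarith [hmax k hk]
  by_cases ht : y m + h m + h j ≤ N
  · right; linarith
  left
  have hmB : ∀ k ∈ B, h j ≤ h k → IntervalsSeparated x w m k := by
    intro k hk hjk
    have hmk : m ≠ k := fun e => Finset.disjoint_left.1 hAB hmA (e ▸ hk)
    refine (hP.separated m (hAI m hmA) k (hBI k hk) hmk).resolve_right ?_
    rintro (h1 | h1)
    · linarith [hP.top k (hBI k hk)]
    · linarith [hP.bottom k (hBI k hk), hlow m hmA, hB k hk]
  have hsub : ∀ k ∈ insert m (B.filter fun k => h j ≤ h k), k ∈ A ∪ B := by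
    intro k hk
    rcases Finset.mem_insert.1 hk with rfl | hk
    · exact hAI k hmA
    · exact hBI k (Finset.mem_filter.1 hk).1
  have hwsum : ∑ k ∈ insert m (B.filter fun k => h j ≤ h k), w k ≤ N := by
    refine sum_length_le_of_separated _ x w (fun k hk => hP.width_pos k (hsub k hk))
      (fun k hk => hP.left k (hsub k hk)) ?_ N
      (by linarith [hP.left m (hAI m hmA), hP.right m (hAI m hmA), hP.width_pos m (hAI m hmA)])
      (fun k hk => hP.right k (hsub k hk))
    intro k hk k' hk' hkk'
    rcases Finset.mem_insert.1 hk with rfl | hkf <;>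
      rcases Finset.mem_insert.1 hk' with rfl | hkf'
    · exact absurd rfl hkk'
    · exact hmB k' (Finset.mem_filter.1 hkf').1 (Finset.mem_filter.1 hkf').2
    · exact (hmB k (Finset.mem_filter.1 hkf).1 (Finset.mem_filter.1 hkf).2).symm
    · exact hxsep k (Finset.mem_filter.1 hkf).1 k' (Finset.mem_filter.1 hkf').1 hkk'
  rw [Finset.sum_insert fun hmem =>
    Finset.disjoint_left.1 hAB hmA (Finset.mem_filter.1 hmem).1] at hwsum
  linarith

/-- The horizontal items split into two parts, each of which can be stacked together with the
vertical items. -/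
theorem exists_split_stacksCompatible [DecidableEq ι] {A B : Finset ι}
    (hP : IsSquarePlacement N w h x y (A ∪ B)) (hAB : Disjoint A B)
    (hA : ∀ i ∈ A, N / 2 < w i) (hB : ∀ i ∈ B, N / 2 < h i) (p : ι → ℝ) :
    ∃ A' ⊆ A, StacksCompatible N w h A' B ∧ ∑ i ∈ A, p i ≤ 2 * ∑ i ∈ A', p i := by
  have hlow := Finset.filter_subset (fun i => y i < N / 2) A
  have hhigh := Finset.filter_subset (fun i => ¬ y i < N / 2) A
  have hsum := Finset.sum_filter_add_sum_filter_not A (fun i => y i < N / 2) p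
  rcases le_total (∑ i ∈ A with ¬ y i < N / 2, p i) (∑ i ∈ A with y i < N / 2, p i) with h1 | h1
  · refine ⟨_, hlow, ?_, by linarith⟩
    exact (hP.mono (Finset.union_subset_union_left hlow)).stacksCompatible_of_low
      (hAB.mono_left hlow) (fun i hi => hA i (hlow hi)) hB fun i hi => (Finset.mem_filter.1 hi).2
  · refine ⟨_, hhigh, ?_, by linarith⟩
    refine (hP.mono (Finset.union_subset_union_left hhigh)).reflect.stacksCompatible_of_low
      (hAB.mono_left hhigh) (fun i hi => hA i (hhigh hi)) hB fun i hi => ?_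
    have := hP.height_pos i (Finset.mem_union_left _ (hhigh hi))
    linarith [not_lt.1 (Finset.mem_filter.1 hi).2]

end IsSquarePlacement

theorem Ioo_prod_Ioo_subset_Icc_prod_Icc {a b c d a' b' c' d' : ℝ}
    (ha : a' ≤ a) (hb : b ≤ b') (hc : c' ≤ c) (hd : d ≤ d') :
    Set.Ioo a b ×ˢ Set.Ioo c d ⊆ Set.Icc a' b' ×ˢ Set.Icc c' d' :=
  Set.prod_mono (Set.Ioo_subset_Icc_self.trans (Set.Icc_subset_Icc ha hb))
    (Set.Ioo_subset_Icc_self.trans (Set.Icc_subset_Icc hc hd))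

theorem IsPacking.exists_isSquarePlacement {ι : Type*} {N : ℝ} {w h : ι → ℝ} {I : Finset ι}
    (hpack : IsPacking I w h (Set.Icc 0 N ×ˢ Set.Icc 0 N))
    (hw : ∀ i ∈ I, 0 < w i) (hh : ∀ i ∈ I, 0 < h i) :
    ∃ x y : ι → ℝ, IsSquarePlacement N w h x y I := by
  obtain ⟨x, y, hsub, hdisj⟩ := hpack
  have hbounds : ∀ i ∈ I, (0 ≤ x i ∧ x i + w i ≤ N) ∧ (0 ≤ y i ∧ y i + h i ≤ N) := by
    intro i hi
    have hx : x i < x i + w i := by linarith [hw i hi]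
    have hy : y i < y i + h i := by linarith [hh i hi]
    have hcl := closure_mono (hsub i hi)
    rw [closure_prod_eq, closure_Ioo hx.ne, closure_Ioo hy.ne,
      (isClosed_Icc.prod isClosed_Icc).closure_eq] at hcl
    have h1 := hcl (Set.mk_mem_prod (Set.left_mem_Icc.2 hx.le) (Set.left_mem_Icc.2 hy.le))
    have h2 := hcl (Set.mk_mem_prod (Set.right_mem_Icc.2 hx.le) (Set.right_mem_Icc.2 hy.le))
    exact ⟨⟨h1.1.1, h2.1.2⟩, h1.2.1, h2.2.2⟩
  refine ⟨x, y, hw, hh, fun i hi => (hbounds i hi).1.1, fun i hi => (hbounds i hi).1.2,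
    fun i hi => (hbounds i hi).2.1, fun i hi => (hbounds i hi).2.2, fun i hi j hj hij => ?_⟩
  exact (Set.disjoint_prod.1 (hdisj i hi j hj hij)).imp
    (intervalsSeparated_of_disjoint (hw i hi) (hw j hj))
    (intervalsSeparated_of_disjoint (hh i hi) (hh j hj))

/-- from any packing of long horizontal items `H` and long vertical
items `V` into the `N × N` knapsack one can extract a subset `APX` with at
least `3/4` of the profit which packs into the boundary L-shaped region
`([0,N] × [0, h_H]) ∪ ([0, w_V] × [0,N])`, with the horizontal items inside the
horizontal box and the vertical items inside the vertical box. -/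
theorem L_packing_of_long_items
    {ι : Type*} [DecidableEq ι] (N : ℝ) (hN : 0 < N)
    (H V : Finset ι) (hHV : Disjoint H V)
    (w h p : ι → ℝ)
    (hwpos : ∀ i ∈ H ∪ V, 0 < w i) (hhpos : ∀ i ∈ H ∪ V, 0 < h i)
    (hp : ∀ i ∈ H ∪ V, 0 ≤ p i)
    (hHwide : ∀ i ∈ H, N / 2 < w i) (hVhigh : ∀ i ∈ V, N / 2 < h i)
    (hpack : IsPacking (H ∪ V) w h (Set.Icc 0 N ×ˢ Set.Icc 0 N)) :
    ∃ APX ⊆ H ∪ V,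
      (3 / 4 * (∑ i ∈ H, p i + ∑ i ∈ V, p i) ≤ ∑ i ∈ APX, p i) ∧
      ∃ x y : ι → ℝ,
        (∀ i ∈ APX ∩ H,
          (Set.Ioo (x i) (x i + w i) ×ˢ Set.Ioo (y i) (y i + h i)) ⊆
            Set.Icc 0 N ×ˢ Set.Icc 0 (∑ j ∈ H, h j)) ∧
        (∀ i ∈ APX ∩ V,
          (Set.Ioo (x i) (x i + w i) ×ˢ Set.Ioo (y i) (y i + h i)) ⊆
            Set.Icc 0 (∑ j ∈ V, w j) ×ˢ Set.Icc 0 N) ∧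
        (∀ i ∈ APX, ∀ j ∈ APX, i ≠ j →
          Disjoint (Set.Ioo (x i) (x i + w i) ×ˢ Set.Ioo (y i) (y i + h i))
            (Set.Ioo (x j) (x j + w j) ×ˢ Set.Ioo (y j) (y j + h j))) := by
  obtain ⟨x, y, hP⟩ := hpack.exists_isSquarePlacement hwpos hhpos
  obtain ⟨A, hA, B, hB, hc, hprofit⟩ : ∃ A ⊆ H, ∃ B ⊆ V, StacksCompatible N w h A B ∧
      3 / 4 * (∑ i ∈ H, p i + ∑ i ∈ V, p i) ≤ ∑ i ∈ A, p i + ∑ i ∈ B, p i := by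
    rcases le_total (∑ i ∈ H, p i) (∑ i ∈ V, p i) with hle | hle
    · obtain ⟨A, hA, hc, hp2⟩ := hP.exists_split_stacksCompatible hHV hHwide hVhigh p
      exact ⟨A, hA, V, subset_rfl, hc, by linarith⟩
    · have hP' := hP.transpose
      rw [Finset.union_comm] at hP'
      obtain ⟨B, hB, hc, hp2⟩ := hP'.exists_split_stacksCompatible hHV.symm hVhigh hHwide p
      exact ⟨H, subset_rfl, B, hB, hc.symm, by linarith⟩
  have hAB : Disjoint A B := hHV.mono hA hB
  have hsub : A ∪ B ⊆ H ∪ V := Finset.union_subset_union hA hB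
  obtain ⟨x', y', hx', hy', hsep⟩ := hc.exists_positions hAB
    (fun i hi => ⟨hwpos i (hsub hi), by linarith [hP.left i (hsub hi), hP.right i (hsub hi)]⟩)
    (fun i hi => ⟨hhpos i (hsub hi), by linarith [hP.bottom i (hsub hi), hP.top i (hsub hi)]⟩)
  refine ⟨A ∪ B, hsub, by rwa [Finset.sum_union hAB], x', y', ?_, ?_, ?_⟩
  · intro i hi
    obtain ⟨hi, hiH⟩ := Finset.mem_inter.1 hi
    have hiA : i ∈ A := (Finset.mem_union.1 hi).resolve_right
      fun hiB => Finset.disjoint_left.1 hHV hiH (hB hiB)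
    obtain ⟨h1, h2, h3, h4⟩ := hx' i hiA
    exact Ioo_prod_Ioo_subset_Icc_prod_Icc h1 h2 h3 (h4.trans
      (Finset.sum_le_sum_of_subset_of_nonneg hA
        fun j hj _ => (hhpos j (Finset.mem_union_left _ hj)).le))
  · intro i hi
    obtain ⟨hi, hiV⟩ := Finset.mem_inter.1 hi
    have hiB : i ∈ B := (Finset.mem_union.1 hi).resolve_left
      fun hiA => Finset.disjoint_left.1 hHV (hA hiA) hiV
    obtain ⟨h1, h2, h3, h4⟩ := hy' i hiB
    exact Ioo_prod_Ioo_subset_Icc_prod_Icc h1 (h2.trans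
      (Finset.sum_le_sum_of_subset_of_nonneg hB
        fun j hj _ => (hwpos j (Finset.mem_union_right _ hj)).le)) h3 h4
  · intro i hi j hj hij
    exact Set.disjoint_prod.2 ((hsep i hi j hj hij).imp
      IntervalsSeparated.disjoint IntervalsSeparated.disjoint)
end

section
/- Let N > 0, let 0 < ε ≤ 1/13 be such that 1/(2ε) is an integer, and let 0 < ε_small < ε^{1/(2ε)+1}. Let M be a finite set of items, each with w(i), h(i) ∈ (0, N], admitting a packing into [0,N]×[0,N], and suppose |M| ≥ 1/ε_small³. Then there exists a subset M' ⊆ M with |M'| ≥ (2/3)(1 − 15ε)·|M| admitting a packing with rotations into the box [0, (1 − ε^{1/(2ε)+1})N] × [0, N]. -/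
/-- An axis-parallel packing with (90-degree) rotations: each item may also be
placed with its width and height interchanged. -/
def IsPackingRot {ι : Type*} (I : Finset ι) (w h : ι → ℝ) (R : Set (ℝ × ℝ)) : Prop :=
  ∃ x y : ι → ℝ, ∃ rot : ι → Bool,
    (∀ i ∈ I,
      (Set.Ioo (x i) (x i + (if rot i then h i else w i)) ×ˢ
        Set.Ioo (y i) (y i + (if rot i then w i else h i))) ⊆ R) ∧
    (∀ i ∈ I, ∀ j ∈ I, i ≠ j →
      Disjoint
        (Set.Ioo (x i) (x i + (if rot i then h i else w i)) ×ˢ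
          Set.Ioo (y i) (y i + (if rot i then w i else h i)))
        (Set.Ioo (x j) (x j + (if rot j then h j else w j)) ×ˢ
          Set.Ioo (y j) (y j + (if rot j then w j else h j))))

open MeasureTheory

/-- Coordinate form of a packing into `[0, A] × [0, B]`. -/
def CoordPacking {ι : Type*} (I : Finset ι) (w h x y : ι → ℝ) (A B : ℝ) : Prop :=
  (∀ i ∈ I, 0 ≤ x i ∧ x i + w i ≤ A ∧ 0 ≤ y i ∧ y i + h i ≤ B) ∧
  ∀ i ∈ I, ∀ j ∈ I, i ≠ j →
    x i + w i ≤ x j ∨ x j + w j ≤ x i ∨ y i + h i ≤ y j ∨ y j + h j ≤ y i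

/-- Coordinate form of a packing with rotations into `[0, A] × [0, B]`. -/
def CoordPackingRot {ι : Type*} (I : Finset ι) (w h : ι → ℝ) (A B : ℝ) : Prop :=
  ∃ x y : ι → ℝ, ∃ rot : ι → Bool,
    CoordPacking I (fun i => if rot i then h i else w i) (fun i => if rot i then w i else h i)
      x y A B

section Coordinates

variable {ι : Type*} {I J : Finset ι} {w h x y : ι → ℝ} {A B N : ℝ}

theorem disjoint_Ioo_prod_iff {a b c d a' b' c' d' : ℝ} (hab : a < b) (hcd : c < d)
    (hab' : a' < b') (hcd' : c' < d') :
    Disjoint (Set.Ioo a b ×ˢ Set.Ioo c d) (Set.Ioo a' b' ×ˢ Set.Ioo c' d') ↔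
      b ≤ a' ∨ b' ≤ a ∨ d ≤ c' ∨ d' ≤ c := by
  rw [Set.disjoint_prod, Set.Ioo_disjoint_Ioo, Set.Ioo_disjoint_Ioo]
  simp only [min_le_iff, le_max_iff]
  constructor
  · rintro (((h | h) | (h | h)) | ((h | h) | (h | h))) <;> first | tauto | (exfalso; linarith)
  · tauto

theorem Ioo_prod_subset_Icc_prod {a b c d p q r s : ℝ} (hab : a < b) (hcd : c < d) :
    Set.Ioo a b ×ˢ Set.Ioo c d ⊆ Set.Icc p q ×ˢ Set.Icc r s ↔
      p ≤ a ∧ b ≤ q ∧ r ≤ c ∧ d ≤ s := by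
  constructor
  · intro hs
    have := closure_mono hs
    rw [closure_prod_eq, closure_Ioo hab.ne, closure_Ioo hcd.ne,
      (isClosed_Icc.prod isClosed_Icc).closure_eq] at this
    have h1 := this (show (a, c) ∈ _ from ⟨⟨le_rfl, hab.le⟩, ⟨le_rfl, hcd.le⟩⟩)
    have h2 := this (show (b, d) ∈ _ from ⟨⟨hab.le, le_rfl⟩, ⟨hcd.le, le_rfl⟩⟩)
    exact ⟨h1.1.1, h2.1.2, h1.2.1, h2.2.2⟩
  · rintro ⟨h1, h2, h3, h4⟩ z ⟨hz1, hz2⟩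
    exact ⟨⟨h1.trans hz1.1.le, hz1.2.le.trans h2⟩, ⟨h3.trans hz2.1.le, hz2.2.le.trans h4⟩⟩

theorem IsPacking.exists_coordPacking (hw : ∀ i ∈ I, 0 < w i) (hh : ∀ i ∈ I, 0 < h i)
    (hp : IsPacking I w h (Set.Icc 0 A ×ˢ Set.Icc 0 B)) :
    ∃ x y, CoordPacking I w h x y A B := by
  obtain ⟨x, y, h1, h2⟩ := hp
  refine ⟨x, y, fun i hi => ?_, fun i hi j hj hij => ?_⟩
  · exact (Ioo_prod_subset_Icc_prod (by linarith [hw i hi]) (by linarith [hh i hi])).1 (h1 i hi)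
  · exact (disjoint_Ioo_prod_iff (by linarith [hw i hi]) (by linarith [hh i hi])
      (by linarith [hw j hj]) (by linarith [hh j hj])).1 (h2 i hi j hj hij)

theorem CoordPackingRot.isPackingRot (hw : ∀ i ∈ I, 0 < w i) (hh : ∀ i ∈ I, 0 < h i)
    (hp : CoordPackingRot I w h A B) :
    IsPackingRot I w h (Set.Icc 0 A ×ˢ Set.Icc 0 B) := by
  obtain ⟨x, y, rot, h1, h2⟩ := hp
  have pw : ∀ i ∈ I, 0 < if rot i then h i else w i := fun i hi => by
    split_ifs
    exacts [hh i hi, hw i hi]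
  have ph : ∀ i ∈ I, 0 < if rot i then w i else h i := fun i hi => by
    split_ifs
    exacts [hw i hi, hh i hi]
  refine ⟨x, y, rot, fun i hi => ?_, fun i hi j hj hij => ?_⟩
  · exact (Ioo_prod_subset_Icc_prod (by linarith [pw i hi]) (by linarith [ph i hi])).2 (h1 i hi)
  · exact (disjoint_Ioo_prod_iff (by linarith [pw i hi]) (by linarith [ph i hi])
      (by linarith [pw j hj]) (by linarith [ph j hj])).2 (h2 i hi j hj hij)

theorem CoordPacking.mono (hp : CoordPacking I w h x y A B) (hJ : J ⊆ I) :
    CoordPacking J w h x y A B :=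
  ⟨fun i hi => hp.1 i (hJ hi), fun i hi j hj => hp.2 i (hJ hi) j (hJ hj)⟩

theorem CoordPacking.transpose (hp : CoordPacking I w h x y A B) :
    CoordPacking I h w y x B A := by
  refine ⟨fun i hi => ?_, fun i hi j hj hij => ?_⟩
  · obtain ⟨h1, h2, h3, h4⟩ := hp.1 i hi
    exact ⟨h3, h4, h1, h2⟩
  · have := hp.2 i hi j hj hij
    tauto

theorem CoordPacking.reflect (hp : CoordPacking I w h x y A B) :
    CoordPacking I w h (fun i => A - x i - w i) y A B := by
  refine ⟨fun i hi => ?_, fun i hi j hj hij => ?_⟩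
  · obtain ⟨h1, h2, h3, h4⟩ := hp.1 i hi
    exact ⟨by linarith, by linarith, h3, h4⟩
  · rcases hp.2 i hi j hj hij with h | h | h | h
    · exact Or.inr (Or.inl (by linarith))
    · exact Or.inl (by linarith)
    · exact Or.inr (Or.inr (Or.inl h))
    · exact Or.inr (Or.inr (Or.inr h))

theorem CoordPackingRot.swap (hp : CoordPackingRot I h w A B) : CoordPackingRot I w h A B := by
  obtain ⟨x, y, rot, hp⟩ := hp
  refine ⟨x, y, fun i => !rot i, ?_⟩
  convert hp using 2 with i i <;> cases h : rot i <;> simp [h]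

/-- Pairwise disjoint intervals inside `[p, q]` have total length at most `q - p`. -/
theorem sum_le_of_disjoint_intervals {s g : ι → ℝ} {p q : ℝ} (hpq : p ≤ q)
    (hg : ∀ i ∈ I, 0 ≤ g i) (hs : ∀ i ∈ I, p ≤ s i ∧ s i + g i ≤ q)
    (hd : ∀ i ∈ I, ∀ j ∈ I, i ≠ j → s i + g i ≤ s j ∨ s j + g j ≤ s i) :
    ∑ i ∈ I, g i ≤ q - p := by
  have hU : volume (⋃ i ∈ I, Set.Ioo (s i) (s i + g i)) ≤ volume (Set.Icc p q) := by
    refine measure_mono (Set.iUnion₂_subset fun i hi z hz => ?_)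
    exact ⟨(hs i hi).1.trans hz.1.le, hz.2.le.trans (hs i hi).2⟩
  rw [measure_biUnion_finset (fun i hi j hj hij => ?_) (fun i _ => measurableSet_Ioo)] at hU
  · simp only [Real.volume_Ioo, Real.volume_Icc, add_sub_cancel_left] at hU
    rw [← ENNReal.ofReal_sum_of_nonneg hg] at hU
    exact (ENNReal.ofReal_le_ofReal_iff (by linarith)).1 hU
  · rw [Function.onFun, Set.Ioo_disjoint_Ioo, min_le_iff, le_max_iff, le_max_iff]
    rcases hd i hi j hj hij with h | h
    · exact Or.inl (Or.inr h)
    · exact Or.inr (Or.inl h)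

/-- The total area of packed items is at most the area of the region. -/
theorem CoordPacking.sum_area_le (hp : CoordPacking I w h x y A B) (hA : 0 ≤ A) (hB : 0 ≤ B)
    (hw : ∀ i ∈ I, 0 < w i) (hh : ∀ i ∈ I, 0 < h i) : ∑ i ∈ I, w i * h i ≤ A * B := by
  have hU : volume (⋃ i ∈ I, Set.Ioo (x i) (x i + w i) ×ˢ Set.Ioo (y i) (y i + h i)) ≤
      volume (Set.Icc 0 A ×ˢ Set.Icc 0 B) := by
    refine measure_mono (Set.iUnion₂_subset fun i hi => ?_)
    exact (Ioo_prod_subset_Icc_prod (by linarith [hw i hi]) (by linarith [hh i hi])).2 (hp.1 i hi)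
  rw [measure_biUnion_finset (fun i hi j hj hij => ?_)
    (fun i _ => measurableSet_Ioo.prod measurableSet_Ioo)] at hU
  · simp only [Measure.volume_eq_prod, Measure.prod_prod, Real.volume_Ioo, Real.volume_Icc,
      add_sub_cancel_left, sub_zero] at hU
    rw [← ENNReal.ofReal_mul hA, Finset.sum_congr rfl
      (fun i hi => (ENNReal.ofReal_mul (hw i hi).le).symm),
      ← ENNReal.ofReal_sum_of_nonneg (fun i hi => (mul_pos (hw i hi) (hh i hi)).le)] at hU
    exact (ENNReal.ofReal_le_ofReal_iff (by positivity)).1 hU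
  · exact (disjoint_Ioo_prod_iff (by linarith [hw i hi]) (by linarith [hh i hi])
      (by linarith [hw j hj]) (by linarith [hh j hj])).2 (hp.2 i hi j hj hij)

/-- Intervals of given lengths can be placed one after the other. -/
theorem exists_stacking_s9 (I : Finset ι) (g : ι → ℝ) (hg : ∀ i ∈ I, 0 ≤ g i) :
    ∃ s : ι → ℝ, (∀ i ∈ I, 0 ≤ s i ∧ s i + g i ≤ ∑ j ∈ I, g j) ∧
      ∀ i ∈ I, ∀ j ∈ I, i ≠ j → s i + g i ≤ s j ∨ s j + g j ≤ s i := by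
  classical
  induction I using Finset.induction_on with
  | empty => exact ⟨0, by simp, by simp⟩
  | insert a I ha ih =>
    obtain ⟨s, h1, h2⟩ := ih fun i hi => hg i (Finset.mem_insert_of_mem hi)
    have hne : ∀ i ∈ I, i ≠ a := fun i hi e => ha (e ▸ hi)
    have hga := hg a (Finset.mem_insert_self a I)
    have hI : 0 ≤ ∑ j ∈ I, g j :=
      Finset.sum_nonneg fun i hi => hg i (Finset.mem_insert_of_mem hi)
    refine ⟨Function.update s a (∑ j ∈ I, g j), fun i hi => ?_, fun i hi j hj hij => ?_⟩
    · rw [Finset.sum_insert ha]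
      rcases Finset.mem_insert.1 hi with rfl | hi
      · rw [Function.update_self]
        exact ⟨hI, by linarith⟩
      · rw [Function.update_of_ne (hne i hi)]
        exact ⟨(h1 i hi).1, by linarith [(h1 i hi).2]⟩
    · rcases Finset.mem_insert.1 hi with hi | hi <;> rcases Finset.mem_insert.1 hj with hj | hj
      · exact absurd (hi.trans hj.symm) hij
      · rw [hi, Function.update_self, Function.update_of_ne (hne j hj)]
        exact Or.inr (h1 j hj).2
      · rw [hj, Function.update_self, Function.update_of_ne (hne i hi)]
        exact Or.inl (h1 i hi).2
      · rw [Function.update_of_ne (hne i hi), Function.update_of_ne (hne j hj)]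
        exact h2 i hi j hj hij

/-- Items that all cross the middle vertical line and lie in the bottom or top strip of height `R`
have total height at most `2 * R`. -/
theorem CoordPacking.sum_height_le {R : ℝ} (hp : CoordPacking I w h x y N N) (hR : 0 ≤ R)
    (hRN : 2 * R < N) (hh : ∀ i ∈ I, 0 < h i)
    (hx : ∀ i ∈ I, x i < R ∧ N - R < x i + w i)
    (hy : ∀ i ∈ I, y i + h i ≤ R ∨ N - R ≤ y i) : ∑ i ∈ I, h i ≤ 2 * R := by
  classical
  have hd : ∀ i ∈ I, ∀ j ∈ I, i ≠ j → y i + h i ≤ y j ∨ y j + h j ≤ y i := by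
    intro i hi j hj hij
    have hxi := hx i hi
    have hxj := hx j hj
    rcases hp.2 i hi j hj hij with h | h | h | h
    · linarith
    · linarith
    · exact Or.inl h
    · exact Or.inr h
  rw [← Finset.sum_filter_add_sum_filter_not I (fun i => y i + h i ≤ R)]
  have h1 : ∑ i ∈ I with y i + h i ≤ R, h i ≤ R - 0 := by
    refine sum_le_of_disjoint_intervals (s := y) hR ?_ ?_ ?_
    · exact fun i hi => (hh i (Finset.mem_filter.1 hi).1).le
    · exact fun i hi => ⟨(hp.1 i (Finset.mem_filter.1 hi).1).2.2.1, (Finset.mem_filter.1 hi).2⟩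
    · exact fun i hi j hj => hd i (Finset.mem_filter.1 hi).1 j (Finset.mem_filter.1 hj).1
  have h2 : ∑ i ∈ I with ¬ y i + h i ≤ R, h i ≤ N - (N - R) := by
    refine sum_le_of_disjoint_intervals (s := y) (by linarith) ?_ ?_ ?_
    · exact fun i hi => (hh i (Finset.mem_filter.1 hi).1).le
    · intro i hi
      obtain ⟨hi, hi'⟩ := Finset.mem_filter.1 hi
      exact ⟨(hy i hi).resolve_left hi', (hp.1 i hi).2.2.2⟩
    · exact fun i hi j hj => hd i (Finset.mem_filter.1 hi).1 j (Finset.mem_filter.1 hj).1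
  linarith

/-- The items reaching from the left strip to the right strip have small total height, or the items
reaching from the bottom strip to the top strip have small total width. -/
theorem CoordPacking.sum_height_le_or_sum_width_le {R : ℝ} (hp : CoordPacking I w h x y N N)
    (hR : 0 ≤ R) (hRN : 2 * R < N) (hw : ∀ i ∈ I, 0 < w i) (hh : ∀ i ∈ I, 0 < h i)
    (hHV : ∀ i ∈ I, x i < R ∧ N - R < x i + w i → ¬ (y i < R ∧ N - R < y i + h i)) :
    ∑ i ∈ I with x i < R ∧ N - R < x i + w i, h i ≤ 2 * R ∨
      ∑ i ∈ I with y i < R ∧ N - R < y i + h i, w i ≤ 2 * R := by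
  by_cases hV : ∀ i ∈ I, y i < R ∧ N - R < y i + h i → x i + w i ≤ R ∨ N - R ≤ x i
  · refine Or.inr ((hp.mono (Finset.filter_subset _ _)).transpose.sum_height_le hR hRN ?_ ?_ ?_)
    · exact fun i hi => hw i (Finset.mem_filter.1 hi).1
    · exact fun i hi => (Finset.mem_filter.1 hi).2
    · exact fun i hi => hV i (Finset.mem_filter.1 hi).1 (Finset.mem_filter.1 hi).2
  · push Not at hV
    obtain ⟨j, hj, hjy, hj1, hj2⟩ := hV
    refine Or.inl ((hp.mono (Finset.filter_subset _ _)).sum_height_le hR hRN ?_ ?_ ?_)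
    · exact fun i hi => hh i (Finset.mem_filter.1 hi).1
    · exact fun i hi => (Finset.mem_filter.1 hi).2
    · intro i hi
      obtain ⟨hi, hix⟩ := Finset.mem_filter.1 hi
      have hij : i ≠ j := by
        rintro rfl
        exact hHV i hi hix hjy
      rcases hp.2 i hi j hj hij with h | h | h | h
      · linarith
      · linarith
      · exact Or.inl (by linarith)
      · exact Or.inr (by linarith)

/-- Among `n` candidate vertical slabs in the left strip of width `R`, one meets few narrow items.
Emptying it at the expense of the wide items outside `H`, and stacking the rotated items of `H` in
it, narrows the packing by `D`. -/
theorem CoordPacking.exists_narrowed [DecidableEq ι] {H : Finset ι} {D W R : ℝ} {n : ℕ}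
    (hp : CoordPacking I w h x y N N) (hw : ∀ i ∈ I, 0 < w i ∧ w i ≤ N)
    (hh : ∀ i ∈ I, 0 < h i) (hHI : H ⊆ I) (hD : 0 < D) (hHW : ∑ i ∈ H, h i ≤ W)
    (hn : 0 < n) (hnR : n * (W + 2 * D) ≤ R) (hRN : R ≤ N) {a : ℝ}
    (ha : (I.filter fun i => (D ≤ w i ∧ x i < R) ∧ i ∉ H).card ≤ a) :
    ∃ J ⊆ I, (I.card : ℝ) - a - I.card / n ≤ J.card ∧ CoordPackingRot J w h (N - D) N := by
  have hW : 0 ≤ W := (Finset.sum_nonneg fun i hi => (hh i (hHI hi)).le).trans hHW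
  set c := W + 2 * D with hc
  let Bad : ℕ → Finset ι := fun k =>
    I.filter fun i => w i < D ∧ x i < k * c + W + D ∧ k * c < x i + w i
  have hBad : ∀ k l : ℕ, k < l → Disjoint (Bad k) (Bad l) := by
    intro k l hkl
    rw [Finset.disjoint_left]
    intro i hi hi'
    obtain ⟨-, h1, h2, -⟩ := Finset.mem_filter.1 hi
    obtain ⟨-, -, -, h3⟩ := Finset.mem_filter.1 hi'
    have h4 : ((k : ℝ) + 1) * c ≤ l * c := by
      have : ((k : ℝ) + 1) ≤ l := by exact_mod_cast hkl
      exact mul_le_mul_of_nonneg_right this (by positivity)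
    linarith
  have hsum : ∑ k ∈ Finset.range n, (Bad k).card ≤ I.card := by
    rw [← Finset.card_biUnion]
    · exact Finset.card_le_card (Finset.biUnion_subset.2 fun k _ => Finset.filter_subset _ _)
    · intro k _ l _ hkl
      rcases lt_or_gt_of_ne hkl with h | h
      exacts [hBad k l h, (hBad l k h).symm]
  obtain ⟨k, hk, hkBad⟩ : ∃ k ∈ Finset.range n, ((Bad k).card : ℝ) ≤ I.card / n := by
    refine Finset.exists_le_of_sum_le (Finset.nonempty_range_iff.2 hn.ne') ?_
    rw [Finset.sum_const, Finset.card_range, nsmul_eq_mul,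
      mul_div_cancel₀ _ (by exact_mod_cast hn.ne')]
    exact_mod_cast hsum
  set A := I.filter fun i => (D ≤ w i ∧ x i < R) ∧ i ∉ H with hA
  set b : ℝ := k * c with hb
  have hb0 : 0 ≤ b := by positivity
  have hbR : b + W + 2 * D ≤ R := by
    have : ((k : ℝ) + 1) * c ≤ n * c := by
      have : ((k : ℝ) + 1) ≤ n := by exact_mod_cast Finset.mem_range.1 hk
      exact mul_le_mul_of_nonneg_right this (by positivity)
    linarith
  have hJ : I \ (A ∪ Bad k) ⊆ I := Finset.sdiff_subset
  have hout : ∀ i ∈ I \ (A ∪ Bad k), i ∉ H → x i + w i ≤ b ∨ b + W + D ≤ x i := by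
    intro i hi hiH
    simp only [Finset.mem_sdiff, Finset.mem_union, not_or, hA, Bad, Finset.mem_filter,
      not_and, not_lt, not_not] at hi
    obtain ⟨hi, h1, h2⟩ := hi
    rcases lt_or_ge (w i) D with hD' | hD'
    · rcases lt_or_ge (x i) (b + W + D) with h3 | h3
      · exact Or.inl (h2 hi hD' h3)
      · exact Or.inr h3
    · refine Or.inr ?_
      by_contra h3
      exact hiH (h1 hi ⟨hD', by linarith⟩)
  obtain ⟨s, hs, hsd⟩ := exists_stacking_s9 H h fun i hi => (hh i (hHI hi)).le
  refine ⟨I \ (A ∪ Bad k), hJ, ?_,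
    fun i => if i ∈ H then b + s i else if x i + w i ≤ b then x i else x i - D,
    fun i => if i ∈ H then 0 else y i, fun i => decide (i ∈ H), ?_, ?_⟩
  · have h1 : I.card ≤ (I \ (A ∪ Bad k)).card + (A ∪ Bad k).card := by
      rw [← Finset.card_union_of_disjoint Finset.sdiff_disjoint]
      exact Finset.card_le_card (by intro i hi; by_cases h : i ∈ A ∪ Bad k <;> simp_all)
    have h2 := Finset.card_union_le A (Bad k)
    have h3 : (I.card : ℝ) ≤ (I \ (A ∪ Bad k)).card + (A.card + (Bad k).card) := by
      exact_mod_cast h1.trans (by omega)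
    linarith
  · intro i hi
    have hiI := hJ hi
    have hpi := hp.1 i hiI
    by_cases hiH : i ∈ H
    · have := hs i hiH
      simp only [hiH, decide_true, if_true]
      refine ⟨by linarith, by linarith, le_rfl, by linarith [(hw i hiI).2]⟩
    · simp only [hiH, decide_false, if_false, Bool.false_eq_true]
      rcases hout i hi hiH with h | h
      · rw [if_pos h]
        exact ⟨hpi.1, by linarith, hpi.2.2⟩
      · rw [if_neg (by linarith [(hw i hiI).1])]
        exact ⟨by linarith, by linarith, hpi.2.2⟩
  · intro i hi j hj hij
    have hiI := hJ hi
    have hjI := hJ hj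
    have hwi := (hw i hiI).1
    have hwj := (hw j hjI).1
    by_cases hiH : i ∈ H <;> by_cases hjH : j ∈ H <;>
      simp only [hiH, hjH, decide_true, decide_false, if_true, if_false, Bool.false_eq_true]
    · rcases hsd i hiH j hjH hij with h | h
      · exact Or.inl (by linarith)
      · exact Or.inr (Or.inl (by linarith))
    · have := hs i hiH
      rcases hout j hj hjH with h | h
      · rw [if_pos h]
        exact Or.inr (Or.inl (by linarith))
      · rw [if_neg (by linarith)]
        exact Or.inl (by linarith)
    · have := hs j hjH
      rcases hout i hi hiH with h | h
      · rw [if_pos h]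
        exact Or.inl (by linarith)
      · rw [if_neg (by linarith)]
        exact Or.inr (Or.inl (by linarith))
    · have := hp.2 i hiI j hjI hij
      rcases hout i hi hiH with h | h <;> rcases hout j hj hjH with h' | h'
      · rw [if_pos h, if_pos h']
        exact this
      · rw [if_pos h, if_neg (by linarith)]
        exact Or.inl (by linarith)
      · rw [if_neg (by linarith), if_pos h']
        exact Or.inr (Or.inl (by linarith))
      · rw [if_neg (by linarith), if_neg (by linarith)]
        rcases this with h | h | h | h
        · exact Or.inl (by linarith)
        · exact Or.inr (Or.inl (by linarith))
        · exact Or.inr (Or.inr (Or.inl h))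
        · exact Or.inr (Or.inr (Or.inr h))

/-- Narrowing when the items that reach from the left to the right strip of width `R'` have small
total height. -/
theorem CoordPacking.exists_narrowed_of_sum_height_le {D R R' q : ℝ} {n : ℕ}
    (hp : CoordPacking I w h x y N N) (hw : ∀ i ∈ I, 0 < w i ∧ w i ≤ N)
    (hh : ∀ i ∈ I, 0 < h i ∧ h i ≤ N) (hthin : ∀ i ∈ I, D ≤ w i → h i < D)
    (hD : 0 < D) (hDN : D + 2 * R ≤ N) (hn : 0 < n) (hnR : n * (2 * R' + 2 * D) ≤ R)
    (hR' : 0 ≤ R') (hRR : R' ≤ R)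
    (hsum : ∑ i ∈ I with x i < R' ∧ N - R' < x i + w i, h i ≤ 2 * R')
    (hq : ((I.filter fun i => x i < R ∧ N - R < x i + w i).card : ℝ) -
      (I.filter fun i => x i < R' ∧ N - R' < x i + w i).card ≤ q) (hq0 : 0 ≤ q) :
    ∃ J ⊆ I, 2 / 3 * (I.card : ℝ) - q - I.card / n ≤ J.card ∧ CoordPackingRot J w h (N - D) N := by
  classical
  have hRN : R ≤ N := by linarith
  set H' := I.filter fun i => x i < R' ∧ N - R' < x i + w i with hH'
  set H := I.filter fun i => x i < R ∧ N - R < x i + w i with hH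
  have hHH : H' ⊆ H := Finset.monotone_filter_right I fun i _ h =>
    ⟨h.1.trans_le hRR, by linarith [h.2]⟩
  set B := I.filter fun i => D ≤ h i ∧ y i < R with hB
  set L := I.filter fun i => D ≤ w i ∧ x i < R with hL
  set T := I.filter fun i => D ≤ w i ∧ N - x i - w i < R with hT
  have hLT : L ∩ T ⊆ H := by
    intro i hi
    simp only [hL, hT, hH, Finset.mem_inter, Finset.mem_filter] at hi ⊢
    exact ⟨hi.1.1, hi.1.2.2, by linarith [hi.2.2.2]⟩
  have hcardB : (B.card : ℝ) + (L ∪ T).card ≤ I.card := by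
    have hdisj : Disjoint B (L ∪ T) := by
      rw [Finset.disjoint_left]
      intro i hi hi'
      simp only [hB, hL, hT, Finset.mem_union, Finset.mem_filter] at hi hi'
      have : D ≤ w i := by tauto
      linarith [hthin i hi.1 this, hi.2.1]
    have := Finset.card_le_card (s := B ∪ (L ∪ T)) (t := I)
      (Finset.union_subset (Finset.filter_subset _ _)
        (Finset.union_subset (Finset.filter_subset _ _) (Finset.filter_subset _ _)))
    rw [Finset.card_union_of_disjoint hdisj] at this
    exact_mod_cast this
  have hcardLT : ((L \ H).card : ℝ) + (T \ H).card ≤ (L ∪ T).card := by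
    have hdisj : Disjoint (L \ H) (T \ H) := by
      rw [Finset.disjoint_left]
      intro i hi hi'
      rw [Finset.mem_sdiff] at hi hi'
      exact hi.2 (hLT (Finset.mem_inter.2 ⟨hi.1, hi'.1⟩))
    have := Finset.card_le_card (s := (L \ H) ∪ (T \ H)) (t := L ∪ T)
      (Finset.union_subset_union Finset.sdiff_subset Finset.sdiff_subset)
    rw [Finset.card_union_of_disjoint hdisj] at this
    exact_mod_cast this
  have hHcard : ((H \ H').card : ℝ) ≤ q := by
    rw [Finset.cast_card_sdiff hHH]
    exact hq
  have hdel : ∀ P : ι → Prop, ∀ [DecidablePred P],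
      ((I.filter fun i => P i ∧ i ∉ H').card : ℝ) ≤ (I.filter P \ H).card + q := by
    intro P _
    have h1 : (I.filter fun i => P i ∧ i ∉ H') ⊆ (I.filter P \ H) ∪ (H \ H') := by
      intro i hi
      simp only [Finset.mem_filter, Finset.mem_union, Finset.mem_sdiff] at hi ⊢
      tauto
    have h2 := (Finset.card_le_card h1).trans (Finset.card_union_le _ _)
    have h3 : ((I.filter fun i => P i ∧ i ∉ H').card : ℝ) ≤
        (I.filter P \ H).card + (H \ H').card := by exact_mod_cast h2
    linarith
  rcases le_or_gt (B.card : ℝ) (I.card / 3) with hB3 | hB3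
  · have hnR0 : n * (0 + 2 * D) ≤ R := by
      refine le_trans ?_ hnR
      exact mul_le_mul_of_nonneg_left (by linarith) (by positivity)
    obtain ⟨J, hJ, hJc, hJp⟩ := hp.transpose.exists_narrowed (H := ∅) (W := 0) (a := B.card) hh
      (fun i hi => (hw i hi).1) (Finset.empty_subset _) hD (by simp) hn hnR0 hRN
      (by simp [hB])
    exact ⟨J, hJ, by linarith, hJp.swap⟩
  · have : ((L \ H).card : ℝ) ≤ I.card / 3 ∨ ((T \ H).card : ℝ) ≤ I.card / 3 := by
      by_contra! hcon
      linarith [hcon.1, hcon.2]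
    rcases this with h3 | h3
    · obtain ⟨J, hJ, hJc, hJp⟩ := hp.exists_narrowed hw (fun i hi => (hh i hi).1)
        (Finset.filter_subset _ _) hD hsum hn hnR hRN (hdel _)
      exact ⟨J, hJ, by linarith, hJp⟩
    · obtain ⟨J, hJ, hJc, hJp⟩ := hp.reflect.exists_narrowed hw (fun i hi => (hh i hi).1)
        (Finset.filter_subset _ _) hD hsum hn hnR hRN (hdel _)
      exact ⟨J, hJ, by linarith, hJp⟩

/-- Among the first `m` scales there is one at which two bounded decreasing sequences both drop by
little. -/
theorem exists_small_drop {m : ℕ} (hm : 0 < m) {f g : ℕ → ℝ} {C : ℝ} (hf : f 0 - f m ≤ C)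
    (hg : g 0 - g m ≤ C) : ∃ k < m, (f k - f (k + 1)) + (g k - g (k + 1)) ≤ 2 * C / m := by
  obtain ⟨k, hk, h⟩ := Finset.exists_le_of_sum_le (s := Finset.range m)
    (f := fun k => (f k - f (k + 1)) + (g k - g (k + 1))) (g := fun _ => 2 * C / m)
    (Finset.nonempty_range_iff.2 hm.ne') (by
      rw [Finset.sum_add_distrib, Finset.sum_range_sub', Finset.sum_range_sub', Finset.sum_const,
        Finset.card_range, nsmul_eq_mul, mul_div_cancel₀ _ (by exact_mod_cast hm.ne')]
      linarith)
  exact ⟨k, Finset.mem_range.1 hk, h⟩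

/-- Few items are large in both dimensions. -/
theorem CoordPacking.card_large_mul_sq_le {D : ℝ} (hp : CoordPacking I w h x y N N) (hN : 0 ≤ N)
    (hD : 0 < D) : (I.filter fun i => D ≤ w i ∧ D ≤ h i).card * D ^ 2 ≤ N ^ 2 := by
  have hmem := fun i (hi : i ∈ I.filter fun i => D ≤ w i ∧ D ≤ h i) => (Finset.mem_filter.1 hi).2
  have h1 := (hp.mono (Finset.filter_subset (fun i => D ≤ w i ∧ D ≤ h i) I)).sum_area_le hN hN
    (fun i hi => hD.trans_le (hmem i hi).1) (fun i hi => hD.trans_le (hmem i hi).2)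
  have h2 := Finset.card_nsmul_le_sum (I.filter fun i => D ≤ w i ∧ D ≤ h i)
    (fun i => w i * h i) (D * D)
    (fun i hi => mul_le_mul (hmem i hi).1 (hmem i hi).2 hD.le (hD.le.trans (hmem i hi).1))
  rw [nsmul_eq_mul] at h2
  calc _ = ((I.filter fun i => D ≤ w i ∧ D ≤ h i).card : ℝ) * (D * D) := by ring
    _ ≤ N * N := h2.trans h1
    _ = N ^ 2 := by ring

/-- A packing of thin items can be narrowed by keeping almost two thirds of them. -/
theorem CoordPacking.exists_narrowed_of_thin {ε : ℝ} {m : ℕ}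
    (hp : CoordPacking I w h x y N N) (hN : 0 < N) (hε0 : 0 < ε) (hε : ε ≤ 1 / 13) (hm7 : 7 ≤ m)
    (hme : 2 * m * ε = 1) (hw : ∀ i ∈ I, 0 < w i ∧ w i ≤ N) (hh : ∀ i ∈ I, 0 < h i ∧ h i ≤ N)
    (hthin : ∀ i ∈ I, ε ^ (m + 1) * N ≤ w i → h i < ε ^ (m + 1) * N)
    (hthin' : ∀ i ∈ I, ε ^ (m + 1) * N ≤ h i → w i < ε ^ (m + 1) * N) :
    ∃ J ⊆ I, 2 / 3 * (I.card : ℝ) - 9 * ε * I.card ≤ J.card ∧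
      CoordPackingRot J w h (N - ε ^ (m + 1) * N) N := by
  obtain ⟨n, hn0, hnm, hnm'⟩ : ∃ n : ℕ, 0 < n ∧ 2 * n ≤ m ∧ m ≤ 2 * n + 1 :=
    ⟨m / 2, by omega, by omega, by omega⟩
  have hnm : 2 * (n : ℝ) ≤ m := by exact_mod_cast hnm
  have hnm' : (m : ℝ) ≤ 2 * n + 1 := by exact_mod_cast hnm'
  have hn0' : (0 : ℝ) < n := by exact_mod_cast hn0
  have hε1 : ε ≤ 1 := by linarith
  have hD : 0 < ε ^ (m + 1) * N := by positivity
  have hdrop : ∀ z l : ι → ℝ,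
      ((I.filter fun i => z i < ε ^ (0 + 1) * N ∧ N - ε ^ (0 + 1) * N < z i + l i).card : ℝ) -
        (I.filter fun i => z i < ε ^ (m + 1) * N ∧ N - ε ^ (m + 1) * N < z i + l i).card ≤
          I.card := fun z l =>
    (sub_le_self _ (Nat.cast_nonneg _)).trans
      (by exact_mod_cast Finset.card_le_card (Finset.filter_subset _ _))
  obtain ⟨k, hkm, hk⟩ := exists_small_drop (m := m) (C := I.card)
    (f := fun k =>
      (I.filter fun i => x i < ε ^ (k + 1) * N ∧ N - ε ^ (k + 1) * N < x i + w i).card)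
    (g := fun k =>
      (I.filter fun i => y i < ε ^ (k + 1) * N ∧ N - ε ^ (k + 1) * N < y i + h i).card)
    (by omega) (hdrop x w) (hdrop y h)
  have hRε : ε ^ (k + 1) * N ≤ ε * N :=
    mul_le_mul_of_nonneg_right (pow_le_of_le_one hε0.le hε1 (by omega)) hN.le
  have hR'R : ε ^ (k + 1 + 1) * N = ε * (ε ^ (k + 1) * N) := by ring
  have hDR' : ε ^ (m + 1) * N ≤ ε ^ (k + 1 + 1) * N :=
    mul_le_mul_of_nonneg_right (pow_le_pow_of_le_one hε0.le hε1 (by omega)) hN.le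
  have hR0 : 0 < ε ^ (k + 1) * N := by positivity
  have hmono : ∀ z l : ι → ℝ,
      ((I.filter fun i =>
        z i < ε ^ (k + 1 + 1) * N ∧ N - ε ^ (k + 1 + 1) * N < z i + l i).card : ℝ) ≤
        (I.filter fun i => z i < ε ^ (k + 1) * N ∧ N - ε ^ (k + 1) * N < z i + l i).card := by
    intro z l
    have : ε ^ (k + 1 + 1) * N ≤ ε ^ (k + 1) * N := by nlinarith
    refine Nat.cast_le.2 (Finset.card_le_card (Finset.monotone_filter_right I fun i _ hi => ?_))
    exact ⟨hi.1.trans_le this, by linarith [hi.2]⟩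
  have hxm := hmono x w
  have hym := hmono y h
  have hq : 2 * (I.card : ℝ) / m = 4 * ε * I.card := by
    rw [div_eq_iff (by positivity)]
    linear_combination (-2 * (I.card : ℝ)) * hme
  have hn5 : (I.card : ℝ) / n ≤ 5 * ε * I.card := by
    rw [div_le_iff₀ hn0']
    have : 1 ≤ 5 * ε * n := by nlinarith
    nlinarith [Nat.cast_nonneg (α := ℝ) I.card]
  rw [hq] at hk
  set R := ε ^ (k + 1) * N with hR
  set R' := ε ^ (k + 1 + 1) * N with hR'
  have hR'0 : 0 < R' := by positivity
  have hεN : ε * N ≤ 1 / 13 * N := mul_le_mul_of_nonneg_right hε hN.le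
  have hδN : ε ^ (m + 1) * N ≤ ε * N :=
    mul_le_mul_of_nonneg_right (pow_le_of_le_one hε0.le hε1 (by omega)) hN.le
  have hRR : R' ≤ R := by nlinarith
  have hnR : n * (2 * R' + 2 * (ε ^ (m + 1) * N)) ≤ R := by
    have h1 : n * (2 * R' + 2 * (ε ^ (m + 1) * N)) ≤ n * (4 * R') :=
      mul_le_mul_of_nonneg_left (by linarith) hn0'.le
    have h2 : 2 * (2 * n) * ε ≤ 2 * m * ε := by gcongr
    rw [hR'R] at h1
    nlinarith
  have hdich := hp.sum_height_le_or_sum_width_le (R := R') hR'0.le (by linarith)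
    (fun i hi => (hw i hi).1) (fun i hi => (hh i hi).1)
    (fun i hi hix hiy => by
      have := hthin i hi (by linarith [hix.1, hix.2])
      linarith [hiy.1, hiy.2])
  rcases hdich with hsum | hsum
  · obtain ⟨J, hJ, hJc, hJp⟩ := hp.exists_narrowed_of_sum_height_le hw hh hthin hD
      (by linarith) hn0 hnR hR'0.le hRR hsum (q := 4 * ε * I.card) (by linarith) (by positivity)
    exact ⟨J, hJ, by linarith, hJp⟩
  · obtain ⟨J, hJ, hJc, hJp⟩ := hp.transpose.exists_narrowed_of_sum_height_le hh hw hthin' hD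
      (by linarith) hn0 hnR hR'0.le hRR hsum (q := 4 * ε * I.card) (by linarith) (by positivity)
    exact ⟨J, hJ, by linarith, hJp.swap⟩

end Coordinates

/-- resource contraction, cardinality case with rotations: from a
packing of `M` into the `N × N` knapsack one can keep `2/3(1 - 15ε)` of the
items and pack them, with rotations, into `[0, (1 - ε^{1/(2ε)+1})N] × [0, N]`. -/
theorem resource_contraction_cardinality
    {ι : Type*} (N ε εsmall : ℝ) (hN : 0 < N)
    (hε0 : 0 < ε) (hε : ε ≤ 1 / 13)
    (m : ℕ) (hm : (m : ℝ) = 1 / (2 * ε))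
    (hεsm0 : 0 < εsmall) (hεsm : εsmall < ε ^ (m + 1))
    (M : Finset ι) (w h : ι → ℝ)
    (hw : ∀ i ∈ M, 0 < w i ∧ w i ≤ N)
    (hh : ∀ i ∈ M, 0 < h i ∧ h i ≤ N)
    (hcard : 1 / εsmall ^ 3 ≤ (M.card : ℝ))
    (hpack : IsPacking M w h (Set.Icc 0 N ×ˢ Set.Icc 0 N)) :
    ∃ M' ⊆ M, (2 / 3 * (1 - 15 * ε) * M.card ≤ (M'.card : ℝ)) ∧
      IsPackingRot M' w h
        (Set.Icc 0 ((1 - ε ^ (m + 1)) * N) ×ˢ Set.Icc 0 N) := by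
  classical
  have hw0 := fun i hi => (hw i hi).1
  have hh0 := fun i hi => (hh i hi).1
  obtain ⟨x, y, hp⟩ := hpack.exists_coordPacking hw0 hh0
  have hme : 2 * m * ε = 1 := by
    rw [hm]
    field_simp
  have hm7 : 7 ≤ m := by
    have : (6 : ℝ) < m := by nlinarith
    exact_mod_cast this
  have hε1 : ε ≤ 1 := by linarith
  set δ := ε ^ (m + 1) with hδ
  have hδ0 : 0 < δ := by positivity
  have hδε : δ ≤ ε := pow_le_of_le_one hε0.le hε1 (by omega)
  have hD : 0 < δ * N := by positivity
  set M₀ := M.filter fun i => ¬ (δ * N ≤ w i ∧ δ * N ≤ h i) with hM₀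
  have hsub : M₀ ⊆ M := Finset.filter_subset _ _
  have hcard₀ : ((M.filter fun i => δ * N ≤ w i ∧ δ * N ≤ h i).card : ℝ) + M₀.card = M.card := by
    exact_mod_cast Finset.card_filter_add_card_filter_not _
  have hlarge : ((M.filter fun i => δ * N ≤ w i ∧ δ * N ≤ h i).card : ℝ) ≤ ε * M.card := by
    have h1 := hp.card_large_mul_sq_le hN.le hD
    have h2 : 1 ≤ δ ^ 3 * M.card := by
      rw [div_le_iff₀ (by positivity)] at hcard
      have : εsmall ^ 3 ≤ δ ^ 3 := pow_le_pow_left₀ hεsm0.le hεsm.le 3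
      nlinarith
    have h3 : ((M.filter fun i => δ * N ≤ w i ∧ δ * N ≤ h i).card : ℝ) * (δ ^ 2 * N ^ 2) ≤
        δ * M.card * (δ ^ 2 * N ^ 2) := by
      nlinarith [pow_pos hN 2]
    refine (le_of_mul_le_mul_right h3 (by positivity)).trans ?_
    gcongr
  have hp₀ := hp.mono hsub
  have hw₀ : ∀ i ∈ M₀, 0 < w i ∧ w i ≤ N := fun i hi => hw i (hsub hi)
  have hh₀ : ∀ i ∈ M₀, 0 < h i ∧ h i ≤ N := fun i hi => hh i (hsub hi)
  have hthin : ∀ i ∈ M₀, δ * N ≤ w i → h i < δ * N := fun i hi hiw =>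
    not_le.1 fun hih => (Finset.mem_filter.1 hi).2 ⟨hiw, hih⟩
  have hthin' : ∀ i ∈ M₀, δ * N ≤ h i → w i < δ * N := fun i hi hih =>
    not_le.1 fun hiw => (Finset.mem_filter.1 hi).2 ⟨hiw, hih⟩
  obtain ⟨J, hJ, hJc, hJp⟩ :=
    hp₀.exists_narrowed_of_thin hN hε0 hε hm7 hme hw₀ hh₀ hthin hthin'
  have hJM := hJ.trans hsub
  refine ⟨J, hJM, ?_, ?_⟩
  · have h1 : ε * M₀.card ≤ ε * M.card :=
      mul_le_mul_of_nonneg_left (by exact_mod_cast Finset.card_le_card hsub) hε0.le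
    have h2 : 0 ≤ ε * M.card := by positivity
    linarith
  · rw [show (1 - δ) * N = N - δ * N by ring]
    exact hJp.isPackingRot (fun i hi => hw0 i (hJM hi)) (fun i hi => hh0 i (hJM hi))
end

section
/- Let N > 0 and 0 < ε ≤ 1/6. Let M be a finite set of items with nonnegative profits, each with w(i), h(i) ∈ (0, N], admitting a packing into [0,N]×[0,N], and suppose M contains no massive item, i.e., every i ∈ M satisfies w(i) < (1 − ε)N or h(i) < (1 − ε)N. Then there exists a subset M' ⊆ M with p(M') ≥ (1/2)·p(M) admitting a packing with rotations into the box [0, N] × [0, (1 − ε/2)N]. -/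
/-- The open rectangles with corners `(x i, y i)` and side lengths `w i`, `h i` are separated by an
axis-parallel line. -/
def Separated {ι : Type*} (w h x y : ι → ℝ) (i j : ι) : Prop :=
  x i + w i ≤ x j ∨ x j + w j ≤ x i ∨ y i + h i ≤ y j ∨ y j + h j ≤ y i

/-- The items of `S` can be packed with rotations into a horizontal strip of width `N` and
height `s`. -/
def PacksInStrip {ι : Type*} (w h : ι → ℝ) (N : ℝ) (S : Finset ι) (s : ℝ) : Prop :=
  ∃ x y : ι → ℝ, ∃ rot : ι → Bool,
    (∀ i ∈ S, 0 ≤ x i ∧ x i + (if rot i then h i else w i) ≤ N ∧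
      0 ≤ y i ∧ y i + (if rot i then w i else h i) ≤ s) ∧
    (∀ i ∈ S, ∀ j ∈ S, i ≠ j →
      Separated (fun k => if rot k then h k else w k) (fun k => if rot k then w k else h k) x y i j)

theorem disjoint_Ioo_prod_of_separated {ι : Type*} {w h x y : ι → ℝ} {i j : ι}
    (hs : Separated w h x y i j) :
    Disjoint (Set.Ioo (x i) (x i + w i) ×ˢ Set.Ioo (y i) (y i + h i))
      (Set.Ioo (x j) (x j + w j) ×ˢ Set.Ioo (y j) (y j + h j)) := by
  rw [Set.disjoint_left]
  rintro ⟨a, b⟩ ⟨⟨h1, h2⟩, h3, h4⟩ ⟨⟨h5, h6⟩, h7, h8⟩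
  simp only at h1 h2 h3 h4 h5 h6 h7 h8
  rcases hs with hs | hs | hs | hs <;> linarith

theorem separated_of_disjoint_Ioo_prod {ι : Type*} {w h x y : ι → ℝ} {i j : ι}
    (hwi : 0 < w i) (hwj : 0 < w j) (hhi : 0 < h i) (hhj : 0 < h j)
    (hd : Disjoint (Set.Ioo (x i) (x i + w i) ×ˢ Set.Ioo (y i) (y i + h i))
      (Set.Ioo (x j) (x j + w j) ×ˢ Set.Ioo (y j) (y j + h j))) :
    Separated w h x y i j := by
  rw [Set.disjoint_prod, Set.Ioo_disjoint_Ioo, Set.Ioo_disjoint_Ioo] at hd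
  unfold Separated
  simp only [min_le_iff, le_max_iff] at hd
  rcases hd with ((h1 | h1) | (h1 | h1)) | ((h1 | h1) | (h1 | h1)) <;>
    first
      | linarith
      | exact Or.inl h1
      | exact Or.inr (Or.inl h1)
      | exact Or.inr (Or.inr (Or.inl h1))
      | exact Or.inr (Or.inr (Or.inr h1))

namespace PacksInStrip

variable {ι : Type*} {w h : ι → ℝ} {N s t : ℝ} {S T : Finset ι}

theorem isPackingRot (hS : PacksInStrip w h N S s) :
    IsPackingRot S w h (Set.Icc 0 N ×ˢ Set.Icc 0 s) := by
  obtain ⟨x, y, rot, hin, hsep⟩ := hS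
  refine ⟨x, y, rot, fun i hi => ?_, fun i hi j hj hij =>
    disjoint_Ioo_prod_of_separated (hsep i hi j hj hij)⟩
  obtain ⟨h1, h2, h3, h4⟩ := hin i hi
  exact Set.prod_mono (Set.Ioo_subset_Icc_self.trans (Set.Icc_subset_Icc h1 h2))
    (Set.Ioo_subset_Icc_self.trans (Set.Icc_subset_Icc h3 h4))

theorem mono (hS : PacksInStrip w h N S s) (hst : s ≤ t) : PacksInStrip w h N S t := by
  obtain ⟨x, y, rot, hin, hsep⟩ := hS
  refine ⟨x, y, rot, fun i hi => ?_, hsep⟩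
  obtain ⟨h1, h2, h3, h4⟩ := hin i hi
  exact ⟨h1, h2, h3, h4.trans hst⟩

theorem union [DecidableEq ι] (hS : PacksInStrip w h N S s) (hT : PacksInStrip w h N T t)
    (hs : 0 ≤ s) (ht : 0 ≤ t) : PacksInStrip w h N (S ∪ T) (s + t) := by
  obtain ⟨x, y, rot, hin, hsep⟩ := hS
  obtain ⟨x', y', rot', hin', hsep'⟩ := hT
  refine ⟨fun i => if i ∈ S then x i else x' i, fun i => if i ∈ S then y i else s + y' i,
    fun i => if i ∈ S then rot i else rot' i, fun i hi => ?_, fun i hi j hj hij => ?_⟩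
  · by_cases hiS : i ∈ S
    · obtain ⟨h1, h2, h3, h4⟩ := hin i hiS
      simp only [hiS, if_true]
      exact ⟨h1, h2, h3, by linarith⟩
    · obtain ⟨h1, h2, h3, h4⟩ := hin' i ((Finset.mem_union.1 hi).resolve_left hiS)
      simp only [hiS, if_false]
      exact ⟨h1, h2, by linarith, by linarith⟩
  · by_cases hiS : i ∈ S <;> by_cases hjS : j ∈ S
    · simpa only [Separated, hiS, hjS, if_true] using hsep i hiS j hjS hij
    · obtain ⟨-, -, -, h4⟩ := hin i hiS
      obtain ⟨-, -, h3, -⟩ := hin' j ((Finset.mem_union.1 hj).resolve_left hjS)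
      simp only [Separated, hiS, hjS, if_true, if_false]
      exact Or.inr (Or.inr (Or.inl (by linarith)))
    · obtain ⟨-, -, h3, -⟩ := hin' i ((Finset.mem_union.1 hi).resolve_left hiS)
      obtain ⟨-, -, -, h4⟩ := hin j hjS
      simp only [Separated, hiS, hjS, if_true, if_false]
      exact Or.inr (Or.inr (Or.inr (by linarith)))
    · have := hsep' i ((Finset.mem_union.1 hi).resolve_left hiS) j
        ((Finset.mem_union.1 hj).resolve_left hjS) hij
      simp only [Separated, hiS, hjS, if_false] at this ⊢
      rcases this with h1 | h1 | h1 | h1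
      · exact Or.inl h1
      · exact Or.inr (Or.inl h1)
      · exact Or.inr (Or.inr (Or.inl (by linarith)))
      · exact Or.inr (Or.inr (Or.inr (by linarith)))

end PacksInStrip

/-- The corner positions `x`, `y` describe a packing of `M` into the square of side length `N`,
where disjointness of items is expressed by separation. -/
structure IsSquarePacking {ι : Type*} (M : Finset ι) (w h : ι → ℝ) (N : ℝ) (x y : ι → ℝ) :
    Prop where
  left : ∀ i ∈ M, 0 ≤ x i
  right : ∀ i ∈ M, x i + w i ≤ N
  bottom : ∀ i ∈ M, 0 ≤ y i
  top : ∀ i ∈ M, y i + h i ≤ N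
  separated : ∀ i ∈ M, ∀ j ∈ M, i ≠ j → Separated w h x y i j

theorem IsPacking.exists_isSquarePacking {ι : Type*} {M : Finset ι} {w h : ι → ℝ} {N : ℝ}
    (hw : ∀ i ∈ M, 0 < w i) (hh : ∀ i ∈ M, 0 < h i)
    (hM : IsPacking M w h (Set.Icc 0 N ×ˢ Set.Icc 0 N)) :
    ∃ x y, IsSquarePacking M w h N x y := by
  obtain ⟨x, y, hin, hdis⟩ := hM
  have key : ∀ i ∈ M, (0 ≤ x i ∧ x i + w i ≤ N) ∧ 0 ≤ y i ∧ y i + h i ≤ N := by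
    intro i hi
    have hx : x i < x i + w i := by linarith [hw i hi]
    have hy : y i < y i + h i := by linarith [hh i hi]
    have hc := closure_mono (hin i hi)
    rw [closure_prod_eq, closure_Ioo hx.ne, closure_Ioo hy.ne,
      (isClosed_Icc.prod isClosed_Icc).closure_eq, Set.prod_subset_prod_iff] at hc
    rcases hc with hc | hc | hc
    · exact ⟨(Set.Icc_subset_Icc_iff hx.le).1 hc.1, (Set.Icc_subset_Icc_iff hy.le).1 hc.2⟩
    · exact absurd hc (Set.nonempty_Icc.2 hx.le).ne_empty
    · exact absurd hc (Set.nonempty_Icc.2 hy.le).ne_empty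
  exact ⟨x, y, fun i hi => (key i hi).1.1, fun i hi => (key i hi).1.2,
    fun i hi => (key i hi).2.1, fun i hi => (key i hi).2.2, fun i hi j hj hij =>
    separated_of_disjoint_Ioo_prod (hw i hi) (hw j hj) (hh i hi) (hh j hj) (hdis i hi j hj hij)⟩

namespace IsSquarePacking

variable {ι : Type*} {M : Finset ι} {w h : ι → ℝ} {N : ℝ} {x y : ι → ℝ}

theorem packsInStrip_of_horizontal (hM : IsSquarePacking M w h N x y) {S : Finset ι} (hS : S ⊆ M)
    (c s : ℝ) (hc : ∀ i ∈ S, c ≤ y i ∧ y i + h i ≤ c + s) : PacksInStrip w h N S s := by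
  refine ⟨x, fun i => y i - c, fun _ => false, fun i hi => ?_, fun i hi j hj hij => ?_⟩
  · obtain ⟨h1, h2⟩ := hc i hi
    simp only [Bool.false_eq_true, if_false]
    exact ⟨hM.left i (hS hi), hM.right i (hS hi), by linarith, by linarith⟩
  · simp only [Separated, Bool.false_eq_true, if_false]
    rcases hM.separated i (hS hi) j (hS hj) hij with h1 | h1 | h1 | h1
    · exact Or.inl h1
    · exact Or.inr (Or.inl h1)
    · exact Or.inr (Or.inr (Or.inl (by linarith)))
    · exact Or.inr (Or.inr (Or.inr (by linarith)))

theorem packsInStrip_of_vertical (hM : IsSquarePacking M w h N x y) {S : Finset ι} (hS : S ⊆ M)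
    (c s : ℝ) (hc : ∀ i ∈ S, c ≤ x i ∧ x i + w i ≤ c + s) : PacksInStrip w h N S s := by
  refine ⟨y, fun i => x i - c, fun _ => true, fun i hi => ?_, fun i hi j hj hij => ?_⟩
  · obtain ⟨h1, h2⟩ := hc i hi
    simp only [if_true]
    exact ⟨hM.bottom i (hS hi), hM.top i (hS hi), by linarith, by linarith⟩
  · simp only [Separated, if_true]
    rcases hM.separated i (hS hi) j (hS hj) hij with h1 | h1 | h1 | h1
    · exact Or.inr (Or.inr (Or.inl (by linarith)))
    · exact Or.inr (Or.inr (Or.inr (by linarith)))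
    · exact Or.inl h1
    · exact Or.inr (Or.inl h1)

/-- A non-massive item `d` reaching close to both vertical sides of the square lies close to the
bottom or to the top of the square, unless `M` is covered by two sets fitting into the shrunken
strip. -/
theorem exists_cover_or_near_boundary [DecidableEq ι] (hM : IsSquarePacking M w h N x y) {e : ℝ}
    (he : 0 < e) (heN : 6 * e ≤ N) {d : ι} (hd : d ∈ M) (hhd : 0 < h d)
    (hmass : w d < N - e ∨ h d < N - e)
    (hl : x d < 3 / 2 * e) (hr : N - 3 / 2 * e < x d + w d) :
    (∃ A ⊆ M, ∃ B ⊆ M, M ⊆ A ∪ B ∧ PacksInStrip w h N A (N - e / 2) ∧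
      PacksInStrip w h N B (N - e / 2)) ∨ y d + h d ≤ e / 2 ∨ N - e / 2 ≤ y d := by
  have hx0 := hM.left d hd
  have hx1 := hM.right d hd
  have hy0 := hM.bottom d hd
  have hy1 := hM.top d hd
  let Le := M.filter fun i => x i + w i ≤ x d
  let Ri := M.filter fun i => x d + w d ≤ x i
  let Lo := M.filter fun i => y i + h i ≤ y d
  let Up := M.filter fun i => y d + h d ≤ y i
  have sLe : Le ⊆ M := Finset.filter_subset _ _
  have sRi : Ri ⊆ M := Finset.filter_subset _ _
  have sLo : Lo ⊆ M := Finset.filter_subset _ _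
  have sUp : Up ⊆ M := Finset.filter_subset _ _
  have sD : {d} ⊆ M := Finset.singleton_subset_iff.2 hd
  have cover : ∀ i ∈ M, i ∈ Le ∨ i ∈ Ri ∨ i ∈ Lo ∨ i ∈ Up ∨ i ∈ ({d} : Finset ι) := by
    intro i hi
    by_cases hid : i = d
    · simp [hid]
    · rcases hM.separated i hi d hd hid with h1 | h1 | h1 | h1 <;> simp [Le, Ri, Lo, Up, hi, h1]
  have pLe : PacksInStrip w h N Le (x d) := hM.packsInStrip_of_vertical sLe 0 _ fun i hi =>
    ⟨hM.left i (sLe hi), by linarith [(Finset.mem_filter.1 hi).2]⟩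
  have pRi : PacksInStrip w h N Ri (N - (x d + w d)) :=
    hM.packsInStrip_of_vertical sRi (x d + w d) _ fun i hi =>
      ⟨(Finset.mem_filter.1 hi).2, by linarith [hM.right i (sRi hi)]⟩
  have pLo : PacksInStrip w h N Lo (y d) := hM.packsInStrip_of_horizontal sLo 0 _ fun i hi =>
    ⟨hM.bottom i (sLo hi), by linarith [(Finset.mem_filter.1 hi).2]⟩
  have pUp : PacksInStrip w h N Up (N - (y d + h d)) :=
    hM.packsInStrip_of_horizontal sUp (y d + h d) _ fun i hi =>
      ⟨(Finset.mem_filter.1 hi).2, by linarith [hM.top i (sUp hi)]⟩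
  have pD : PacksInStrip w h N {d} (h d) :=
    hM.packsInStrip_of_horizontal sD (y d) _ fun i hi => by
      rw [Finset.mem_singleton.1 hi]; exact ⟨le_rfl, le_rfl⟩
  have pD' : PacksInStrip w h N {d} (N - e / 2) := by
    rcases hmass with h1 | h1
    · refine (hM.packsInStrip_of_vertical sD (x d) (w d) fun i hi => ?_).mono (by linarith)
      rw [Finset.mem_singleton.1 hi]; exact ⟨le_rfl, le_rfl⟩
    · exact pD.mono (by linarith)
  have two : ∀ {A B : Finset ι} {a b : ℝ}, PacksInStrip w h N A a → PacksInStrip w h N B b →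
      0 ≤ a → 0 ≤ b → a + b ≤ N - e / 2 → PacksInStrip w h N (A ∪ B) (N - e / 2) :=
    fun hA hB ha hb hab => (hA.union hB ha hb).mono hab
  have three : ∀ {A B C : Finset ι} {a b c : ℝ}, PacksInStrip w h N A a →
      PacksInStrip w h N B b → PacksInStrip w h N C c → 0 ≤ a → 0 ≤ b → 0 ≤ c →
      a + b + c ≤ N - e / 2 → PacksInStrip w h N (A ∪ B ∪ C) (N - e / 2) :=
    fun hA hB hC ha hb hc habc => two (hA.union hB ha hb) hC (add_nonneg ha hb) hc habc
  have four : ∀ {A B C D : Finset ι} {a b c d : ℝ}, PacksInStrip w h N A a →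
      PacksInStrip w h N B b → PacksInStrip w h N C c → PacksInStrip w h N D d →
      0 ≤ a → 0 ≤ b → 0 ≤ c → 0 ≤ d →
      a + b + c + d ≤ N - e / 2 → PacksInStrip w h N (A ∪ B ∪ C ∪ D) (N - e / 2) :=
    fun hA hB hC hD ha hb hc hd habcd =>
      three (hA.union hB ha hb) hC hD (add_nonneg ha hb) hc hd habcd
  have hz1 : 0 ≤ N - (x d + w d) := by linarith
  have hb0 : 0 ≤ N - (y d + h d) := by linarith
  have finish : ∀ {A B : Finset ι}, A ⊆ M → B ⊆ M →
      (∀ i, (i ∈ Le ∨ i ∈ Ri ∨ i ∈ Lo ∨ i ∈ Up ∨ i ∈ ({d} : Finset ι)) → i ∈ A ∨ i ∈ B) →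
      PacksInStrip w h N A (N - e / 2) → PacksInStrip w h N B (N - e / 2) →
      (∃ A ⊆ M, ∃ B ⊆ M, M ⊆ A ∪ B ∧ PacksInStrip w h N A (N - e / 2) ∧
        PacksInStrip w h N B (N - e / 2)) ∨ y d + h d ≤ e / 2 ∨ N - e / 2 ≤ y d :=
    fun hA hB hAB pA pB =>
      Or.inl ⟨_, hA, _, hB, fun i hi => Finset.mem_union.2 (hAB i (cover i hi)), pA, pB⟩
  clear_value Le Ri Lo Up
  by_cases ha : 2 * e ≤ y d ∧ y d ≤ N - 2 * e
  · refine finish (Finset.union_subset sLo sLe)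
      (Finset.union_subset (Finset.union_subset sUp sD) sRi)
      (fun i => by
        rintro (hi | hi | hi | hi | hi) <;> simp only [Finset.mem_union, hi, true_or, or_true])
      (two pLo pLe ?_ ?_ ?_) (three pUp pD pRi ?_ ?_ ?_ ?_) <;> linarith
  by_cases hb : 2 * e ≤ N - (y d + h d) ∧ N - (y d + h d) ≤ N - 2 * e
  · refine finish (Finset.union_subset sUp sLe)
      (Finset.union_subset (Finset.union_subset sLo sD) sRi)
      (fun i => by
        rintro (hi | hi | hi | hi | hi) <;> simp only [Finset.mem_union, hi, true_or, or_true])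
      (two pUp pLe ?_ ?_ ?_) (three pLo pD pRi ?_ ?_ ?_ ?_) <;> linarith
  by_cases hc : 2 * e ≤ h d ∧ h d ≤ N - 2 * e
  · refine finish (Finset.union_subset sD sLe)
      (Finset.union_subset (Finset.union_subset sLo sUp) sRi)
      (fun i => by
        rintro (hi | hi | hi | hi | hi) <;> simp only [Finset.mem_union, hi, true_or, or_true])
      (two pD pLe ?_ ?_ ?_) (three pLo pUp pRi ?_ ?_ ?_ ?_) <;> linarith
  by_cases hc' : N - 2 * e < h d
  · refine finish sD
      (Finset.union_subset (Finset.union_subset (Finset.union_subset sLo sUp) sRi) sLe)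
      (fun i => by
        rintro (hi | hi | hi | hi | hi) <;> simp only [Finset.mem_union, hi, true_or, or_true])
      pD' (four pLo pUp pRi pLe ?_ ?_ ?_ ?_ ?_) <;> linarith
  by_cases hb' : N - 2 * e < N - (y d + h d)
  · by_cases hlow : y d + h d ≤ e / 2
    · exact Or.inr (Or.inl hlow)
    refine finish sUp
      (Finset.union_subset (Finset.union_subset (Finset.union_subset sLo sD) sRi) sLe)
      (fun i => by
        rintro (hi | hi | hi | hi | hi) <;> simp only [Finset.mem_union, hi, true_or, or_true])
      (pUp.mono ?_) (four pLo pD pRi pLe ?_ ?_ ?_ ?_ ?_) <;> linarith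
  by_cases ha' : N - 2 * e < y d
  · by_cases hup : N - e / 2 ≤ y d
    · exact Or.inr (Or.inr hup)
    refine finish sLo
      (Finset.union_subset (Finset.union_subset (Finset.union_subset sUp sD) sRi) sLe)
      (fun i => by
        rintro (hi | hi | hi | hi | hi) <;> simp only [Finset.mem_union, hi, true_or, or_true])
      (pLo.mono ?_) (four pUp pD pRi pLe ?_ ?_ ?_ ?_ ?_) <;> linarith
  · exfalso
    have h1 : y d < 2 * e := lt_of_not_ge fun h1 => ha ⟨h1, not_lt.1 ha'⟩
    have h2 : N - (y d + h d) < 2 * e := lt_of_not_ge fun h2 => hb ⟨h2, not_lt.1 hb'⟩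
    have h3 : h d < 2 * e := lt_of_not_ge fun h3 => hc ⟨h3, not_lt.1 hc'⟩
    linarith

theorem exists_cover [DecidableEq ι] (hM : IsSquarePacking M w h N x y) {e : ℝ}
    (he : 0 < e) (heN : 6 * e ≤ N) (hh : ∀ i ∈ M, 0 < h i)
    (hmass : ∀ i ∈ M, w i < N - e ∨ h i < N - e) :
    ∃ A ⊆ M, ∃ B ⊆ M, M ⊆ A ∪ B ∧ PacksInStrip w h N A (N - e / 2) ∧
      PacksInStrip w h N B (N - e / 2) := by
  by_contra hcon
  let Lo := M.filter fun i => y i + h i ≤ e / 2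
  let Up := M.filter fun i => N - e / 2 ≤ y i
  let A := M.filter fun i => 3 / 2 * e ≤ x i
  let B := M.filter fun i => x i + w i ≤ N - 3 / 2 * e
  have sLo : Lo ⊆ M := Finset.filter_subset _ _
  have sUp : Up ⊆ M := Finset.filter_subset _ _
  have sA : A ⊆ M := Finset.filter_subset _ _
  have sB : B ⊆ M := Finset.filter_subset _ _
  have cover : ∀ i ∈ M, i ∈ A ∨ i ∈ B ∨ i ∈ Lo ∨ i ∈ Up := by
    intro i hi
    by_cases hiA : 3 / 2 * e ≤ x i
    · simp [A, hi, hiA]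
    by_cases hiB : x i + w i ≤ N - 3 / 2 * e
    · simp [B, hi, hiB]
    rcases (hM.exists_cover_or_near_boundary he heN hi (hh i hi) (hmass i hi) (not_le.1 hiA)
      (not_le.1 hiB)).resolve_left hcon with h1 | h1
    · exact Or.inr (Or.inr (Or.inl (Finset.mem_filter.2 ⟨hi, h1⟩)))
    · exact Or.inr (Or.inr (Or.inr (Finset.mem_filter.2 ⟨hi, h1⟩)))
  have pLo : PacksInStrip w h N Lo (e / 2) := hM.packsInStrip_of_horizontal sLo 0 _ fun i hi =>
    ⟨hM.bottom i (sLo hi), by linarith [(Finset.mem_filter.1 hi).2]⟩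
  have pUp : PacksInStrip w h N Up (e / 2) :=
    hM.packsInStrip_of_horizontal sUp (N - e / 2) _ fun i hi =>
      ⟨(Finset.mem_filter.1 hi).2, by linarith [hM.top i (sUp hi)]⟩
  have pA : PacksInStrip w h N A (N - 3 / 2 * e) :=
    hM.packsInStrip_of_vertical sA (3 / 2 * e) _ fun i hi =>
      ⟨(Finset.mem_filter.1 hi).2, by linarith [hM.right i (sA hi)]⟩
  have pB : PacksInStrip w h N B (N - 3 / 2 * e) :=
    hM.packsInStrip_of_vertical sB 0 _ fun i hi =>
      ⟨hM.left i (sB hi), by linarith [(Finset.mem_filter.1 hi).2]⟩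
  have pLU := pLo.union pUp (by linarith) (by linarith)
  exact hcon ⟨A ∪ (Lo ∪ Up), by grind, B ∪ (Lo ∪ Up), by grind, by grind,
    (pA.union pLU (by linarith) (by linarith)).mono (by linarith),
    (pB.union pLU (by linarith) (by linarith)).mono (by linarith)⟩

end IsSquarePacking

/-- resource contraction, weighted case with rotations: if `M`
packs into the `N × N` knapsack and contains no massive item, then half of its
profit can be packed, with rotations, into `[0, N] × [0, (1 - ε/2)N]`. -/
theorem resource_contraction_weighted
    {ι : Type*} (N ε : ℝ) (hN : 0 < N)
    (hε0 : 0 < ε) (hε : ε ≤ 1 / 6)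
    (M : Finset ι) (w h p : ι → ℝ)
    (hw : ∀ i ∈ M, 0 < w i ∧ w i ≤ N)
    (hh : ∀ i ∈ M, 0 < h i ∧ h i ≤ N)
    (hp : ∀ i ∈ M, 0 ≤ p i)
    (hnomassive : ∀ i ∈ M, w i < (1 - ε) * N ∨ h i < (1 - ε) * N)
    (hpack : IsPacking M w h (Set.Icc 0 N ×ˢ Set.Icc 0 N)) :
    ∃ M' ⊆ M, (1 / 2 * ∑ i ∈ M, p i ≤ ∑ i ∈ M', p i) ∧
      IsPackingRot M' w h (Set.Icc 0 N ×ˢ Set.Icc 0 ((1 - ε / 2) * N)) := by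
  classical
  have hid : (1 - ε / 2) * N = N - ε * N / 2 := by ring
  have hid' : (1 - ε) * N = N - ε * N := by ring
  rw [hid]
  simp only [hid'] at hnomassive
  obtain ⟨x, y, hM⟩ := hpack.exists_isSquarePacking (fun i hi => (hw i hi).1)
    fun i hi => (hh i hi).1
  obtain ⟨A, hA, B, hB, hAB, pA, pB⟩ := hM.exists_cover (mul_pos hε0 hN) (by nlinarith)
    (fun i hi => (hh i hi).1) hnomassive
  have hsum : ∑ i ∈ M, p i ≤ ∑ i ∈ A, p i + ∑ i ∈ B, p i := by
    rw [← Finset.sum_union_inter]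
    have h1 : ∑ i ∈ M, p i ≤ ∑ i ∈ A ∪ B, p i :=
      Finset.sum_le_sum_of_subset_of_nonneg hAB fun i hi _ => hp i (Finset.union_subset hA hB hi)
    have h2 : 0 ≤ ∑ i ∈ A ∩ B, p i :=
      Finset.sum_nonneg fun i hi => hp i (hA (Finset.mem_inter.1 hi).1)
    linarith
  by_cases hhalf : 1 / 2 * ∑ i ∈ M, p i ≤ ∑ i ∈ A, p i
  · exact ⟨A, hA, hhalf, pA.isPackingRot⟩
  · exact ⟨B, hB, by linarith, pB.isPackingRot⟩
end

section
/- Let ε ∈ (0, 1), let w, h > 0, and let I' be a finite set of items such that every i ∈ I' satisfies w(i) ≤ ε·w and h(i) ≤ ε·h. Then there exists a subset I'' ⊆ I' with a(I'') ≥ min{ a(I'), (1 − 2ε)·w·h } that can be packed into the box [0, w] × [0, h]. In particular, if a(I') ≤ (1 − 2ε)·w·h, then all of I' can be packed into [0, w] × [0, h]. -/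
theorem IsPacking.mono {ι : Type*} {I : Finset ι} {w h : ι → ℝ} {R R' : Set (ℝ × ℝ)}
    (hI : IsPacking I w h R) (hR : R ⊆ R') : IsPacking I w h R' := by
  obtain ⟨x, y, hin, hdisj⟩ := hI
  exact ⟨x, y, fun i hi => (hin i hi).trans hR, hdisj⟩

theorem isPacking_empty {ι : Type*} (w h : ι → ℝ) (R : Set (ℝ × ℝ)) :
    IsPacking ∅ w h R :=
  ⟨0, 0, by simp, by simp⟩

/-- Packings of disjoint sets of items into regions with disjoint interiors can be combined. -/
theorem IsPacking.union {ι : Type*} [DecidableEq ι] {S T : Finset ι} {w h : ι → ℝ}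
    {R R' : Set (ℝ × ℝ)} (hS : IsPacking S w h R) (hT : IsPacking T w h R')
    (hST : Disjoint S T) (hR : Disjoint (interior R) (interior R')) :
    IsPacking (S ∪ T) w h (R ∪ R') := by
  obtain ⟨x, y, hin, hdisj⟩ := hS
  obtain ⟨x', y', hin', hdisj'⟩ := hT
  have hT_notMem : ∀ i ∈ T, i ∉ S := fun i hi hi' => Finset.disjoint_left.1 hST hi' hi
  have hcross : ∀ i ∈ S, ∀ j ∈ T,
      Disjoint (Set.Ioo (x i) (x i + w i) ×ˢ Set.Ioo (y i) (y i + h i))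
        (Set.Ioo (x' j) (x' j + w j) ×ˢ Set.Ioo (y' j) (y' j + h j)) := fun i hi j hj =>
    hR.mono (interior_maximal (hin i hi) (isOpen_Ioo.prod isOpen_Ioo))
      (interior_maximal (hin' j hj) (isOpen_Ioo.prod isOpen_Ioo))
  refine ⟨fun i => if i ∈ S then x i else x' i, fun i => if i ∈ S then y i else y' i, ?_, ?_⟩
  · intro i hi
    rcases Finset.mem_union.1 hi with hi | hi
    · simpa only [hi, if_true] using (hin i hi).trans Set.subset_union_left
    · simpa only [hT_notMem i hi, if_false] using (hin' i hi).trans Set.subset_union_right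
  · intro i hi j hj hij
    rcases Finset.mem_union.1 hi with hi | hi <;> rcases Finset.mem_union.1 hj with hj | hj
    · simpa only [hi, hj, if_true] using hdisj i hi j hj hij
    · simpa only [hi, hT_notMem j hj, if_true, if_false] using hcross i hi j hj
    · simpa only [hj, hT_notMem i hi, if_true, if_false] using (hcross j hj i hi).symm
    · simpa only [hT_notMem i hi, hT_notMem j hj, if_false] using hdisj' i hi j hj hij

/-- Items of height at most `H` can be packed side by side. -/
theorem isPacking_row {ι : Type*} (T : Finset ι) (w h : ι → ℝ) (x₀ y₀ H : ℝ)
    (hw : ∀ i ∈ T, 0 ≤ w i) (hH : ∀ i ∈ T, h i ≤ H) :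
    IsPacking T w h (Set.Icc x₀ (x₀ + ∑ i ∈ T, w i) ×ˢ Set.Icc y₀ (y₀ + H)) := by
  classical
  induction T using Finset.induction_on with
  | empty => exact isPacking_empty _ _ _
  | insert a s ha ih =>
    rw [Finset.forall_mem_insert] at hw hH
    have hs : 0 ≤ ∑ i ∈ s, w i := Finset.sum_nonneg hw.2
    have hsingle : IsPacking {a} w h (Set.Icc (x₀ + ∑ i ∈ s, w i)
        (x₀ + ∑ i ∈ s, w i + w a) ×ˢ Set.Icc y₀ (y₀ + H)) := by
      refine ⟨fun _ => x₀ + ∑ i ∈ s, w i, fun _ => y₀, ?_, by simp⟩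
      intro i hi
      rw [Finset.mem_singleton] at hi
      subst hi
      exact Set.prod_mono Set.Ioo_subset_Icc_self
        (Set.Ioo_subset_Icc_self.trans (Set.Icc_subset_Icc_right (by linarith [hH.1])))
    have hunion := hsingle.union (ih hw.2 hH.2) (Finset.disjoint_singleton_left.2 ha) (by
      simp only [interior_prod_eq, interior_Icc]
      refine Set.disjoint_prod.2 (Or.inl (Set.disjoint_left.2 fun z hz hz' => ?_))
      exact lt_asymm hz.1 hz'.2)
    rw [Finset.insert_eq]
    refine hunion.mono (Set.union_subset ?_ ?_) <;>
      rw [← Finset.insert_eq, Finset.sum_insert ha] <;>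
      refine Set.prod_mono (Set.Icc_subset_Icc ?_ ?_) subset_rfl <;> linarith [hw.1]

/-- The greedy choice of a shelf: a set of tallest items whose total width is at most `W`, which
either contains all items or is wider than `W - δ`. -/
theorem exists_shelf {ι : Type*} (I : Finset ι) (w h : ι → ℝ) {W δ : ℝ} (hW : 0 ≤ W)
    (hδ : ∀ i ∈ I, w i ≤ δ) :
    ∃ T ⊆ I, ∑ i ∈ T, w i ≤ W ∧
      (T = I ∨ ∃ c, (∀ i ∈ T, c ≤ h i) ∧ (∀ i ∈ I, i ∉ T → h i ≤ c) ∧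
        (∃ i ∈ I, i ∉ T ∧ h i = c) ∧ W - δ < ∑ i ∈ T, w i) := by
  classical
  induction I using Finset.induction_on_min_value h with
  | empty => exact ⟨∅, subset_rfl, by simpa using hW, Or.inl rfl⟩
  | insert a s ha hmin ih =>
    rw [Finset.forall_mem_insert] at hδ
    obtain ⟨T, hTs, hTW, rfl | ⟨c, hcT, hcs, ⟨j, hj, hjT, hjc⟩, hwide⟩⟩ := ih hδ.2
    · by_cases hfit : w a + ∑ i ∈ T, w i ≤ W
      · exact ⟨insert a T, subset_rfl, by rwa [Finset.sum_insert ha], Or.inl rfl⟩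
      · refine ⟨T, Finset.subset_insert a T, hTW, Or.inr ⟨h a, hmin, ?_,
          ⟨a, Finset.mem_insert_self a T, ha, rfl⟩, by linarith [hδ.1]⟩⟩
        intro i hi hiT
        rw [(Finset.mem_insert.1 hi).resolve_right hiT]
    · refine ⟨T, hTs.trans (Finset.subset_insert a s), hTW, Or.inr ⟨c, hcT, ?_,
        ⟨j, Finset.mem_insert_of_mem hj, hjT, hjc⟩, hwide⟩⟩
      intro i hi hiT
      rcases Finset.mem_insert.1 hi with rfl | hi
      · exact hjc ▸ hmin j hj
      · exact hcs i hi hiT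

/-- Next Fit Decreasing Height in a strip: it packs all items, or items of total area at least
`(W - δ) * (H - c)`, where `δ` and `c` bound the widths and heights of the items. -/
theorem exists_isPacking_strip {ι : Type*} {w h : ι → ℝ} {W δ : ℝ} (hW : 0 ≤ W)
    (hδW : δ ≤ W) (I : Finset ι) (hw : ∀ i ∈ I, 0 < w i) (hh : ∀ i ∈ I, 0 < h i)
    (hδ : ∀ i ∈ I, w i ≤ δ) {c : ℝ} (hc : ∀ i ∈ I, h i ≤ c) (y₀ H : ℝ) :
    ∃ S ⊆ I, (S = I ∨ (W - δ) * (H - c) ≤ ∑ i ∈ S, w i * h i) ∧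
      IsPacking S w h (Set.Icc 0 W ×ˢ Set.Icc y₀ (y₀ + H)) := by
  classical
  induction I using Finset.strongInduction generalizing c y₀ H with
  | H I ih =>
    rcases I.eq_empty_or_nonempty with rfl | hne
    · exact ⟨∅, subset_rfl, Or.inl rfl, isPacking_empty _ _ _⟩
    obtain ⟨m, hm, hmax⟩ := I.exists_max_image h hne
    by_cases hmH : H < h m
    · refine ⟨∅, I.empty_subset, Or.inr ?_, isPacking_empty _ _ _⟩
      rw [Finset.sum_empty]
      exact mul_nonpos_of_nonneg_of_nonpos (by linarith) (by linarith [hc m hm])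
    rw [not_lt] at hmH
    obtain ⟨T, hTI, hTW, hT⟩ := exists_shelf I w h hW hδ
    have hrow : IsPacking T w h (Set.Icc 0 W ×ˢ Set.Icc y₀ (y₀ + h m)) :=
      (isPacking_row T w h 0 y₀ (h m) (fun i hi => (hw i (hTI hi)).le)
        fun i hi => hmax i (hTI hi)).mono
          (Set.prod_mono (Set.Icc_subset_Icc_right (by linarith)) subset_rfl)
    rcases hT with rfl | ⟨c', hcT, hcI, ⟨j, hj, -, hjc⟩, hwide⟩
    · exact ⟨T, subset_rfl, Or.inl rfl, hrow.mono
        (Set.prod_mono subset_rfl (Set.Icc_subset_Icc_right (by linarith)))⟩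
    have hTne : T.Nonempty := Finset.nonempty_of_sum_ne_zero (f := w) (by linarith)
    have hsub : I \ T ⊆ I := Finset.sdiff_subset
    obtain ⟨S, hS, hSarea, hSpack⟩ := ih (I \ T) (Finset.sdiff_ssubset hTI hTne)
      (fun i hi => hw i (hsub hi)) (fun i hi => hh i (hsub hi)) (fun i hi => hδ i (hsub hi))
      (fun i hi => hcI i (hsub hi) (Finset.mem_sdiff.1 hi).2) (y₀ + h m) (H - h m)
    have hdisj : Disjoint T S := Finset.disjoint_of_subset_right hS Finset.disjoint_sdiff
    refine ⟨T ∪ S, Finset.union_subset hTI (hS.trans hsub), ?_, ?_⟩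
    · rcases hSarea with rfl | hSarea
      · exact Or.inl (Finset.union_sdiff_of_subset hTI)
      · right
        have hTarea : (∑ i ∈ T, w i) * c' ≤ ∑ i ∈ T, w i * h i := by
          rw [Finset.sum_mul]
          exact Finset.sum_le_sum fun i hi =>
            mul_le_mul_of_nonneg_left (hcT i hi) (hw i (hTI hi)).le
        rw [Finset.sum_union hdisj]
        have hwide' : (W - δ) * c' ≤ (∑ i ∈ T, w i) * c' :=
          mul_le_mul_of_nonneg_right hwide.le (hjc ▸ (hh j hj).le)
        have hmc : (W - δ) * (H - c) ≤ (W - δ) * (H - h m) :=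
          mul_le_mul_of_nonneg_left (by linarith [hc m hm]) (by linarith)
        linarith
    · refine (hrow.union hSpack hdisj ?_).mono (Set.union_subset ?_ ?_)
      · simp only [interior_prod_eq, interior_Icc]
        refine Set.disjoint_prod.2 (Or.inr (Set.disjoint_left.2 fun z hz hz' => ?_))
        exact lt_asymm hz.2 hz'.1
      · exact Set.prod_mono subset_rfl (Set.Icc_subset_Icc_right (by linarith))
      · exact Set.prod_mono subset_rfl
          (Set.Icc_subset_Icc (by linarith [hh m hm]) (by linarith))

/-- Next Fit Decreasing Height: if all items of `I'` have width
at most `ε w` and height at most `ε h`, then a subset of area at least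
`min(a(I'), (1-2ε)wh)` can be packed into the `w × h` box; in particular, if
`a(I') ≤ (1-2ε)wh` then all of `I'` can be packed. -/
theorem nfdh_packing
    {ι : Type*} (ε w h : ℝ) (hε0 : 0 < ε) (hε1 : ε < 1)
    (hw : 0 < w) (hh : 0 < h)
    (I' : Finset ι) (wI hI : ι → ℝ)
    (hwpos : ∀ i ∈ I', 0 < wI i) (hhpos : ∀ i ∈ I', 0 < hI i)
    (hwub : ∀ i ∈ I', wI i ≤ ε * w) (hhub : ∀ i ∈ I', hI i ≤ ε * h) :
    (∃ I'' ⊆ I',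
        (min (∑ i ∈ I', wI i * hI i) ((1 - 2 * ε) * (w * h)) ≤
          ∑ i ∈ I'', wI i * hI i) ∧
        IsPacking I'' wI hI (Set.Icc 0 w ×ˢ Set.Icc 0 h)) ∧
      ((∑ i ∈ I', wI i * hI i) ≤ (1 - 2 * ε) * (w * h) →
        IsPacking I' wI hI (Set.Icc 0 w ×ˢ Set.Icc 0 h)) := by
  obtain ⟨S, hSI, hSarea, hSpack⟩ := exists_isPacking_strip hw.le
    (mul_le_of_le_one_left hw.le hε1.le) I' hwpos hhpos hwub hhub 0 h
  rw [zero_add] at hSpack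
  have harea : min (∑ i ∈ I', wI i * hI i) ((1 - 2 * ε) * (w * h)) ≤
      ∑ i ∈ S, wI i * hI i := by
    rcases hSarea with rfl | hSarea
    · exact min_le_left _ _
    · refine (min_le_right _ _).trans (le_trans ?_ hSarea)
      nlinarith [mul_nonneg (sq_nonneg ε) (mul_pos hw hh).le]
  refine ⟨⟨S, hSI, harea, hSpack⟩, fun hle => ?_⟩
  rw [min_eq_left hle] at harea
  suffices S = I' from this ▸ hSpack
  refine hSI.antisymm fun i hi => ?_
  by_contra hiS
  exact harea.not_gt (Finset.sum_lt_sum_of_subset hSI hi hiS (mul_pos (hwpos i hi) (hhpos i hi))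
    fun j hj _ => (mul_pos (hwpos j hj) (hhpos j hj)).le)
end

section
/- Let 0 < ε < 1, let C > 0, and let R be a finite set of items, each item i having a size s(i) ≥ 0 and a profit p(i) ≥ 0, with Σ_{i∈R} s(i) ≤ C. Then there exist disjoint subsets X, Y ⊆ R such that |X| ≤ ⌈1/ε⌉², p(Y) ≤ ε·p(R), and every item i ∈ R ∖ (X ∪ Y) satisfies s(i) ≤ ε·(C − Σ_{j∈X} s(j)). -/
/-- Among items of total size at most `D`, at most `⌈1 / ε⌉` have size exceeding `ε * D`. -/
theorem card_filter_large_le {ι : Type*} {ε D : ℝ} (hε : 0 < ε) (A : Finset ι) (s : ι → ℝ)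
    (hs : ∀ i ∈ A, 0 ≤ s i) (hsum : ∑ i ∈ A, s i ≤ D) :
    (A.filter fun i => ε * D < s i).card ≤ ⌈1 / ε⌉₊ := by
  have hle : ∑ i ∈ A.filter (fun i => ε * D < s i), s i ≤ ∑ i ∈ A, s i :=
    Finset.sum_le_sum_of_subset_of_nonneg (Finset.filter_subset _ _) fun i hi _ => hs i hi
  have hcard : ((A.filter fun i => ε * D < s i).card : ℝ) * (ε * D) ≤
      ∑ i ∈ A.filter (fun i => ε * D < s i), s i := by
    rw [← nsmul_eq_mul]
    exact Finset.card_nsmul_le_sum _ _ _ fun i hi => (Finset.mem_filter.1 hi).2.le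
  rcases (hsum.trans' (Finset.sum_nonneg hs)).eq_or_lt with hD | hD
  · have hempty : A.filter (fun i => ε * D < s i) = ∅ := by
      refine Finset.filter_eq_empty_iff.2 fun i hi => ?_
      have := Finset.single_le_sum hs hi
      rw [← hD, mul_zero]
      linarith
    simp [hempty]
  · refine Nat.cast_le.1 (le_trans ?_ (Nat.le_ceil (1 / ε)))
    rw [le_div_iff₀ hε]
    refine le_of_mul_le_mul_right ?_ hD
    linarith


/-- from a set `R` of items with sizes summing to at most `C`
one can remove a set `X` of at most `⌈1/ε⌉²` items and a set `Y` of profit at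
most `ε p(R)` so that every remaining item has size at most
`ε (C - s(X))`. -/
theorem size_classification
    {ι : Type*} [DecidableEq ι] (ε C : ℝ) (hε0 : 0 < ε) (hε1 : ε < 1) (hC : 0 < C)
    (R : Finset ι) (s p : ι → ℝ)
    (hs : ∀ i ∈ R, 0 ≤ s i) (hp : ∀ i ∈ R, 0 ≤ p i)
    (hsum : ∑ i ∈ R, s i ≤ C) :
    ∃ X ⊆ R, ∃ Y ⊆ R, Disjoint X Y ∧
      X.card ≤ ⌈1 / ε⌉₊ ^ 2 ∧
      (∑ i ∈ Y, p i) ≤ ε * ∑ i ∈ R, p i ∧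
      ∀ i ∈ R \ (X ∪ Y), s i ≤ ε * (C - ∑ j ∈ X, s j) := by
  let L : Finset ι → Finset ι := fun A =>
    (R \ A).filter fun i => ε * (C - ∑ j ∈ A, s j) < s i
  have hLsub (A : Finset ι) : L A ⊆ R \ A := Finset.filter_subset _ _
  have hLdisj (A : Finset ι) : Disjoint A (L A) :=
    Finset.disjoint_sdiff.mono_right (hLsub A)
  have hLcard {A : Finset ι} (hA : A ⊆ R) : (L A).card ≤ ⌈1 / ε⌉₊ := by
    refine card_filter_large_le hε0 _ _ (fun i hi => hs i (Finset.mem_sdiff.1 hi).1) ?_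
    have := Finset.sum_sdiff (f := s) hA
    linarith
  by_contra hcon
  have hprofit {A : Finset ι} (hA : A ⊆ R) (hAcard : A.card ≤ ⌈1 / ε⌉₊ ^ 2) :
      ε * ∑ i ∈ R, p i < ∑ i ∈ L A, p i := by
    by_contra! hle
    refine hcon ⟨A, hA, L A, (hLsub A).trans Finset.sdiff_subset, hLdisj A, hAcard, hle, ?_⟩
    intro i hi
    by_contra! hlt
    simp only [Finset.mem_sdiff, Finset.mem_union, not_or] at hi
    exact hi.2.2 (Finset.mem_filter.2 ⟨Finset.mem_sdiff.2 ⟨hi.1, hi.2.1⟩, hlt⟩)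
  have hiter (n : ℕ) (hn : n ≤ ⌈1 / ε⌉₊) :
      ∃ A ⊆ R, A.card ≤ n * ⌈1 / ε⌉₊ ∧ n * (ε * ∑ i ∈ R, p i) ≤ ∑ i ∈ A, p i := by
    induction n with
    | zero => exact ⟨∅, by simp⟩
    | succ n ih =>
      obtain ⟨A, hA, hAcard, hAp⟩ := ih (by omega)
      refine ⟨A ∪ L A, Finset.union_subset hA ((hLsub A).trans Finset.sdiff_subset), ?_, ?_⟩
      · have := Finset.card_union_le A (L A)
        have := hLcard hA
        linarith
      · have := hprofit hA (by nlinarith)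
        rw [Finset.sum_union (hLdisj A)]
        push_cast
        linarith
  obtain ⟨A, hA, hAcard, hAp⟩ := hiter _ le_rfl
  have hlarge := hprofit hA (by rwa [sq])
  have hL : ∑ i ∈ L A, p i ≤ ∑ i ∈ R \ A, p i :=
    Finset.sum_le_sum_of_subset_of_nonneg (hLsub A) fun i hi _ => hp i (Finset.mem_sdiff.1 hi).1
  have hsplit := Finset.sum_sdiff (f := p) hA
  have hR : 0 ≤ ∑ i ∈ R, p i := Finset.sum_nonneg hp
  have hceil : 1 ≤ (⌈1 / ε⌉₊ : ℝ) * ε := (div_le_iff₀ hε0).1 (Nat.le_ceil _)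
  nlinarith [mul_le_mul_of_nonneg_right hceil hR, mul_nonneg hε0.le hR]
end

section
/- Let 0 < ε < 1 and let I be a nonempty finite set of n items with nonnegative profits. Let w_C, h_C > 0 satisfy w(i) ≤ w_C for all i ∈ I and Σ_{i∈I} h(i) ≤ h_C. Then for every integer k ≥ 1/ε there exist a subset I' ⊆ I with p(I') ≥ (1 − ε)·p(I) and reals w' ∈ WIDTHS(I)^{(k,n)} and h' ∈ HEIGHTS(I)^{(k,n)} with w' ≤ w_C and h' ≤ h_C, such that w(i) ≤ w' for all i ∈ I' and Σ_{i∈I'} h(i) ≤ h'. -/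
/-- `PCombSet P k n` is the set `P^{(k,n)} = {p₁ + ⋯ + p_l + i·p : l ≤ k, pⱼ, p ∈ P,
i ∈ ℕ, i ≤ n}`. -/
def PCombSet (P : Set ℝ) (k n : ℕ) : Set ℝ :=
  {x | ∃ l : ℕ, l ≤ k ∧ ∃ q : Fin l → ℝ, (∀ j, q j ∈ P) ∧
    ∃ p ∈ P, ∃ i : ℕ, i ≤ n ∧ x = (∑ j, q j) + (i : ℝ) * p}

/-- A finite set has a subset of any admissible cardinality `k` all of whose `f`-values dominate
those outside of it. -/
theorem Finset.exists_subset_card_eq_forall_le {ι : Type*} (I : Finset ι) (f : ι → ℝ) (k : ℕ)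
    (hk : k ≤ I.card) :
    ∃ L ⊆ I, L.card = k ∧ ∀ x ∈ L, ∀ y ∈ I, y ∉ L → f y ≤ f x := by
  classical
  induction k with
  | zero => exact ⟨∅, by simp, by simp, by simp⟩
  | succ k ih =>
    obtain ⟨L, hLI, hcard, hL⟩ := ih (by omega)
    have hne : (I \ L).Nonempty := by
      rw [← Finset.card_pos, Finset.card_sdiff_of_subset hLI]
      omega
    obtain ⟨m, hm, hmax⟩ := Finset.exists_max_image (I \ L) f hne
    rw [Finset.mem_sdiff] at hm
    refine ⟨insert m L, Finset.insert_subset hm.1 hLI, ?_, ?_⟩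
    · rw [Finset.card_insert_of_notMem hm.2, hcard]
    · intro x hx y hy hyL
      rw [Finset.mem_insert, not_or] at hyL
      rcases Finset.mem_insert.1 hx with rfl | hx
      · exact hmax y (Finset.mem_sdiff.2 ⟨hy, hyL.2⟩)
      · exact hL x hx y hy hyL.2

theorem sum_add_mul_mem_PCombSet {ι : Type*} {I S : Finset ι} {f : ι → ℝ} {k n i : ℕ} {j : ι}
    (hS : S ⊆ I) (hcard : S.card ≤ k) (hj : j ∈ I) (hi : i ≤ n) :
    (∑ x ∈ S, f x) + (i : ℝ) * f j ∈ PCombSet {t : ℝ | ∃ i ∈ I, f i = t} k n := by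
  refine ⟨S.card, hcard, fun a => f (S.equivFin.symm a),
    fun a => ⟨_, hS (S.equivFin.symm a).2, rfl⟩, f j, ⟨j, hj, rfl⟩, i, hi, ?_⟩
  rw [Equiv.sum_comp S.equivFin.symm (fun x : S => f x), Finset.sum_coe_sort]

/-- rounding a (horizontal) container: keeping `(1-ε)` of the
profit, the container dimensions can be rounded down to values in
`WIDTHS(I)^{(k,n)}` and `HEIGHTS(I)^{(k,n)}`. -/
theorem round_container_sizes
    {ι : Type*} (ε : ℝ) (hε0 : 0 < ε) (hε1 : ε < 1)
    (I : Finset ι) (hI : I.Nonempty) (n : ℕ) (hn : I.card = n)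
    (w h p : ι → ℝ)
    (hwpos : ∀ i ∈ I, 0 < w i) (hhpos : ∀ i ∈ I, 0 < h i)
    (hp : ∀ i ∈ I, 0 ≤ p i)
    (wC hC : ℝ) (hwC : 0 < wC) (hhC : 0 < hC)
    (hwub : ∀ i ∈ I, w i ≤ wC) (hhsum : ∑ i ∈ I, h i ≤ hC)
    (k : ℕ) (hk : (1 : ℝ) / ε ≤ k) :
    ∃ I' ⊆ I, ((1 - ε) * ∑ i ∈ I, p i ≤ ∑ i ∈ I', p i) ∧
      ∃ w' ∈ PCombSet {t : ℝ | ∃ i ∈ I, w i = t} k n,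
      ∃ h' ∈ PCombSet {t : ℝ | ∃ i ∈ I, h i = t} k n,
        w' ≤ wC ∧ h' ≤ hC ∧ (∀ i ∈ I', w i ≤ w') ∧ (∑ i ∈ I', h i) ≤ h' := by
  classical
  obtain ⟨m, hm, hmax⟩ := Finset.exists_max_image I w hI
  have hn1 : 1 ≤ n := hn ▸ Finset.card_pos.2 hI
  have hw' : w m ∈ PCombSet {t : ℝ | ∃ i ∈ I, w i = t} k n := by
    simpa using sum_add_mul_mem_PCombSet (f := w) (k := k) (Finset.empty_subset I) (by simp) hm hn1
  have hP : 0 ≤ ∑ i ∈ I, p i := Finset.sum_nonneg hp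
  rcases le_or_gt n k with hnk | hkn
  · refine ⟨I, Finset.Subset.refl I, by nlinarith, w m, hw', ∑ i ∈ I, h i, ?_,
      hwub m hm, hhsum, hmax, le_rfl⟩
    simpa using sum_add_mul_mem_PCombSet (f := h) (Finset.Subset.refl I) (hn.trans_le hnk) hm
      (Nat.zero_le n)
  · have hk0 : (0 : ℝ) < k := (one_div_pos.2 hε0).trans_le hk
    obtain ⟨L, hLI, hLcard, hL⟩ := I.exists_subset_card_eq_forall_le h k (by omega)
    have hLne : L.Nonempty := by
      rw [← Finset.card_pos, hLcard]
      exact_mod_cast hk0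
    obtain ⟨j, hjL, hjmin⟩ := Finset.exists_min_image L p hLne
    have hjI := hLI hjL
    have hpj : p j ≤ ε * ∑ i ∈ I, p i := by
      have h1 : (k : ℝ) * p j ≤ ∑ i ∈ I, p i := by
        have h2 := Finset.card_nsmul_le_sum L p (p j) hjmin
        rw [hLcard, nsmul_eq_mul] at h2
        exact h2.trans (Finset.sum_le_sum_of_subset_of_nonneg hLI fun i hi _ => hp i hi)
      rw [div_le_iff₀ hε0] at hk
      nlinarith [hp j hjI]
    have hj0 := hhpos j hjI
    have hR0 : 0 ≤ ∑ i ∈ I \ L, h i :=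
      Finset.sum_nonneg fun i hi => (hhpos i (Finset.mem_sdiff.1 hi).1).le
    have hsplit : ∑ i ∈ I \ L, h i + (∑ i ∈ L.erase j, h i + h j) = ∑ i ∈ I, h i := by
      rw [Finset.sum_erase_add _ _ hjL, Finset.sum_sdiff hLI]
    have herase := Finset.sum_erase_add I h hjI
    have hperase := Finset.sum_erase_add I p hjI
    have hceil_le : ⌈(∑ i ∈ I \ L, h i) / h j⌉₊ ≤ n := by
      rw [Nat.ceil_le, div_le_iff₀ hj0]
      have h1 := Finset.sum_le_card_nsmul (I \ L) h (h j) fun i hi =>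
        hL j hjL i (Finset.mem_sdiff.1 hi).1 (Finset.mem_sdiff.1 hi).2
      rw [nsmul_eq_mul] at h1
      have h2 : (((I \ L).card : ℕ) : ℝ) ≤ n := by
        exact_mod_cast hn ▸ Finset.card_le_card Finset.sdiff_subset
      exact h1.trans (mul_le_mul_of_nonneg_right h2 hj0.le)
    have hlow : ∑ i ∈ I \ L, h i ≤ ⌈(∑ i ∈ I \ L, h i) / h j⌉₊ * h j :=
      (div_le_iff₀ hj0).1 (Nat.le_ceil _)
    have hupp : ⌈(∑ i ∈ I \ L, h i) / h j⌉₊ * h j ≤ ∑ i ∈ I \ L, h i + h j := by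
      have h1 := mul_le_mul_of_nonneg_right
        (Nat.ceil_lt_add_one (div_nonneg hR0 hj0.le)).le hj0.le
      rwa [add_mul, div_mul_cancel₀ _ hj0.ne', one_mul] at h1
    refine ⟨I.erase j, Finset.erase_subset j I, by linarith, w m, hw', _,
      sum_add_mul_mem_PCombSet (S := L.erase j) ((Finset.erase_subset j L).trans hLI)
        ((Finset.card_erase_le).trans hLcard.le) hjI hceil_le,
      hwub m hm, by linarith, fun i hi => hmax i (Finset.mem_of_mem_erase hi), by linarith⟩
end

section
/- Let N > 0 and 0 < ε ≤ 1/20. Let S be a finite set of items with nonnegative profits packed into [0,N]×[0,N] such that every item i satisfies either (h(i) ≤ εN and w(i) ≤ (1/2 + 2ε)N) or (w(i) ≤ εN and h(i) ≤ (1/2 + 2ε)N). Then there exist a, b ∈ [0, (1 − 3ε)N] such that the set S' of items of S whose open rectangles are disjoint from both the vertical strip [a, a + 3εN]×[0,N] and the horizontal strip [0,N]×[b, b + 3εN] satisfies p(S') ≥ (1/2 − 13ε)·p(S). -/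
open MeasureTheory in
/-- Averaging over `a ∈ [0, L]`: some point `a` is hit by a family of weighted open intervals
with total weight at most the weighted sum of the lengths divided by `L`. -/
lemma exists_mul_sum_indicator_Ioo_le {ι : Type*} (S : Finset ι) (p l r : ι → ℝ) {L : ℝ}
    (hL : 0 < L) (hp : ∀ i ∈ S, 0 ≤ p i) (hlr : ∀ i ∈ S, l i ≤ r i) :
    ∃ a ∈ Set.Icc 0 L,
      L * ∑ i ∈ S, (Set.Ioo (l i) (r i)).indicator (fun _ => p i) a ≤
        ∑ i ∈ S, p i * (r i - l i) := by
  have hint : ∀ i ∈ S, IntegrableOn ((Set.Ioo (l i) (r i)).indicator fun _ => p i)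
      (Set.Icc 0 L) := fun i _ =>
    (integrableOn_const (by simp)).indicator measurableSet_Ioo
  obtain ⟨a, ha, hle⟩ := exists_le_setAverage (μ := volume) (s := Set.Icc 0 L)
    (f := fun a => ∑ i ∈ S, (Set.Ioo (l i) (r i)).indicator (fun _ => p i) a)
    (by simp [hL]) (by simp) (integrable_finsetSum S hint)
  refine ⟨a, ha, ?_⟩
  rw [setAverage_eq, integral_finsetSum S hint, smul_eq_mul, Real.volume_real_Icc_of_le hL.le,
    sub_zero, inv_mul_eq_div, le_div_iff₀' hL] at hle
  refine hle.trans (Finset.sum_le_sum fun i hi => ?_)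
  rw [integral_indicator_const _ measurableSet_Ioo, smul_eq_mul, mul_comm,
    ← Real.volume_real_Ioo_of_le (hlr i hi), measureReal_restrict_apply measurableSet_Ioo]
  exact mul_le_mul_of_nonneg_left
    (measureReal_mono Set.inter_subset_left (by simp)) (hp i hi)

/-- for a packing of short items into the `N × N` square, there
are positions for a vertical strip of width `3εN` and a horizontal strip of
height `3εN` such that the items avoiding both strips keep at least
`(1/2 - 13ε)` of the profit. -/
theorem random_strip_deletion
    {ι : Type*} (N ε : ℝ) (hN : 0 < N) (hε0 : 0 < ε) (hε : ε ≤ 1 / 20)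
    (S : Finset ι) (w h p : ι → ℝ)
    (hwpos : ∀ i ∈ S, 0 < w i) (hhpos : ∀ i ∈ S, 0 < h i)
    (hp : ∀ i ∈ S, 0 ≤ p i)
    (hshort : ∀ i ∈ S,
      (h i ≤ ε * N ∧ w i ≤ (1 / 2 + 2 * ε) * N) ∨
      (w i ≤ ε * N ∧ h i ≤ (1 / 2 + 2 * ε) * N))
    (x y : ι → ℝ)
    (hin : ∀ i ∈ S,
      (Set.Ioo (x i) (x i + w i) ×ˢ Set.Ioo (y i) (y i + h i)) ⊆
        Set.Icc 0 N ×ˢ Set.Icc 0 N)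
    (hdisj : ∀ i ∈ S, ∀ j ∈ S, i ≠ j →
      Disjoint (Set.Ioo (x i) (x i + w i) ×ˢ Set.Ioo (y i) (y i + h i))
        (Set.Ioo (x j) (x j + w j) ×ˢ Set.Ioo (y j) (y j + h j))) :
    ∃ a b : ℝ, 0 ≤ a ∧ a ≤ (1 - 3 * ε) * N ∧ 0 ≤ b ∧ b ≤ (1 - 3 * ε) * N ∧
      ∀ S' : Finset ι,
        (∀ i, i ∈ S' ↔ i ∈ S ∧
          Disjoint (Set.Ioo (x i) (x i + w i) ×ˢ Set.Ioo (y i) (y i + h i))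
            (Set.Icc a (a + 3 * ε * N) ×ˢ Set.Icc 0 N) ∧
          Disjoint (Set.Ioo (x i) (x i + w i) ×ˢ Set.Ioo (y i) (y i + h i))
            (Set.Icc 0 N ×ˢ Set.Icc b (b + 3 * ε * N))) →
        (1 / 2 - 13 * ε) * ∑ i ∈ S, p i ≤ ∑ i ∈ S', p i := by
  classical
  have hL : 0 < (1 - 3 * ε) * N := mul_pos (by linarith) hN
  have hεN : 0 < ε * N := mul_pos hε0 hN
  obtain ⟨a, ha, hA⟩ := exists_mul_sum_indicator_Ioo_le S p
    (fun i => x i - 3 * ε * N) (fun i => x i + w i) hL hp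
    (fun i hi => by linarith [hwpos i hi])
  obtain ⟨b, hb, hB⟩ := exists_mul_sum_indicator_Ioo_le S p
    (fun i => y i - 3 * ε * N) (fun i => y i + h i) hL hp
    (fun i hi => by linarith [hhpos i hi])
  refine ⟨a, b, ha.1, ha.2, hb.1, hb.2, fun S' hS' => ?_⟩
  set A := fun i => (Set.Ioo (x i - 3 * ε * N) (x i + w i)).indicator (fun _ => p i) a
  set B := fun i => (Set.Ioo (y i - 3 * ε * N) (y i + h i)).indicator (fun _ => p i) b
  have hsub : S' ⊆ S := fun i hi => ((hS' i).1 hi).1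
  have hcover : ∑ i ∈ S, p i ≤ ∑ i ∈ S', p i + (∑ i ∈ S, A i + ∑ i ∈ S, B i) := by
    rw [← Finset.inter_eq_right.2 hsub, ← Finset.sum_ite_mem, ← Finset.sum_add_distrib,
      ← Finset.sum_add_distrib]
    refine Finset.sum_le_sum fun i hi => ?_
    have hA0 : 0 ≤ A i := Set.indicator_nonneg (fun _ _ => hp i hi) a
    have hB0 : 0 ≤ B i := Set.indicator_nonneg (fun _ _ => hp i hi) b
    by_cases hiA : a ∈ Set.Ioo (x i - 3 * ε * N) (x i + w i)
    · have : A i = p i := Set.indicator_of_mem hiA _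
      split_ifs <;> linarith [hp i hi]
    by_cases hiB : b ∈ Set.Ioo (y i - 3 * ε * N) (y i + h i)
    · have : B i = p i := Set.indicator_of_mem hiB _
      split_ifs <;> linarith [hp i hi]
    have hmem : i ∈ S' := by
      refine (hS' i).2 ⟨hi, ?_, ?_⟩
      · refine Set.disjoint_left.2 fun q hq hq' => hiA ⟨?_, ?_⟩
        · linarith [hq.1.1, hq'.1.2]
        · linarith [hq.1.2, hq'.1.1]
      · refine Set.disjoint_left.2 fun q hq hq' => hiB ⟨?_, ?_⟩
        · linarith [hq.2.1, hq'.2.2]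
        · linarith [hq.2.2, hq'.2.1]
    rw [if_pos hmem]
    linarith
  have hlengths : ∑ i ∈ S, p i * (x i + w i - (x i - 3 * ε * N)) +
      ∑ i ∈ S, p i * (y i + h i - (y i - 3 * ε * N)) ≤
      (1 - 3 * ε) * N * ((1 / 2 + 13 * ε) * ∑ i ∈ S, p i) := by
    rw [← Finset.sum_add_distrib, Finset.mul_sum, Finset.mul_sum]
    refine Finset.sum_le_sum fun i hi => ?_
    have hwh : w i + h i ≤ (1 / 2 + 3 * ε) * N := by
      rcases hshort i hi with ⟨h₁, h₂⟩ | ⟨h₁, h₂⟩ <;> linarith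
    have hsum : w i + h i + 6 * (ε * N) ≤ (1 - 3 * ε) * N * (1 / 2 + 13 * ε) := by
      nlinarith [mul_le_mul_of_nonneg_left hε hεN.le]
    linarith [mul_le_mul_of_nonneg_left hsum (hp i hi)]
  have hlost : ∑ i ∈ S, A i + ∑ i ∈ S, B i ≤ (1 / 2 + 13 * ε) * ∑ i ∈ S, p i :=
    le_of_mul_le_mul_left (by linarith) hL
  linarith
end
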